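/- Let U be an open subset of ℝ^D with 0 ∈ U, let r ≥ 4 be an integer and N ∈ ℕ*. Let t ↦ T_t be a C^N map from U into C^{r+1}(S¹,S¹) whose values are expanding maps of the circle with |T_t'(x)| ≥ λ^{-1} > 1 for all x ∈ S¹ and t ∈ U, and let t ↦ g_t be a C^N map from U into C^r(S¹). Set k = min(⌊r/2 − 7/4⌋, r − 4, N − 1). Then there exist R > e^{−P_0(g_0)} and a neighbourhood W of 0 in U such that: (i) for every t ∈ W the power series Σ_{n≥1} (1/n) (Σ_{x : T_t^n x = x} e^{g_{n,t}(x)} / (1 − ((T_t^n)'(x))^{-1})) z^n has nonzero radius of convergence; (ii) for every t ∈ W the map z ↦ exp(−Σ_{n≥1} (1/n) (Σ_{x : T_t^n x = x} e^{g_{n,t}(x)} / (1 − ((T_t^n)'(x))^{-1})) z^n) extends to a holomorphic function z ↦ d(z,t) on the open disc D(0,R); (iii) for every t ∈ W the real number e^{−P_t(g_t)} is the unique zero of d(·,t) in D(0,R) and it is a simple zero; (iv) the map (z,t) ↦ d(z,t) is C^k on D(0,R) × W. -/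

import Mathlib

noncomputable section

open MeasureTheory Complex Filter Set
open scoped Topology ENNReal NNReal BigOperators FourierTransform SchwartzMap

/-! ### `C^N` families of `C^r` functions -/

/-- Bundle a function of a real variable as a bounded continuous function
(junk value `0` if it is not bounded continuous). -/
def toBCF (u : ℝ → ℝ) : BoundedContinuousFunction ℝ ℝ :=
  open scoped Classical in
  if h : Continuous u ∧ ∃ C, ∀ x y, dist (u x) (u y) ≤ C then ⟨⟨u, h.1⟩, h.2⟩
  else 0

section Family
variable {P : Type*} [NormedAddCommGroup P] [NormedSpace ℝ P]

/-- `t ↦ f t` is a `C^N` map on `U` with values in the space `C^r(ℝ)`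
(of bounded `C^r` functions): each value is `C^r` and each derivative of order `≤ r`
depends on the parameter in a `C^N` way, as a bounded continuous function. -/
def CNFamily (N : ℕ) (r : ℕ) (U : Set P) (f : P → ℝ → ℝ) : Prop :=
  (∀ t ∈ U, ContDiff ℝ r (f t)) ∧
  ∀ j : ℕ, j ≤ r → ContDiffOn ℝ N (fun t => toBCF (iteratedDeriv j (f t))) U

/-- `t ↦ F t` is a `C^N` map on `U` with values in `C^r(ℝ)`, where the values may be
unbounded (e.g. diffeomorphisms of `ℝ`): the value at the base point and all
derivatives of order `1 ≤ j ≤ r` are `C^N` in the parameter. -/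
def CNFamilyU (N : ℕ) (r : ℕ) (U : Set P) (F : P → ℝ → ℝ) : Prop :=
  (∀ t ∈ U, ContDiff ℝ r (F t)) ∧
  ContDiffOn ℝ N (fun t => F t 0) U ∧
  ∀ j : ℕ, 1 ≤ j → j ≤ r → ContDiffOn ℝ N (fun t => toBCF (iteratedDeriv j (F t))) U

end Family

/-- `F` is a `C^k` diffeomorphism of `ℝ`. -/
def IsCDiffeo (k : ℕ) (F : ℝ → ℝ) : Prop :=
  ContDiff ℝ k F ∧ Function.Bijective F ∧ ∀ x, deriv F x ≠ 0

/-! ### The circle, circle maps through their lifts, periodic points, pressure -/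

/-- The circle `S¹ = ℝ/ℤ`. -/
abbrev 𝕊 : Type := UnitAddCircle

/-- The canonical representative in `[0,1)` of a point of the circle. -/
def liftRep (y : 𝕊) : ℝ := ((AddCircle.equivIco 1 0) y).1

/-- The self-map of the circle induced by a map `T : ℝ → ℝ` (meant to be applied to
lifts of circle maps, i.e. maps commuting with integer translations). -/
def circleMapC (T : ℝ → ℝ) (y : 𝕊) : 𝕊 := (T (liftRep y) : ℝ) 

/-- The function on the circle induced by a function `g : ℝ → ℝ` (meant to be applied
to `1`-periodic functions). -/
def circleFun (g : ℝ → ℝ) (y : 𝕊) : ℝ := g (liftRep y)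

/-- `T` is the lift of a degree `d` circle map. -/
def IsCircleLift (T : ℝ → ℝ) (d : ℤ) : Prop := ∀ x, T (x + 1) = T x + d

/-- Representatives in `[0,1)` of the fixed points of the `n`-th iterate of the
circle map with lift `T`. -/
def periodicPtsIn (T : ℝ → ℝ) (n : ℕ) : Set ℝ :=
  {x | x ∈ Set.Ico (0:ℝ) 1 ∧ ∃ k : ℤ, T^[n] x = x + k}

/-- Birkhoff sum `g_{n}(x) = ∑_{i<n} g(T^i x)`. -/
def birkhoff (T g : ℝ → ℝ) (n : ℕ) (x : ℝ) : ℝ :=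
  ∑ i ∈ Finset.range n, g (T^[i] x)

/-- `T` is (the lift of) a `C^r` expanding circle map with expansion constant `lam⁻¹`. -/
def IsExpandingLift (lam : ℝ) (r : ℕ) (T : ℝ → ℝ) : Prop :=
  ContDiff ℝ r T ∧ (∃ d : ℤ, IsCircleLift T d) ∧ ∀ x, lam⁻¹ ≤ |deriv T x|

/-- The topological pressure `P(T, g)` of the potential `g` for an expanding circle
map (with lift) `T`, computed through weighted periodic orbits. -/
def pressureExp (T g : ℝ → ℝ) : ℝ :=
  limsup (fun n : ℕ =>
    Real.log (∑ᶠ x ∈ periodicPtsIn T n, Real.exp (birkhoff T g n x)) / n) atTop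

section CFam
variable {P : Type*} [NormedAddCommGroup P] [NormedSpace ℝ P]

/-- `t ↦ T t` is a `C^N` family on `U`, with values in the `C^r` expanding maps of the
circle with expansion constant `lam⁻¹` (described through their lifts). -/
def ExpandingFamily (N r : ℕ) (lam : ℝ) (U : Set P) (T : P → ℝ → ℝ) : Prop :=
  (∀ t ∈ U, IsExpandingLift lam r (T t)) ∧ CNFamilyU N r U T

/-- `t ↦ g t` is a `C^N` family on `U` of `C^r` functions on the circle
(described through their `1`-periodic lifts). -/
def PotentialFamily (N r : ℕ) (U : Set P) (G : P → ℝ → ℝ) : Prop :=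
  (∀ t ∈ U, ContDiff ℝ r (G t) ∧ ∀ x, G t (x + 1) = G t x) ∧ CNFamily N r U G

end CFam

/-- The `n`-th coefficient of the logarithm of the dynamical determinant:
`(1/n) ∑_{T^n x = x} e^{g_n(x)} / (1 − ((T^n)'(x))⁻¹)` (and `0` for `n = 0`). -/
def detCoeff (T G : ℝ → ℝ) (n : ℕ) : ℂ :=
  ((n : ℂ))⁻¹ * ∑ᶠ x ∈ periodicPtsIn T n,
    ((Real.exp (birkhoff T G n x) / (1 - (deriv (T^[n]) x)⁻¹) : ℝ) : ℂ)

open scoped BoundedContinuousFunction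

set_option linter.unusedSectionVars false
set_option linter.unusedSimpArgs false

/-- Cauchy estimate for the Frechet derivative of a bounded holomorphic map. -/
theorem cauchy_fderiv {E F : Type} [NormedAddCommGroup E] [NormedSpace ℂ E]
    [NormedAddCommGroup F] [NormedSpace ℂ F] [CompleteSpace F] {f : E → F} {x : E} {ε c : ℝ}
    (hε : 0 < ε) (hc : 0 ≤ c) (hf : DifferentiableOn ℂ f (Metric.ball x (2 * ε)))
    (hb : ∀ y ∈ Metric.ball x (2 * ε), ‖f y‖ ≤ c) : ‖fderiv ℂ f x‖ ≤ c / ε := by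
  refine ContinuousLinearMap.opNorm_le_bound _ (by positivity) fun v => ?_
  by_cases hv : v = 0
  · simp [hv]
  have hv' : 0 < ‖v‖ := norm_pos_iff.2 hv
  set g : ℂ → F := fun s => f (x + s • v) with hg
  have hmem : ∀ s ∈ Metric.closedBall (0:ℂ) (ε / ‖v‖), x + s • v ∈ Metric.ball x (2 * ε) := by
    intro s hs
    have : ‖s‖ ≤ ε / ‖v‖ := by simpa using hs
    rw [Metric.mem_ball, dist_eq_norm, add_sub_cancel_left, norm_smul]
    have : ‖s‖ * ‖v‖ ≤ ε := by rwa [le_div_iff₀ hv'] at this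
    linarith
  have hline : ∀ s : ℂ, HasDerivAt (fun s : ℂ => x + s • v) v s := by
    intro s
    simpa using ((hasDerivAt_id s).smul_const v).const_add x
  have hd : ∀ s ∈ Metric.closedBall (0:ℂ) (ε / ‖v‖), DifferentiableAt ℂ g s := by
    intro s hs
    have h1 : DifferentiableAt ℂ f (x + s • v) :=
      (hf _ (hmem s hs)).differentiableAt (Metric.isOpen_ball.mem_nhds (hmem s hs))
    exact h1.comp s (hline s).differentiableAt
  have hderiv : deriv g 0 = fderiv ℂ f x v := by
    have h1 : DifferentiableAt ℂ f x := (hf x (by simp [hε])).differentiableAt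
      (Metric.isOpen_ball.mem_nhds (by simp [hε]))
    have h2 : HasFDerivAt f (fderiv ℂ f x) (x + (0:ℂ) • v) := by simpa using h1.hasFDerivAt
    exact (h2.comp_hasDerivAt (0:ℂ) (hline 0)).deriv
  have hR : 0 < ε / ‖v‖ := by positivity
  have := Complex.norm_deriv_le_of_forall_mem_sphere_norm_le (f := g) (c := 0) (C := c) hR
    (by
      apply DifferentiableOn.diffContOnCl
      rw [closure_ball _ hR.ne']
      intro s hs
      exact (hd s hs).differentiableWithinAt)
    (fun s hs => hb _ (hmem s (Metric.sphere_subset_closedBall hs)))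
  rw [hderiv] at this
  calc _ ≤ _ := this
    _ = _ := by field_simp

/-- A normally convergent series of holomorphic maps on an open set of a Banach space is smooth. -/
theorem holo_sum (k : ℕ) : ∀ {E F : Type} [NormedAddCommGroup E] [NormedSpace ℂ E]
    [NormedAddCommGroup F] [NormedSpace ℂ F] [CompleteSpace F] {f : ℕ → E → F} {V : Set E}
    {c : ℕ → ℝ}, IsOpen V → Summable c → (∀ n, ContDiffOn ℂ (k + 1 : ℕ) (f n) V) →
    (∀ n, ∀ y ∈ V, ‖f n y‖ ≤ c n) → ContDiffOn ℂ k (fun y => ∑' n, f n y) V := by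
  induction k with
  | zero =>
    intro E F _ _ _ _ _ f V c hV hc hf hb
    rw [Nat.cast_zero, contDiffOn_zero]
    exact continuousOn_tsum (fun n => (hf n).continuousOn) hc (fun n y hy => hb n y hy)
  | succ k ih =>
    intro E F _ _ _ _ _ f V c hV hc hf hb x hx
    have hdf : ∀ n, DifferentiableOn ℂ (f n) V := fun n => (hf n).differentiableOn (by simp)
    obtain ⟨ε, hε, hball⟩ := Metric.isOpen_iff.1 hV x hx
    set B := Metric.ball x (ε / 3)
    have hBV : B ⊆ V := (Metric.ball_subset_ball (by linarith)).trans hball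
    have hc0 : ∀ n, 0 ≤ c n := fun n => (norm_nonneg _).trans (hb n x hx)
    have hbd : ∀ n, ∀ y ∈ B, ‖fderiv ℂ (f n) y‖ ≤ c n / (ε / 3) := by
      intro n y hy
      have hsub : Metric.ball y (2 * (ε / 3)) ⊆ V := by
        refine Subset.trans ?_ hball
        apply Metric.ball_subset_ball'
        have : dist y x < ε / 3 := hy
        linarith
      exact cauchy_fderiv (by positivity) (hc0 n) ((hdf n).mono hsub)
        (fun z hz => hb n z (hsub hz))
    have hsum' : Summable fun n => c n / (ε / 3) := hc.div_const _
    have hxB : x ∈ B := by simp [B, hε]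
    have hfd : ∀ n, ∀ y ∈ B, HasFDerivAt (f n) (fderiv ℂ (f n) y) y := fun n y hy =>
      ((hdf n y (hBV hy)).differentiableAt (hV.mem_nhds (hBV hy))).hasFDerivAt
    have key : ∀ y ∈ B, HasFDerivAt (fun y => ∑' n, f n y) (∑' n, fderiv ℂ (f n) y) y := by
      intro y hy
      exact hasFDerivAt_tsum_of_isPreconnected hsum' Metric.isOpen_ball
        (convex_ball x _).isPreconnected hfd hbd hxB
        (Summable.of_norm_bounded hc (fun n => hb n x hx)) hy
    have hcd : ContDiffOn ℂ ((k + 1 : ℕ)) (fun y => ∑' n, f n y) B := by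
      rw [Nat.cast_add, Nat.cast_one, contDiffOn_succ_iff_fderiv_of_isOpen Metric.isOpen_ball]
      refine ⟨fun y hy => (key y hy).differentiableAt.differentiableWithinAt, by simp, ?_⟩
      have h1 : ContDiffOn ℂ k (fun y => ∑' n, fderiv ℂ (f n) y) B := by
        refine ih Metric.isOpen_ball hsum' (fun n => ?_) hbd
        have h2 := (hf n).mono hBV
        rw [Nat.cast_add, Nat.cast_one, contDiffOn_succ_iff_fderiv_of_isOpen Metric.isOpen_ball]
          at h2
        exact h2.2.2
      exact h1.congr fun y hy => (key y hy).fderiv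
    exact (hcd.contDiffAt (Metric.isOpen_ball.mem_nhds hxB)).contDiffWithinAt

/-- An iterated function system on a discrete set with an exact contraction ratio. -/
structure Sys (X J : Type) where
  κ : ℝ
  κ_pos : 0 < κ
  κ_lt : κ < 1
  δ : X → X → ℝ
  δ_self : ∀ x, δ x x = 0
  δ_pos : ∀ x y, x ≠ y → 0 < δ x y
  δ_le : ∀ x y, δ x y ≤ 1
  δ_symm : ∀ x y, δ x y = δ y x
  ψ : J → X → X
  δ_ψ : ∀ j x y, δ (ψ j x) (ψ j y) = κ * δ x y

namespace Sys

variable {X J : Type} [TopologicalSpace X] [DiscreteTopology X] (S : Sys X J)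

theorem δ_nonneg (x y : X) : 0 ≤ S.δ x y := by
  by_cases h : x = y
  · rw [h, S.δ_self]
  · exact (S.δ_pos x y h).le

/-- The Banach space of bounded Lipschitz functions, with their difference quotients. -/
def E0 : Submodule ℂ ((X →ᵇ ℂ) × ((X × X) →ᵇ ℂ)) where
  carrier := {p | (∀ x y, p.1 x - p.1 y = S.δ x y * p.2 (x, y)) ∧ ∀ x, p.2 (x, x) = 0}
  add_mem' := by
    rintro p p' ⟨h1, h2⟩ ⟨h1', h2'⟩
    refine ⟨fun x y => ?_, fun x => ?_⟩
    · have := h1 x y; have := h1' x y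
      simp only [Prod.fst_add, Prod.snd_add, BoundedContinuousFunction.coe_add, Pi.add_apply]
      linear_combination h1 x y + h1' x y
    · simp [h2, h2']
  zero_mem' := by simp
  smul_mem' := by
    rintro c p ⟨h1, h2⟩
    refine ⟨fun x y => ?_, fun x => ?_⟩
    · simp only [Prod.smul_fst, Prod.smul_snd, BoundedContinuousFunction.coe_smul, smul_eq_mul]
      linear_combination c * h1 x y
    · simp [h2]

theorem isClosed_E0 : IsClosed (S.E0 : Set ((X →ᵇ ℂ) × ((X × X) →ᵇ ℂ))) := by
  have : (S.E0 : Set ((X →ᵇ ℂ) × ((X × X) →ᵇ ℂ))) =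
      (⋂ x, ⋂ y, {p : (X →ᵇ ℂ) × ((X × X) →ᵇ ℂ) |
        p.1 x - p.1 y = (S.δ x y : ℂ) * p.2 (x, y)}) ∩
      ⋂ x, {p : (X →ᵇ ℂ) × ((X × X) →ᵇ ℂ) | p.2 (x, x) = 0} := by
    ext p
    simp [E0, Set.mem_iInter]
  rw [this]
  have c1 : ∀ x : X, Continuous fun p : (X →ᵇ ℂ) × ((X × X) →ᵇ ℂ) => p.1 x := fun x =>
    (BoundedContinuousFunction.evalCLM ℂ x).continuous.comp continuous_fst
  have c2 : ∀ x : X × X, Continuous fun p : (X →ᵇ ℂ) × ((X × X) →ᵇ ℂ) => p.2 x := fun x =>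
    (BoundedContinuousFunction.evalCLM ℂ x).continuous.comp continuous_snd
  refine IsClosed.inter (isClosed_iInter fun x => isClosed_iInter fun y => ?_)
    (isClosed_iInter fun x => ?_)
  · exact isClosed_eq ((c1 x).sub (c1 y)) (continuous_const.mul (c2 _))
  · exact isClosed_eq (c2 _) continuous_const

/-- The same space, as a type of its own. -/
def E : Type := S.E0

instance : NormedAddCommGroup S.E := inferInstanceAs (NormedAddCommGroup S.E0)
instance : NormedSpace ℂ S.E := inferInstanceAs (NormedSpace ℂ S.E0)
instance : CompleteSpace S.E := S.isClosed_E0.completeSpace_coe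

variable {S}

/-- The function underlying an element of `E`. -/
def fn (e : S.E) (x : X) : ℂ := e.1.1 x

@[simp] theorem fn_add (e e' : S.E) (x : X) : fn (e + e') x = fn e x + fn e' x := rfl
@[simp] theorem fn_sub (e e' : S.E) (x : X) : fn (e - e') x = fn e x - fn e' x := rfl
@[simp] theorem fn_smul (c : ℂ) (e : S.E) (x : X) : fn (c • e) x = c * fn e x := rfl
@[simp] theorem fn_zero (x : X) : fn (0 : S.E) x = 0 := rfl
@[simp] theorem fn_neg (e : S.E) (x : X) : fn (-e) x = - fn e x := rfl

theorem fn_diff (e : S.E) (x y : X) : fn e x - fn e y = S.δ x y * e.1.2 (x, y) := e.2.1 x y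

theorem E_ext {e e' : S.E} (h : ∀ x, fn e x = fn e' x) : e = e' := by
  apply Subtype.ext
  apply Prod.ext
  · ext x; exact h x
  · ext ⟨x, y⟩
    by_cases hxy : x = y
    · subst hxy; rw [e.2.2, e'.2.2]
    · have h1 := fn_diff e x y
      have h2 := fn_diff e' x y
      have : (S.δ x y : ℂ) ≠ 0 := by exact_mod_cast (S.δ_pos x y hxy).ne'
      apply mul_left_cancel₀ this
      rw [← h1, ← h2, h, h]

theorem norm_fn_le (e : S.E) (x : X) : ‖fn e x‖ ≤ ‖e‖ :=
  (e.1.1.norm_coe_le_norm x).trans (norm_fst_le e.1)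

theorem norm_fn_diff_le (e : S.E) (x y : X) : ‖fn e x - fn e y‖ ≤ ‖e‖ * S.δ x y := by
  rw [fn_diff, norm_mul, mul_comm, Complex.norm_real, Real.norm_of_nonneg (S.δ_nonneg x y)]
  gcongr
  · exact S.δ_nonneg x y
  · exact (e.1.2.norm_coe_le_norm _).trans (norm_snd_le e.1)

/-- Constructor of elements of `E`. -/
theorem exists_E (f : X → ℂ) (B : ℝ) (hB : 0 ≤ B) (h1 : ∀ x, ‖f x‖ ≤ B)
    (h2 : ∀ x y, ‖f x - f y‖ ≤ B * S.δ x y) : ∃ e : S.E, (∀ x, fn e x = f x) ∧ ‖e‖ ≤ B := by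
  have hq : ∀ p : X × X, ‖(f p.1 - f p.2) / S.δ p.1 p.2‖ ≤ B := by
    rintro ⟨x, y⟩
    rw [norm_div, Complex.norm_real, Real.norm_of_nonneg (S.δ_nonneg _ _)]
    exact div_le_of_le_mul₀ (S.δ_nonneg _ _) hB (h2 x y)
  refine ⟨⟨(BoundedContinuousFunction.ofNormedAddCommGroup f continuous_of_discreteTopology B h1,
    BoundedContinuousFunction.ofNormedAddCommGroup
      (fun p : X × X => (f p.1 - f p.2) / S.δ p.1 p.2) continuous_of_discreteTopology B hq), ?_, ?_⟩,
      fun x => rfl, ?_⟩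
  · intro x y
    simp only [BoundedContinuousFunction.coe_ofNormedAddCommGroup]
    by_cases hxy : x = y
    · simp [hxy]
    · have : (S.δ x y : ℂ) ≠ 0 := by exact_mod_cast (S.δ_pos x y hxy).ne'
      field_simp
  · intro x
    simp
  · refine norm_prod_le_iff.2 ⟨?_, ?_⟩
    · exact (BoundedContinuousFunction.norm_le hB).2 h1
    · exact (BoundedContinuousFunction.norm_le hB).2 hq

theorem norm_le_of {e : S.E} {B : ℝ} (hB : 0 ≤ B) (h1 : ∀ x, ‖fn e x‖ ≤ B)
    (h2 : ∀ x y, ‖fn e x - fn e y‖ ≤ B * S.δ x y) : ‖e‖ ≤ B := by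
  obtain ⟨e', h, hn⟩ := exists_E (S := S) (fn e) B hB h1 h2
  rwa [E_ext h] at hn

/-- Evaluation at a point. -/
def ev (x : X) : S.E →L[ℂ] ℂ :=
  LinearMap.mkContinuous { toFun := fun e => fn e x, map_add' := fun _ _ => rfl,
                           map_smul' := fun _ _ => rfl } 1
    (fun e => by rw [one_mul]; exact norm_fn_le e x)

@[simp] theorem ev_apply (x : X) (e : S.E) : ev x e = fn e x := rfl

theorem exists_mul (e e' : S.E) :
    ∃ p : S.E, (∀ x, fn p x = fn e x * fn e' x) ∧ ‖p‖ ≤ 2 * ‖e‖ * ‖e'‖ := by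
  refine exists_E _ _ (by positivity) (fun x => ?_) (fun x y => ?_)
  · rw [norm_mul]
    have := mul_le_mul (norm_fn_le e x) (norm_fn_le e' x) (norm_nonneg _) (norm_nonneg _)
    nlinarith [norm_nonneg e, norm_nonneg e', mul_nonneg (norm_nonneg e) (norm_nonneg e')]
  · have : fn e x * fn e' x - fn e y * fn e' y =
      fn e x * (fn e' x - fn e' y) + (fn e x - fn e y) * fn e' y := by ring
    rw [this]
    refine (norm_add_le _ _).trans ?_
    rw [norm_mul, norm_mul]
    have h1 := mul_le_mul (norm_fn_le e x) (norm_fn_diff_le e' x y) (norm_nonneg _) (norm_nonneg _)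
    have h2 := mul_le_mul (norm_fn_diff_le e x y) (norm_fn_le e' y) (norm_nonneg _)
      (mul_nonneg (norm_nonneg _) (S.δ_nonneg _ _))
    linarith

/-- Product of two elements. -/
def mulE (e e' : S.E) : S.E := (exists_mul e e').choose

theorem fn_mulE (e e' : S.E) (x : X) : fn (mulE e e') x = fn e x * fn e' x :=
  (exists_mul e e').choose_spec.1 x

/-- Multiplication as a continuous bilinear map. -/
def mulL : S.E →L[ℂ] S.E →L[ℂ] S.E :=
  LinearMap.mkContinuous₂
    (LinearMap.mk₂ ℂ (fun e e' => mulE e e')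
      (fun a b c => E_ext fun x => by
        simp only [fn_add, fn_mulE]; ring)
      (fun a b c => E_ext fun x => by
        simp only [fn_smul, fn_mulE]; ring)
      (fun a b c => E_ext fun x => by
        simp only [fn_add, fn_mulE]; ring)
      (fun a b c => E_ext fun x => by
        simp only [fn_smul, fn_mulE]; ring)) 2
    (fun a b => (exists_mul a b).choose_spec.2)

@[simp] theorem fn_mulL (e e' : S.E) (x : X) : fn (mulL e e') x = fn e x * fn e' x :=
  (exists_mul e e').choose_spec.1 x

theorem norm_mulL_le (e e' : S.E) : ‖mulL e e'‖ ≤ 2 * ‖e‖ * ‖e'‖ :=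
  (exists_mul e e').choose_spec.2

theorem exists_comp (j : J) (e : S.E) : ∃ p : S.E, (∀ x, fn p x = fn e (S.ψ j x)) ∧ ‖p‖ ≤ 1 * ‖e‖ := by
  rw [one_mul]
  refine exists_E _ _ (norm_nonneg _) (fun x => norm_fn_le _ _) (fun x y => ?_)
  refine (norm_fn_diff_le e _ _).trans ?_
  rw [S.δ_ψ]
  gcongr
  nlinarith [S.κ_lt, S.δ_nonneg x y]

/-- Composition with a contraction. -/
def compE (j : J) (e : S.E) : S.E := (exists_comp j e).choose

theorem fn_compE (j : J) (e : S.E) (x : X) : fn (compE j e) x = fn e (S.ψ j x) :=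
  (exists_comp j e).choose_spec.1 x

/-- Composition with a contraction, as a continuous linear map. -/
def compL (j : J) : S.E →L[ℂ] S.E :=
  LinearMap.mkContinuous
    { toFun := fun e => compE j e
      map_add' := fun a b => E_ext fun x => by
        simp only [fn_add, fn_compE]
      map_smul' := fun a b => E_ext fun x => by
        simp only [fn_smul, fn_compE, RingHom.id_apply] } 1
    (fun a => (exists_comp j a).choose_spec.2)

@[simp] theorem fn_compL (j : J) (e : S.E) (x : X) : fn (compL j e) x = fn e (S.ψ j x) :=
  (exists_comp j e).choose_spec.1 x

theorem norm_compL_le (j : J) (e : S.E) : ‖compL j e‖ ≤ ‖e‖ := by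
  exact ((exists_comp j e).choose_spec.2).trans_eq (one_mul _)

theorem exists_one : ∃ e : S.E, (∀ x, fn e x = 1) ∧ ‖e‖ ≤ 1 :=
  exists_E _ _ zero_le_one (fun x => by simp) (fun x y => by simp [S.δ_nonneg x y])

variable (S) in
/-- The constant function one. -/
def oneE : S.E := (exists_one (S := S)).choose

@[simp] theorem fn_oneE (x : X) : fn (oneE S) x = 1 := (exists_one (S := S)).choose_spec.1 x

theorem norm_oneE_le : ‖oneE S‖ ≤ 1 := (exists_one (S := S)).choose_spec.2

@[simp] theorem fn_sum {ι : Type} (s : Finset ι) (f : ι → S.E) (x : X) :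
    fn (∑ i ∈ s, f i) x = ∑ i ∈ s, fn (f i) x := by
  exact map_sum (ev (S := S) x) f s

variable [Fintype J]

variable (S) in
/-- The transfer operator, bilinear in the weight and the function. -/
def LL : S.E →L[ℂ] S.E →L[ℂ] S.E :=
  ∑ j : J, (ContinuousLinearMap.compL ℂ S.E S.E S.E (compL j)).comp mulL

theorem LL_apply (u f : S.E) : LL S u f = ∑ j : J, compL j (mulL u f) := by
  simp [LL]

@[simp] theorem fn_LL (u f : S.E) (x : X) :
    fn (LL S u f) x = ∑ j : J, fn u (S.ψ j x) * fn f (S.ψ j x) := by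
  simp [LL_apply]

end Sys

theorem exp_gap {s t : ℝ} (_ : s ≤ t) : Real.exp t - Real.exp s ≤ (t - s) * Real.exp t := by
  have := Real.add_one_le_exp (s - t)
  have h2 : Real.exp s = Real.exp t * Real.exp (s - t) := by rw [← Real.exp_add]; ring_nf
  nlinarith [Real.exp_pos t]

theorem exp_gap' {s t : ℝ} : (t - s) * Real.exp s ≤ Real.exp t - Real.exp s := by
  have := Real.add_one_le_exp (t - s)
  have h2 : Real.exp t = Real.exp s * Real.exp (t - s) := by rw [← Real.exp_add]; ring_nf
  nlinarith [Real.exp_pos s]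

namespace Sys
variable {X J : Type} [TopologicalSpace X] [DiscreteTopology X] {S : Sys X J}

@[simp] theorem fn_rsmul (c : ℝ) (e : S.E) (x : X) : fn (c • e) x = (c : ℂ) * fn e x := by
  rw [← Complex.coe_smul, fn_smul]

/-- The cone of log-Lipschitz nonnegative functions. -/
structure Cone (a : ℝ) (e : S.E) : Prop where
  im : ∀ x, (fn e x).im = 0
  nonneg : ∀ x, 0 ≤ (fn e x).re
  le : ∀ x y, (fn e x).re ≤ Real.exp (a * S.δ x y) * (fn e y).re

namespace Cone
variable {a b a' : ℝ} {e f g u : S.E}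

theorem mono (h : Cone a e) (hab : a ≤ b) : Cone b e :=
  ⟨h.im, h.nonneg, fun x y => (h.le x y).trans (by
    gcongr
    · exact h.nonneg y
    · exact S.δ_nonneg x y)⟩

theorem add (h : Cone a e) (h' : Cone a f) : Cone a (e + f) :=
  ⟨fun x => by simp [h.im, h'.im], fun x => by simpa using add_nonneg (h.nonneg x) (h'.nonneg x),
    fun x y => by
      have := h.le x y; have := h'.le x y
      simp only [fn_add, Complex.add_re]; linarith⟩

theorem smul {c : ℝ} (hc : 0 ≤ c) (h : Cone a e) : Cone a ((c : ℂ) • e) :=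
  ⟨fun x => by simp [h.im], fun x => by simpa using mul_nonneg hc (h.nonneg x),
    fun x y => by
      have := mul_le_mul_of_nonneg_left (h.le x y) hc
      simp only [fn_smul, Complex.re_ofReal_mul]; linarith⟩

theorem zero : Cone a (0 : S.E) := ⟨by simp, by simp, by simp⟩

theorem sum {ι : Type} (s : Finset ι) (F : ι → S.E) (h : ∀ i ∈ s, Cone a (F i)) :
    Cone a (∑ i ∈ s, F i) :=
  Finset.sum_induction F (Cone a) (fun _ _ h h' => h.add h') zero h

theorem one (ha : 0 ≤ a) : Cone a (oneE S) :=
  ⟨by simp, by simp, fun x y => by simpa using mul_nonneg ha (S.δ_nonneg x y)⟩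

theorem mul (h : Cone a e) (h' : Cone b f) : Cone (a + b) (mulL e f) := by
  refine ⟨fun x => by simp [h.im, h'.im], fun x => ?_, fun x y => ?_⟩
  · simpa [h.im, h'.im] using mul_nonneg (h.nonneg x) (h'.nonneg x)
  · have := mul_le_mul (h.le x y) (h'.le x y) (h'.nonneg x)
      (mul_nonneg (Real.exp_pos _).le (h.nonneg y))
    simp only [fn_mulL, Complex.mul_re, h.im, h'.im, mul_zero, sub_zero, add_mul, Real.exp_add]
    linarith

theorem comp (j : J) (h : Cone a e) : Cone (S.κ * a) (compL j e) :=
  ⟨fun x => by simp [h.im], fun x => by simpa using h.nonneg _, fun x y => by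
    have := h.le (S.ψ j x) (S.ψ j y)
    rw [S.δ_ψ] at this
    simp only [fn_compL]
    convert this using 3
    ring⟩

theorem transfer [Fintype J] (hu : Cone b u) (h : Cone a e) : Cone (S.κ * (b + a)) (LL S u e) := by
  rw [LL_apply]
  exact sum _ _ fun j _ => (hu.mul h).comp j

theorem le_exp (ha : 0 ≤ a) (h : Cone a e) (x y : X) :
    (fn e x).re ≤ Real.exp a * (fn e y).re := by
  refine (h.le x y).trans ?_
  gcongr
  · exact h.nonneg y
  · nlinarith [S.δ_le x y, S.δ_nonneg x y]

theorem norm_fn (h : Cone a e) (x : X) : ‖fn e x‖ = (fn e x).re := by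
  have : fn e x = ((fn e x).re : ℂ) := Complex.ext (by simp) (by simp [h.im])
  rw [this, Complex.norm_real, Real.norm_of_nonneg (h.nonneg x), Complex.ofReal_re]

theorem norm_le (ha : 0 ≤ a) (h : Cone a e) (x0 : X) :
    ‖e‖ ≤ ((1 + a) * Real.exp (2 * a)) * (fn e x0).re := by
  have h0 := h.nonneg x0
  have hE : 1 ≤ Real.exp a := by simpa using Real.exp_le_exp.2 ha
  have h2 : Real.exp (2 * a) = Real.exp a * Real.exp a := by rw [← Real.exp_add]; ring_nf
  have hup : ∀ x, (fn e x).re ≤ Real.exp a * (fn e x0).re := fun x => h.le_exp ha x x0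
  refine norm_le_of (by positivity) (fun x => ?_) (fun x y => ?_)
  · rw [h.norm_fn, h2]
    refine (hup x).trans ?_
    gcongr
    nlinarith [mul_nonneg ha (mul_nonneg (Real.exp_pos a).le (Real.exp_pos a).le), Real.exp_pos a]
  · have hs : fn e x - fn e y = (((fn e x).re - (fn e y).re : ℝ) : ℂ) :=
      Complex.ext (by simp) (by simp [h.im])
    have key : ∀ x y, (fn e x).re - (fn e y).re ≤
        (1 + a) * Real.exp (2 * a) * (fn e x0).re * S.δ x y := by
      intro x y
      have hd := S.δ_nonneg x y
      have h3 := h.le x y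
      have h4 := exp_gap (mul_nonneg ha hd)
      have h5 : Real.exp (a * S.δ x y) ≤ Real.exp a := by
        gcongr
        nlinarith [S.δ_le x y]
      rw [Real.exp_zero] at h4
      calc (fn e x).re - (fn e y).re ≤ (Real.exp (a * S.δ x y) - 1) * (fn e y).re := by linarith
        _ ≤ ((a * S.δ x y - 0) * Real.exp a) * (fn e y).re := by
            gcongr
            · exact h.nonneg y
            · refine h4.trans ?_
              rw [sub_zero]
              gcongr
        _ ≤ ((a * S.δ x y - 0) * Real.exp a) * (Real.exp a * (fn e x0).re) := by
            gcongr
            · rw [sub_zero]; positivity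
            · exact hup y
        _ = a * (Real.exp (2 * a) * (fn e x0).re * S.δ x y) := by rw [h2]; ring
        _ ≤ (1 + a) * (Real.exp (2 * a) * (fn e x0).re * S.δ x y) := by
            gcongr
            linarith
        _ = _ := by ring
    rw [hs, Complex.norm_real, Real.norm_eq_abs, abs_le]
    have k1 := key x y
    have k2 := key y x
    rw [S.δ_symm y x] at k2
    constructor <;> linarith

theorem compare (ha : 0 ≤ a') (haa : a' < a) (hf : Cone a' f) (hg : Cone a' g) (x0 : X) {η : ℝ}
    (hη : 0 ≤ η) (h1 : η * (a + a') * Real.exp (3 * a) * (fn g x0).re ≤ (a - a') * (fn f x0).re)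
    (h2 : η * Real.exp (2 * a) * (fn g x0).re ≤ (fn f x0).re) : Cone a (f - (η : ℂ) • g) := by
  have hfa := hf.mono haa.le
  have hga := hg.mono haa.le
  have ha0 : 0 ≤ a := ha.trans haa.le
  have e2 : Real.exp (2 * a) = Real.exp a * Real.exp a := by rw [← Real.exp_add]; ring_nf
  have e3 : Real.exp (3 * a) = Real.exp a * Real.exp a * Real.exp a := by
    rw [← Real.exp_add, ← Real.exp_add]; ring_nf
  have hEp := Real.exp_pos a
  refine ⟨fun x => by simp [hf.im, hg.im], fun x => ?_, fun x y => ?_⟩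
  · simp only [fn_sub, fn_smul, Complex.sub_re, Complex.re_ofReal_mul, sub_nonneg]
    have k1 := hfa.le_exp ha0 x0 x
    have k2 := hga.le_exp ha0 x x0
    have : Real.exp a * (η * (fn g x).re) ≤ Real.exp a * (fn f x).re := by
      calc _ ≤ Real.exp a * (η * (Real.exp a * (fn g x0).re)) := by gcongr
        _ = η * Real.exp (2 * a) * (fn g x0).re := by rw [e2]; ring
        _ ≤ _ := h2.trans k1
    exact le_of_mul_le_mul_left this hEp
  · simp only [fn_sub, fn_smul, Complex.sub_re, Complex.re_ofReal_mul]
    set d := S.δ x y with hd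
    have hd0 : 0 ≤ d := S.δ_nonneg x y
    have k1 := hfa.le_exp ha0 x0 y
    have k2 := hga.le_exp ha0 y x0
    have hgy := hg.nonneg y
    have hfy := hf.nonneg y
    -- η(a+a')e^a g(y) ≤ (a-a') f(y)
    have k3 : η * (a + a') * Real.exp a * (fn g y).re ≤ (a - a') * (fn f y).re := by
      have : Real.exp a * (η * (a + a') * Real.exp a * (fn g y).re) ≤
          Real.exp a * ((a - a') * (fn f y).re) := by
        calc _ ≤ Real.exp a * (η * (a + a') * Real.exp a * (Real.exp a * (fn g x0).re)) := by
              gcongr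
          _ = η * (a + a') * Real.exp (3 * a) * (fn g x0).re := by rw [e3]; ring
          _ ≤ (a - a') * (fn f x0).re := h1
          _ ≤ (a - a') * (Real.exp a * (fn f y).re) := by
              gcongr
          _ = _ := by ring
      exact le_of_mul_le_mul_left this hEp
    have k4 := hf.le x y
    have k5 := hg.le y x
    rw [S.δ_symm y x, ← hd] at k5
    rw [← hd] at k4
    -- g x ≥ e^{-a'd} g y
    have k6 : Real.exp (-(a' * d)) * (fn g y).re ≤ (fn g x).re := by
      have : Real.exp (-(a' * d)) * (fn g y).re ≤
        Real.exp (-(a' * d)) * (Real.exp (a' * d) * (fn g x).re) := by gcongr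
      rwa [← mul_assoc, ← Real.exp_add, neg_add_cancel, Real.exp_zero, one_mul] at this
    have k7 := exp_gap (s := -(a' * d)) (t := a * d) (by nlinarith [mul_nonneg ha hd0])
    have k8 := exp_gap' (s := a' * d) (t := a * d)
    have k9 : (a * d - a' * d) ≤ (a * d - a' * d) * Real.exp (a' * d) := by
      have : 1 ≤ Real.exp (a' * d) := by simpa using Real.exp_le_exp.2 (mul_nonneg ha hd0)
      have : 0 ≤ a * d - a' * d := by nlinarith
      nlinarith
    have k10 : Real.exp (a * d) ≤ Real.exp a := by
      gcongr
      nlinarith [S.δ_le x y]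
    have k11 : (a * d - -(a' * d)) * Real.exp (a * d) ≤ ((a + a') * d) * Real.exp a := by
      rw [show a * d - -(a' * d) = (a + a') * d by ring]
      gcongr
    have m1 : η * (Real.exp (a * d) * (fn g y).re - (fn g x).re) ≤
        η * (((a + a') * d) * Real.exp a * (fn g y).re) := by
      gcongr
      nlinarith
    have m2 : (a - a') * d * (fn f y).re ≤ Real.exp (a * d) * (fn f y).re - (fn f x).re := by
      nlinarith
    nlinarith [mul_le_mul_of_nonneg_right k3 hd0]

end Cone

theorem isClosed_cone (a : ℝ) : IsClosed {e : S.E | Cone a e} := by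
  have c : ∀ x : X, Continuous fun e : S.E => fn e x := fun x => (ev (S := S) x).continuous
  have : {e : S.E | Cone a e} = (⋂ x, {e : S.E | (fn e x).im = 0}) ∩
      ((⋂ x, {e : S.E | 0 ≤ (fn e x).re}) ∩
        ⋂ x, ⋂ y, {e : S.E | (fn e x).re ≤ Real.exp (a * S.δ x y) * (fn e y).re}) := by
    ext e
    simp only [Set.mem_ofPred_eq, mem_inter_iff, mem_iInter]
    exact ⟨fun h => ⟨h.im, h.nonneg, h.le⟩, fun h => ⟨h.1, h.2.1, h.2.2⟩⟩
  rw [this]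
  refine (isClosed_iInter fun x => ?_).inter ((isClosed_iInter fun x => ?_).inter
    (isClosed_iInter fun x => isClosed_iInter fun y => ?_))
  · exact isClosed_eq (Complex.continuous_im.comp (c x)) continuous_const
  · exact isClosed_le continuous_const (Complex.continuous_re.comp (c x))
  · exact isClosed_le (Complex.continuous_re.comp (c x))
      (continuous_const.mul (Complex.continuous_re.comp (c y)))

/-- A real function plus a large constant is in the cone. -/
theorem cone_add_const {a : ℝ} (ha : 0 < a) (e : S.E) (him : ∀ x, (fn e x).im = 0) {c : ℝ}
    (hc : ‖e‖ * (1 + 1 / a) ≤ c) : Cone a (e + (c : ℂ) • oneE S) := by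
  have hc' : ‖e‖ + ‖e‖ / a ≤ c := by rw [mul_add, mul_one, mul_one_div] at hc; exact hc
  have hn : 0 ≤ ‖e‖ / a := by positivity
  have hre : ∀ x, -‖e‖ ≤ (fn e x).re := fun x =>
    neg_le_of_abs_le ((Complex.abs_re_le_norm _).trans (norm_fn_le e x))
  refine ⟨fun x => by simp [him], fun x => ?_, fun x y => ?_⟩
  · simp; linarith [hre x]
  · simp only [fn_add, fn_smul, fn_oneE, mul_one, Complex.add_re, Complex.ofReal_re]
    have h1 : (fn e x).re - (fn e y).re ≤ ‖e‖ * S.δ x y := by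
      rw [← Complex.sub_re]
      exact (Complex.re_le_norm _).trans (norm_fn_diff_le e x y)
    have h2 := Real.add_one_le_exp (a * S.δ x y)
    have hd := S.δ_nonneg x y
    have h3 : ‖e‖ / a ≤ (fn e y).re + c := by linarith [hre y]
    have h4 : ‖e‖ * S.δ x y ≤ a * S.δ x y * ((fn e y).re + c) := by
      calc ‖e‖ * S.δ x y = a * S.δ x y * (‖e‖ / a) := by field_simp
        _ ≤ _ := by gcongr
    have h5 : (a * S.δ x y) * ((fn e y).re + c) ≤
      (Real.exp (a * S.δ x y) - 1) * ((fn e y).re + c) := by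
      apply mul_le_mul_of_nonneg_right _ (hn.trans h3)
      linarith
    nlinarith

end Sys

namespace Sys
variable {X J : Type} [TopologicalSpace X] [DiscreteTopology X] {S : Sys X J} [Fintype J]

/-- Constants for the cone contraction. -/
theorem exists_eta {a a' : ℝ} (ha : 0 ≤ a') (haa : a' < a) : ∃ η : ℝ, 0 < η ∧ η < 1 ∧
    η * (a + a') * Real.exp (3 * a) ≤ (a - a') / 2 ∧ η * Real.exp (2 * a) ≤ 1 / 2 := by
  have h1 : 0 < (a + a') * Real.exp (3 * a) := by
    have := Real.exp_pos (3 * a); have : 0 < a + a' := by linarith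
    positivity
  have h2 := Real.exp_pos (2 * a)
  have h3 : 1 ≤ Real.exp (2 * a) := by
    have : (0:ℝ) ≤ 2 * a := by linarith
    simpa using Real.exp_le_exp.2 this
  refine ⟨min ((a - a') / 2 / ((a + a') * Real.exp (3 * a))) (1 / 2 / Real.exp (2 * a)), ?_, ?_, ?_, ?_⟩
  · have : 0 < a - a' := by linarith
    positivity
  · refine (min_le_right _ _).trans_lt ?_
    rw [div_lt_one h2]; linarith
  · rw [mul_assoc, ← le_div_iff₀ h1]; exact min_le_left _ _
  · rw [← le_div_iff₀ h2]; exact min_le_right _ _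

theorem cone_bounds {a a' η : ℝ} (ha : 0 ≤ a') (haa : a' < a) (hη0 : 0 < η)
    (hη1 : η * (a + a') * Real.exp (3 * a) ≤ (a - a') / 2) (hη2 : η * Real.exp (2 * a) ≤ 1 / 2)
    (x0 : X) {f g : S.E} (hf : Cone a' f) (hg : Cone a' g) {c d : ℝ} (hc : 0 ≤ c) (hd : 0 ≤ d)
    (hcd : d * (fn g x0).re ≤ 2 * (c * (fn f x0).re)) :
    Cone a ((c : ℂ) • f - ((η * d : ℝ) : ℂ) • g) := by
  have := Cone.compare ha haa (hf.smul hc) (hg.smul hd) x0 hη0.le ?_ ?_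
  · convert this using 2
    rw [smul_smul]; push_cast; rfl
  · simp only [fn_smul, Complex.re_ofReal_mul]
    have hg0 := mul_nonneg hd (hg.nonneg x0)
    calc _ ≤ (a - a') / 2 * (d * (fn g x0).re) := by gcongr
      _ ≤ (a - a') / 2 * (2 * (c * (fn f x0).re)) := by
        gcongr
      _ = _ := by ring
  · simp only [fn_smul, Complex.re_ofReal_mul]
    have hg0 := mul_nonneg hd (hg.nonneg x0)
    calc _ ≤ 1 / 2 * (d * (fn g x0).re) := by gcongr
      _ ≤ 1 / 2 * (2 * (c * (fn f x0).re)) := by gcongr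
      _ = _ := by ring

/-- One step of the contraction of the projective distance. -/
theorem cone_step {a b η : ℝ} (ha : 0 ≤ S.κ * (b + a)) (haa : S.κ * (b + a) < a) (hη0 : 0 < η)
    (hη1 : η * (a + S.κ * (b + a)) * Real.exp (3 * a) ≤ (a - S.κ * (b + a)) / 2)
    (hη2 : η * Real.exp (2 * a) ≤ 1 / 2) (x0 : X) {u f g : S.E} (hu : Cone b u) (hg : Cone a g)
    {A B : ℝ} (hAB : A ≤ B) (h1 : Cone a (f - (A : ℂ) • g)) (h2 : Cone a ((B : ℂ) • g - f)) :
    ∃ A' B' : ℝ, A ≤ A' ∧ B' ≤ B ∧ A' ≤ B' ∧ B' - A' ≤ (1 - η) * (B - A) ∧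
      Cone a (LL S u f - (A' : ℂ) • LL S u g) ∧ Cone a ((B' : ℂ) • LL S u g - LL S u f) := by
  have hη3 : η ≤ 1 / 2 := by
    have ha0 : 0 ≤ a := ha.trans haa.le
    have : 1 ≤ Real.exp (2 * a) := by simpa using Real.exp_le_exp.2 (by linarith : (0:ℝ) ≤ 2 * a)
    nlinarith
  have hp := hu.transfer h1
  have hq := hu.transfer h2
  have hG := hu.transfer hg
  have hBA : 0 ≤ B - A := by linarith
  have hsum : (fn (LL S u (f - (A : ℂ) • g)) x0).re + (fn (LL S u ((B : ℂ) • g - f)) x0).re =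
      (B - A) * (fn (LL S u g) x0).re := by
    simp only [map_sub, map_smul, fn_sub, fn_smul, Complex.sub_re, Complex.re_ofReal_mul]
    ring
  rcases le_total ((B - A) * (fn (LL S u g) x0).re)
    (2 * (1 * (fn (LL S u (f - (A : ℂ) • g)) x0).re)) with h | h
  · have := cone_bounds ha haa hη0 hη1 hη2 x0 hp hG zero_le_one hBA h
    refine ⟨A + η * (B - A), B, by nlinarith [mul_nonneg hη0.le hBA], le_rfl, by nlinarith,
      by linarith, ?_, ?_⟩
    · convert this using 1
      rw [map_sub, map_smul]
      push_cast
      module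
    · convert hq.mono haa.le using 1
      rw [map_sub, map_smul]
  · have h' : (B - A) * (fn (LL S u g) x0).re ≤
        2 * (1 * (fn (LL S u ((B : ℂ) • g - f)) x0).re) := by linarith
    have := cone_bounds ha haa hη0 hη1 hη2 x0 hq hG zero_le_one hBA h'
    refine ⟨A, B - η * (B - A), le_rfl, by nlinarith [mul_nonneg hη0.le hBA], by nlinarith,
      by linarith, ?_, ?_⟩
    · convert hp.mono haa.le using 1
      rw [map_sub, map_smul]
    · convert this using 1
      rw [map_sub, map_smul]
      push_cast
      module

theorem cone_iter {a b η : ℝ} (ha : 0 ≤ S.κ * (b + a)) (haa : S.κ * (b + a) < a) (hη0 : 0 < η)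
    (hη4 : η < 1)
    (hη1 : η * (a + S.κ * (b + a)) * Real.exp (3 * a) ≤ (a - S.κ * (b + a)) / 2)
    (hη2 : η * Real.exp (2 * a) ≤ 1 / 2) (x0 : X) {u f g : S.E} (hu : Cone b u) (hg : Cone a g)
    {A B : ℝ} (hAB : A ≤ B) (h1 : Cone a (f - (A : ℂ) • g)) (h2 : Cone a ((B : ℂ) • g - f))
    (n : ℕ) :
    Cone a (((LL S u) ^ n) g) ∧
    ∃ A' B' : ℝ, A ≤ A' ∧ B' ≤ B ∧ A' ≤ B' ∧ B' - A' ≤ (1 - η) ^ n * (B - A) ∧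
      Cone a (((LL S u) ^ n) f - (A' : ℂ) • ((LL S u) ^ n) g) ∧
      Cone a ((B' : ℂ) • ((LL S u) ^ n) g - ((LL S u) ^ n) f) := by
  induction n with
  | zero => exact ⟨by simpa using hg, A, B, le_rfl, le_rfl, hAB, by simp, by simpa using h1,
      by simpa using h2⟩
  | succ n ih =>
    obtain ⟨hgn, A1, B1, hA, hB, hAB1, hgap, i1, i2⟩ := ih
    obtain ⟨A2, B2, hA2, hB2, hAB2, hgap2, j1, j2⟩ :=
      cone_step ha haa hη0 hη1 hη2 x0 hu hgn hAB1 i1 i2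
    have e : ∀ z, ((LL S u) ^ (n + 1)) z = LL S u (((LL S u) ^ n) z) := fun z => by
      rw [pow_succ']; rfl
    rw [e, e]
    refine ⟨(hu.transfer hgn).mono haa.le, A2, B2, hA.trans hA2, hB2.trans hB, hAB2, ?_, j1, j2⟩
    calc _ ≤ (1 - η) * (B1 - A1) := hgap2
      _ ≤ (1 - η) * ((1 - η) ^ n * (B - A)) := by gcongr
      _ = _ := by ring

theorem cone_pos_of {a : ℝ} (ha : 0 ≤ a) {e : S.E} (h : Cone a e) {x0 : X}
    (hx : 0 < (fn e x0).re) (x : X) : 0 < (fn e x).re := by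
  have := h.le_exp ha x0 x
  have h2 := Real.exp_pos a
  by_contra hc
  push Not at hc
  nlinarith

theorem transfer_pos [Nonempty J] {b a : ℝ} {u e : S.E} (hu : Cone b u) (_ : Cone a e)
    (hup : ∀ x, 0 < (fn u x).re) (hep : ∀ x, 0 < (fn e x).re) (x : X) :
    0 < (fn (LL S u e) x).re := by
  rw [fn_LL, Complex.re_sum]
  refine Finset.sum_pos (fun j _ => ?_) Finset.univ_nonempty
  rw [Complex.mul_re, hu.im, zero_mul, sub_zero]
  exact mul_pos (hup _) (hep _)

/-- Existence of the leading eigenfunction. -/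
theorem exists_eigen [Nonempty J] {a b η : ℝ} (ha : 0 ≤ S.κ * (b + a)) (haa : S.κ * (b + a) < a)
    (hη0 : 0 < η) (hη4 : η < 1)
    (hη1 : η * (a + S.κ * (b + a)) * Real.exp (3 * a) ≤ (a - S.κ * (b + a)) / 2)
    (hη2 : η * Real.exp (2 * a) ≤ 1 / 2) (x0 : X) {u : S.E} (hu : Cone b u)
    (hup : ∀ x, 0 < (fn u x).re) :
    ∃ (h : S.E) (l : ℝ), 0 < l ∧ Cone (S.κ * (b + a)) h ∧ fn h x0 = 1 ∧
      LL S u h = (l : ℂ) • h := by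
  set L := LL S u with hL
  set a' := S.κ * (b + a) with ha'
  have ha0 : 0 ≤ a := ha.trans haa.le
  set v : ℕ → S.E := fun n => (L ^ (n + 1)) (oneE S) with hv
  have hvs : ∀ n, v (n + 1) = L (v n) := fun n => by simp only [hv]; rw [pow_succ']; rfl
  have hvp : ∀ n, Cone a' (v n) ∧ ∀ x, 0 < (fn (v n) x).re := by
    intro n
    induction n with
    | zero =>
      have e : v 0 = L (oneE S) := by simp [hv]
      rw [e]
      exact ⟨hu.transfer (Cone.one ha0),
        transfer_pos hu (Cone.one ha0) hup (by simp)⟩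
    | succ n ih =>
      rw [hvs]
      exact ⟨hu.transfer (ih.1.mono haa.le), transfer_pos hu ih.1 hup ih.2⟩
  set s : ℕ → ℝ := fun n => (fn (v n) x0).re with hs
  have hsp : ∀ n, 0 < s n := fun n => (hvp n).2 x0
  have hfv : ∀ n, fn (v n) x0 = (s n : ℂ) := fun n =>
    Complex.ext (by simp [hs]) (by simp [(hvp n).1.im])
  -- initial comparison
  have c1 := cone_bounds (x0 := x0) ha haa hη0 hη1 hη2 (hvp 1).1 (hvp 0).1 (c := 1) (d := s 1 / s 0)
    zero_le_one (div_pos (hsp 1) (hsp 0)).le (by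
      change s 1 / s 0 * s 0 ≤ 2 * (1 * s 1)
      rw [div_mul_cancel₀ _ (hsp 0).ne']; linarith [hsp 1])
  have c2 := cone_bounds (x0 := x0) ha haa hη0 hη1 hη2 (hvp 0).1 (hvp 1).1
    (c := s 1 / s 0 / η) (d := 1 / η)
    (div_pos (div_pos (hsp 1) (hsp 0)) hη0).le (by positivity) (by
      change 1 / η * s 1 ≤ 2 * (s 1 / s 0 / η * s 0)
      have h1 := hsp 1
      have h0 := hsp 0
      have : s 1 / s 0 / η * s 0 = 1 / η * s 1 := by field_simp
      rw [this]
      have : 0 < 1 / η * s 1 := by positivity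
      linarith)
  set A := η * (s 1 / s 0) with hA
  set B := s 1 / s 0 / η with hB
  have hApos : 0 < A := mul_pos hη0 (div_pos (hsp 1) (hsp 0))
  have hAB : A ≤ B := by
    rw [hA, hB, le_div_iff₀ hη0]
    have := div_pos (hsp 1) (hsp 0)
    nlinarith [mul_pos hη0 this]
  have c1' : Cone a (v 1 - (A : ℂ) • v 0) := by
    convert c1 using 2
    simp
  have c2' : Cone a ((B : ℂ) • v 0 - v 1) := by
    convert c2 using 2
    rw [mul_one_div_cancel hη0.ne']; simp
  have key := cone_iter ha haa hη0 hη4 hη1 hη2 x0 hu ((hvp 0).1.mono haa.le) hAB c1' c2'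
  have hpow : ∀ n m, (L ^ n) (v m) = v (n + m) := by
    intro n m
    induction n with
    | zero => simp
    | succ n ih =>
      rw [pow_succ', show n + 1 + m = (n + m) + 1 by ring, hvs, ← ih]; rfl
  set K := (1 + a) * Real.exp (2 * a) with hK
  have hK0 : 0 < K := by positivity
  set h : ℕ → S.E := fun n => ((s n)⁻¹ : ℂ) • v n with hh
  have hhK : ∀ n, ‖h n‖ ≤ K := by
    intro n
    simp only [hh]
    rw [norm_smul, norm_inv, Complex.norm_real, Real.norm_of_nonneg (hsp n).le,
      inv_mul_le_iff₀ (hsp n), mul_comm]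
    exact ((hvp n).1.mono haa.le).norm_le ha0 x0
  have hdist : ∀ n, dist (h n) (h (n + 1)) ≤ (2 * K * (B - A) / A) * (1 - η) ^ n := by
    intro n
    obtain ⟨-, A', B', hA1, hB1, hAB1, hgap, i1, i2⟩ := key n
    rw [show (LL S u) ^ n = L ^ n from rfl, hpow, hpow, add_comm n 1, add_zero] at i1 i2
    have j1 := i1.nonneg x0
    have j2 := i2.nonneg x0
    simp only [fn_sub, fn_smul, Complex.sub_re, Complex.re_ofReal_mul] at j1 j2
    change 0 ≤ s (1 + n) - A' * s n at j1
    change 0 ≤ B' * s n - s (1 + n) at j2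
    have hA'p : 0 < A' := hApos.trans_le hA1
    have hn := i1.norm_le ha0 x0
    simp only [fn_sub, fn_smul, Complex.sub_re, Complex.re_ofReal_mul] at hn
    change _ ≤ K * (s (1 + n) - A' * s n) at hn
    set r := s (1 + n) / s n with hr
    have hrs : s (1 + n) = r * s n := by rw [hr, div_mul_cancel₀ _ (hsp n).ne']
    have hrA : A' ≤ r := by rw [hr, le_div_iff₀ (hsp n)]; linarith
    have hrB : r ≤ B' := by rw [hr, div_le_iff₀ (hsp n)]; linarith
    have e1 : (A' : ℂ) • (h (1 + n) - h n) =
        ((s n)⁻¹ : ℂ) • (v (1 + n) - (A' : ℂ) • v n) - ((r - A' : ℝ) : ℂ) • h (1 + n) := by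
      simp only [hh]
      have : ((r : ℝ) : ℂ) * ((s (1 + n))⁻¹ : ℂ) = ((s n)⁻¹ : ℂ) := by
        rw [hr]
        have h1 : (s (1 + n) : ℂ) ≠ 0 := by exact_mod_cast (hsp _).ne'
        push_cast
        field_simp
      rw [smul_sub, smul_sub, smul_smul, smul_smul, smul_smul, smul_smul]
      push_cast
      rw [sub_mul, this]
      module
    have e2 : A' * ‖h (1 + n) - h n‖ ≤ 2 * K * (B' - A') := by
      have : A' * ‖h (1 + n) - h n‖ = ‖(A' : ℂ) • (h (1 + n) - h n)‖ := by
        rw [norm_smul, Complex.norm_real, Real.norm_of_nonneg hA'p.le]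
      rw [this, e1]
      refine (norm_sub_le _ _).trans ?_
      rw [norm_smul, norm_smul, norm_inv, Complex.norm_real, Complex.norm_real,
        Real.norm_of_nonneg (hsp n).le, Real.norm_of_nonneg (by linarith : 0 ≤ r - A')]
      have k1 : (s n)⁻¹ * ‖v (1 + n) - (A' : ℂ) • v n‖ ≤ K * (r - A') := by
        rw [inv_mul_le_iff₀ (hsp n)]
        refine hn.trans_eq ?_
        rw [hrs]; ring
      have k2 : (r - A') * ‖h (1 + n)‖ ≤ (r - A') * K :=
        mul_le_mul_of_nonneg_left (hhK _) (by linarith)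
      have k3 : K * (r - A') ≤ K * (B' - A') := by gcongr
      linarith
    rw [dist_comm, dist_eq_norm, add_comm n 1]
    have e3 : A * ‖h (1 + n) - h n‖ ≤ 2 * K * ((1 - η) ^ n * (B - A)) := by
      calc A * ‖h (1 + n) - h n‖ ≤ A' * ‖h (1 + n) - h n‖ := by gcongr
        _ ≤ _ := e2
        _ ≤ _ := by gcongr
    rw [div_mul_eq_mul_div, le_div_iff₀ hApos]
    linarith
  have hcau : CauchySeq h := cauchySeq_of_le_geometric (1 - η) _ (by linarith) hdist
  obtain ⟨h0, hlim⟩ := cauchySeq_tendsto_of_complete hcau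
  have hhcone : ∀ n, Cone a' (h n) := fun n => by
    have := (hvp n).1.smul (inv_pos.2 (hsp n)).le
    rwa [Complex.ofReal_inv] at this
  have hcone : Cone a' h0 := (isClosed_cone a').mem_of_tendsto hlim (Eventually.of_forall hhcone)
  have hone : ∀ n, fn (h n) x0 = 1 := by
    intro n
    simp only [hh, fn_smul, hfv]
    exact inv_mul_cancel₀ (by exact_mod_cast (hsp n).ne')
  have h01 : fn h0 x0 = 1 := by
    have t1 := ((ev (S := S) x0).continuous.tendsto h0).comp hlim
    have t2 : Tendsto (fun n => fn (h n) x0) atTop (𝓝 (fn h0 x0)) := t1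
    simp only [hone] at t2
    exact (tendsto_nhds_unique tendsto_const_nhds t2).symm
  have hLh : ∀ n, L (h n) = fn (L (h n)) x0 • h (n + 1) := by
    intro n
    simp only [hh, map_smul, ← hvs, fn_smul, hfv, smul_smul]
    congr 1
    have h1 : (s (n + 1) : ℂ) ≠ 0 := by exact_mod_cast (hsp _).ne'
    field_simp
  have tL : Tendsto (fun n => L (h n)) atTop (𝓝 (L h0)) := (L.continuous.tendsto h0).comp hlim
  have tr : Tendsto (fun n => fn (L (h n)) x0) atTop (𝓝 (fn (L h0) x0)) :=
    ((ev (S := S) x0).continuous.tendsto _).comp tL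
  have t3 : Tendsto (fun n => L (h n)) atTop (𝓝 (fn (L h0) x0 • h0)) := by
    have := tr.smul (hlim.comp (tendsto_add_atTop_nat 1))
    refine this.congr fun n => ?_
    exact (hLh n).symm
  have heq := tendsto_nhds_unique tL t3
  have hpos : ∀ x, 0 < (fn h0 x).re := fun x => cone_pos_of ha hcone (x0 := x0) (by simp [h01]) x
  have hc2 := hu.transfer hcone
  refine ⟨h0, (fn (L h0) x0).re, transfer_pos hu hcone hup hpos x0, hcone, h01, ?_⟩
  rw [heq]
  congr 1
  · exact Complex.ext (by simp [h01]) (by simpa [h01, -fn_LL] using hc2.im x0)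

end Sys

/-- Implicit function theorem, convenient form. -/
theorem ift {𝕜 : Type} [RCLike 𝕜] {E₁ E₂ F : Type} [NormedAddCommGroup E₁] [NormedSpace 𝕜 E₁]
    [CompleteSpace E₁] [NormedAddCommGroup E₂] [NormedSpace 𝕜 E₂] [CompleteSpace E₂]
    [NormedAddCommGroup F] [NormedSpace 𝕜 F] [CompleteSpace F] {n : ℕ} (hn : n ≠ 0)
    {f : E₁ × E₂ → F} {a : E₁} {b : E₂} (hf : ContDiffAt 𝕜 n f (a, b)) {A : E₂ →L[𝕜] F}
    (hA : A.IsInvertible) (hd : HasFDerivAt (fun y => f (a, y)) A b) (h0 : f (a, b) = 0) :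
    ∃ φ : E₁ → E₂, φ a = b ∧ ContDiffAt 𝕜 n φ a ∧ ∀ᶠ x in 𝓝 a, f (x, φ x) = 0 := by
  have hn' : (n : WithTop ℕ∞) ≠ 0 := by exact_mod_cast hn
  have hder : HasFDerivAt f (fderiv 𝕜 f (a, b)) (a, b) :=
    (hf.differentiableAt hn').hasFDerivAt
  have e : fderiv 𝕜 f (a, b) ∘L .inr 𝕜 E₁ E₂ = A := by
    have h1 : HasFDerivAt (fun y : E₂ => (a, y)) (ContinuousLinearMap.inr 𝕜 E₁ E₂) b :=
      hasFDerivAt_prodMk_right a b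
    exact (hder.comp b h1).unique hd
  have if₂ : (fderiv 𝕜 f (a, b) ∘L .inr 𝕜 E₁ E₂).IsInvertible := by rw [e]; exact hA
  refine ⟨hf.implicitFunction hn' if₂, hf.implicitFunction_apply_self hn' if₂,
    hf.contDiffAt_implicitFunction hn' if₂, ?_⟩
  have := hf.eventually_apply_implicitFunction hn' if₂
  rw [h0] at this
  exact this

/-- Invertibility from decay of the powers. -/
theorem isUnit_of_pow {A : Type} [NormedRing A] [CompleteSpace A] {x : A} {p : ℕ}
    (h : ‖x ^ p‖ < 1) : IsUnit (1 - x) := by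
  have h1 : IsUnit (1 - x ^ p) := (Units.oneSub _ h).isUnit
  rw [← mul_neg_geom_sum] at h1
  have hc : Commute (1 - x) (∑ i ∈ Finset.range p, x ^ i) :=
    Commute.sum_right _ _ _ fun i _ => ((Commute.one_left _).sub_left (Commute.self_pow x i))
  exact (hc.isUnit_mul_iff.1 h1).1

theorem submul_bound {b : ℕ → ℝ} {θ B : ℝ} {p : ℕ} (hp : 0 < p) (hθ : 0 < θ)
    (hb : ∀ n, 0 ≤ b n)
    (h1 : ∀ n, b (p + n) ≤ b p * b n) (h2 : b p ≤ θ ^ p) (h3 : ∀ r < p, b r ≤ B * θ ^ r) (n : ℕ) :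
    b n ≤ B * θ ^ n := by
  induction n using Nat.strong_induction_on with
  | _ n ih =>
    rcases lt_or_ge n p with h | h
    · exact h3 n h
    · obtain ⟨m, rfl⟩ := Nat.exists_eq_add_of_le h
      calc b (p + m) ≤ b p * b m := h1 m
        _ ≤ θ ^ p * (B * θ ^ m) := by
          apply mul_le_mul h2 (ih m (by omega)) (hb m) (by positivity)
        _ = _ := by rw [pow_add]; ring

namespace Sys
variable {X J : Type} [TopologicalSpace X] [DiscreteTopology X] {S : Sys X J} [Fintype J]

/-- The transfer operator with the leading eigenvector removed. -/
def Mop (x0 : X) (u h : S.E) : S.E →L[ℂ] S.E :=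
  LL S u - ((ev (S := S) x0).comp (LL S u)).smulRight h

theorem Mop_apply (x0 : X) (u h f : S.E) :
    Mop x0 u h f = LL S u f - fn (LL S u f) x0 • h := rfl

theorem Mop_pow_apply {x0 : X} {u h : S.E} {l : ℂ} (hx : fn h x0 = 1) (hl : LL S u h = l • h)
    (n : ℕ) (f : S.E) : (Mop x0 u h ^ (n + 1)) f =
      ((LL S u) ^ (n + 1)) f - fn (((LL S u) ^ (n + 1)) f) x0 • h := by
  have hMh : Mop x0 u h h = 0 := by
    rw [Mop_apply, hl, fn_smul, hx, mul_one, sub_self]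
  induction n with
  | zero => simp only [zero_add, pow_one, Mop_apply]
  | succ n ih =>
    rw [pow_succ', mul_apply_eq_comp, ih, map_sub, map_smul, hMh, smul_zero, sub_zero,
      Mop_apply, pow_succ' (LL S u) (n + 1), mul_apply_eq_comp]

theorem exists_re_im (e : S.E) : ∃ p q : S.E, (∀ x, (fn p x).im = 0) ∧ (∀ x, (fn q x).im = 0) ∧
    ‖p‖ ≤ ‖e‖ ∧ ‖q‖ ≤ ‖e‖ ∧ e = p + Complex.I • q := by
  obtain ⟨p, hp, hpn⟩ := exists_E (S := S) (fun x => ((fn e x).re : ℂ)) ‖e‖ (norm_nonneg _)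
    (fun x => by
      rw [Complex.norm_real]; exact (Complex.abs_re_le_norm _).trans (norm_fn_le e x))
    (fun x y => by
      rw [← Complex.ofReal_sub, ← Complex.sub_re, Complex.norm_real]
      exact (Complex.abs_re_le_norm _).trans (norm_fn_diff_le e x y))
  obtain ⟨q, hq, hqn⟩ := exists_E (S := S) (fun x => ((fn e x).im : ℂ)) ‖e‖ (norm_nonneg _)
    (fun x => by
      rw [Complex.norm_real]; exact (Complex.abs_im_le_norm _).trans (norm_fn_le e x))
    (fun x y => by
      rw [← Complex.ofReal_sub, ← Complex.sub_im, Complex.norm_real]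
      exact (Complex.abs_im_le_norm _).trans (norm_fn_diff_le e x y))
  refine ⟨p, q, fun x => by simp [hp], fun x => by simp [hq], hpn, hqn, E_ext fun x => ?_⟩
  rw [fn_add, fn_smul, hp, hq, mul_comm, Complex.re_add_im]

/-- Spectral gap. -/
theorem gap {a b η : ℝ} (ha : 0 ≤ S.κ * (b + a)) (haa : S.κ * (b + a) < a)
    (hη0 : 0 < η) (hη4 : η < 1)
    (hη1 : η * (a + S.κ * (b + a)) * Real.exp (3 * a) ≤ (a - S.κ * (b + a)) / 2)
    (hη2 : η * Real.exp (2 * a) ≤ 1 / 2) (x0 : X) {u h : S.E} (hu : Cone b u) {l : ℝ}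
    (hl : 0 < l) (hh : Cone (S.κ * (b + a)) h) (hx : fn h x0 = 1) (hLh : LL S u h = (l : ℂ) • h) :
    ∃ C, 0 ≤ C ∧ ∀ n, ‖Mop x0 u h ^ (n + 1)‖ ≤ C * (l * (1 - η)) ^ n := by
  set L := LL S u with hL
  set a' := S.κ * (b + a) with ha'
  have ha0 : 0 < a := ha.trans_lt haa
  set K := (1 + a) * Real.exp (2 * a) with hK
  have hK0 : 0 < K := by positivity
  have hpowh : ∀ n : ℕ, (L ^ n) h = ((l ^ n : ℝ) : ℂ) • h := by
    intro n
    induction n with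
    | zero => simp
    | succ n ih =>
      rw [pow_succ', mul_apply_eq_comp, ih, map_smul, hLh, smul_smul]
      push_cast
      ring_nf
  have hhn : ‖h‖ ≤ K := by
    have := (hh.mono haa.le).norm_le ha0.le x0
    rwa [hx, Complex.one_re, mul_one] at this
  -- cone elements
  have main : ∀ f : S.E, Cone a f → ∀ n, ‖(Mop x0 u h ^ (n + 1)) f‖ ≤
      ((1 + K) * K / η * ‖L‖) * (l * (1 - η)) ^ n * ‖f‖ := by
    intro f hf n
    have hf1 := hu.transfer hf
    rw [← hL] at hf1
    set s := (fn (L f) x0).re with hs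
    have hs0 : 0 ≤ s := hf1.nonneg x0
    have hsn : s ≤ ‖L‖ * ‖f‖ :=
      (Complex.re_le_norm _).trans ((norm_fn_le _ _).trans (L.le_opNorm f))
    have c2 := cone_bounds (x0 := x0) ha haa hη0 hη1 hη2 hh hf1
      (c := s / η) (d := 1 / η) (by positivity) (by positivity) (by
        rw [hx, ← hs]
        have : 0 ≤ s / η := by positivity
        simp only [Complex.one_re, mul_one]
        rw [one_div_mul_eq_div]; linarith)
    have c2' : Cone a (((s / η : ℝ) : ℂ) • h - L f) := by
      convert c2 using 2
      rw [mul_one_div_cancel hη0.ne']; simp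
    have c1' : Cone a (L f - ((0 : ℝ) : ℂ) • h) := by simpa using hf1.mono haa.le
    obtain ⟨-, A', B', hA1, hB1, hAB1, hgap, i1, i2⟩ := cone_iter ha haa hη0 hη4 hη1 hη2 x0 hu
      (hh.mono haa.le) (by positivity) c1' c2' n
    rw [← hL, hpowh] at i1 i2
    set p := (L ^ n) (L f) - (A' : ℂ) • ((l ^ n : ℝ) : ℂ) • h with hp
    have e1 : (Mop x0 u h ^ (n + 1)) f = p - fn p x0 • h := by
      rw [Mop_pow_apply hx hLh, ← hL, pow_succ, mul_apply_eq_comp, hp]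
      simp only [fn_sub, fn_smul, hx, mul_one]
      module
    have hp0 := i1.nonneg x0
    have hq0 := i2.nonneg x0
    have hsum : (fn p x0).re ≤ (B' - A') * l ^ n := by
      have : fn p x0 + fn ((B' : ℂ) • ((l ^ n : ℝ) : ℂ) • h - (L ^ n) (L f)) x0 =
          (((B' - A') * l ^ n : ℝ) : ℂ) := by
        simp only [hp, fn_sub, fn_smul, hx, mul_one]
        push_cast
        ring
      have h2 := congrArg Complex.re this
      rw [Complex.add_re, Complex.ofReal_re] at h2
      linarith
    have hpn := i1.norm_le ha0.le x0
    have hpx : ‖fn p x0‖ = (fn p x0).re := i1.norm_fn x0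
    rw [e1]
    have hl' : 0 ≤ l ^ n := by positivity
    calc ‖p - fn p x0 • h‖ ≤ ‖p‖ + ‖fn p x0‖ * ‖h‖ := by
          refine (norm_sub_le _ _).trans ?_
          rw [norm_smul]
      _ ≤ K * (fn p x0).re + (fn p x0).re * K := by
          rw [hpx]; gcongr
      _ = 2 * K * (fn p x0).re := by ring
      _ ≤ 2 * K * ((B' - A') * l ^ n) := by gcongr
      _ ≤ 2 * K * ((1 - η) ^ n * (s / η - 0) * l ^ n) := by gcongr
      _ = 2 * K / η * (l * (1 - η)) ^ n * s := by rw [mul_pow]; ring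
      _ ≤ (1 + K) * K / η * (l * (1 - η)) ^ n * (‖L‖ * ‖f‖) := by
          have h1η : 0 ≤ 1 - η := by linarith
          have hK1 : 1 ≤ K := by
            have h3 : 1 ≤ Real.exp (2 * a) := by
              simpa using Real.exp_le_exp.2 (by linarith : (0:ℝ) ≤ 2 * a)
            nlinarith
          gcongr
          linarith
      _ = _ := by ring
  set C := (1 + K) * K / η * ‖L‖ with hC
  have hC0 : 0 ≤ C := by positivity
  have hr0 : 0 ≤ l * (1 - η) := mul_nonneg hl.le (by linarith)
  set c0 := 1 + 1 / a with hc0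
  have hc00 : 0 < c0 := by positivity
  have main2 : ∀ f : S.E, (∀ x, (fn f x).im = 0) → ∀ n, ‖(Mop x0 u h ^ (n + 1)) f‖ ≤
      (C * (1 + 2 * c0)) * (l * (1 - η)) ^ n * ‖f‖ := by
    intro f hf n
    have h1 := main _ (cone_add_const ha0 f hf le_rfl) n
    have h2 := main _ ((Cone.one ha0.le).smul (mul_nonneg (norm_nonneg f) hc00.le)) n
    have n1 : ‖(((‖f‖ * c0 : ℝ) : ℂ)) • oneE S‖ ≤ ‖f‖ * c0 := by
      rw [norm_smul, Complex.norm_real, Real.norm_of_nonneg (by positivity)]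
      exact mul_le_of_le_one_right (by positivity) norm_oneE_le
    have n2 : ‖f + (((‖f‖ * c0 : ℝ) : ℂ)) • oneE S‖ ≤ ‖f‖ + ‖f‖ * c0 :=
      (norm_add_le _ _).trans (by gcongr)
    have e : f = (f + (((‖f‖ * c0 : ℝ) : ℂ)) • oneE S) - (((‖f‖ * c0 : ℝ) : ℂ)) • oneE S := by
      abel
    have hP : 0 ≤ C * (l * (1 - η)) ^ n := by positivity
    calc ‖(Mop x0 u h ^ (n + 1)) f‖ = ‖(Mop x0 u h ^ (n + 1))
          (f + (((‖f‖ * c0 : ℝ) : ℂ)) • oneE S) -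
          (Mop x0 u h ^ (n + 1)) ((((‖f‖ * c0 : ℝ) : ℂ)) • oneE S)‖ := by
            rw [← map_sub, ← e]
      _ ≤ _ := norm_sub_le _ _
      _ ≤ C * (l * (1 - η)) ^ n * (‖f‖ + ‖f‖ * c0) + C * (l * (1 - η)) ^ n * (‖f‖ * c0) :=
          add_le_add (h1.trans (mul_le_mul_of_nonneg_left n2 hP))
            (h2.trans (mul_le_mul_of_nonneg_left n1 hP))
      _ = _ := by ring
  refine ⟨2 * (C * (1 + 2 * c0)), by positivity, fun n => ?_⟩
  refine ContinuousLinearMap.opNorm_le_bound _ (by positivity) fun f => ?_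
  obtain ⟨p, q, hp, hq, hpn, hqn, rfl⟩ := exists_re_im f
  have h1 := main2 p hp n
  have h2 := main2 q hq n
  set f := p + Complex.I • q
  have hP : 0 ≤ (C * (1 + 2 * c0)) * (l * (1 - η)) ^ n := by positivity
  calc ‖(Mop x0 u h ^ (n + 1)) f‖ ≤ ‖(Mop x0 u h ^ (n + 1)) p‖ + ‖(Mop x0 u h ^ (n + 1)) q‖ := by
        rw [show f = p + Complex.I • q from rfl, map_add, map_smul]
        refine (norm_add_le _ _).trans_eq ?_
        rw [norm_smul, Complex.norm_I, one_mul]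
    _ ≤ (C * (1 + 2 * c0)) * (l * (1 - η)) ^ n * ‖f‖ + (C * (1 + 2 * c0)) * (l * (1 - η)) ^ n * ‖f‖ :=
        add_le_add (h1.trans (mul_le_mul_of_nonneg_left hpn hP))
          (h2.trans (mul_le_mul_of_nonneg_left hqn hP))
    _ = _ := by ring

end Sys

/-- Sum over the words of length `n`. -/
def wsum {J A : Type} [Fintype J] [AddCommMonoid A] (n : ℕ) (F : List J → A) : A :=
  ∑ w : Fin n → J, F (List.ofFn w)

section words
variable {J A : Type} [Fintype J] [AddCommMonoid A]

theorem wsum_zero (F : List J → A) : wsum 0 F = F [] := by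
  simp [wsum]

theorem wsum_succ (n : ℕ) (F : List J → A) :
    wsum (n + 1) F = ∑ j : J, wsum n (fun w => F (j :: w)) := by
  unfold wsum
  rw [← (Fin.consEquiv (fun _ : Fin (n + 1) => J)).sum_comp, Fintype.sum_prod_type]
  simp [List.ofFn_succ, Fin.consEquiv]

theorem wsum_congr {n : ℕ} {F G : List J → A} (h : ∀ w, w.length = n → F w = G w) :
    wsum n F = wsum n G :=
  Finset.sum_congr rfl fun w _ => h _ (by simp)

theorem wsum_append (m n : ℕ) (F : List J → A) :
    wsum (m + n) F = wsum m (fun w => wsum n (fun w' => F (w ++ w'))) := by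
  induction m generalizing F with
  | zero => simp [wsum_zero]
  | succ m ih =>
    rw [show m + 1 + n = (m + n) + 1 by ring, wsum_succ, wsum_succ]
    exact Finset.sum_congr rfl fun j _ => ih _

theorem wsum_mono {n : ℕ} {F G : List J → ℝ} (h : ∀ w, w.length = n → F w ≤ G w) :
    wsum n F ≤ wsum n G :=
  Finset.sum_le_sum fun w _ => h _ (by simp)

theorem norm_wsum_le {E : Type} [SeminormedAddCommGroup E] (n : ℕ) (F : List J → E) :
    ‖wsum n F‖ ≤ wsum n (fun w => ‖F w‖) := norm_sum_le _ _

theorem wsum_mul_left {n : ℕ} (c : ℝ) (F : List J → ℝ) : wsum n (fun w => c * F w) = c * wsum n F := by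
  simp [wsum, Finset.mul_sum]

theorem wsum_nonneg {n : ℕ} {F : List J → ℝ} (h : ∀ w, 0 ≤ F w) : 0 ≤ wsum n F :=
  Finset.sum_nonneg fun _ _ => h _

end words

namespace Sys
variable {X J : Type} [TopologicalSpace X] [DiscreteTopology X] {S : Sys X J}

variable (S) in
/-- Composition of the contractions along a word. -/
def ψw : List J → X → X
  | [], x => x
  | j :: w, x => ψw w (S.ψ j x)

theorem δ_ψw (w : List J) (x y : X) : S.δ (S.ψw w x) (S.ψw w y) = S.κ ^ w.length * S.δ x y := by
  induction w generalizing x y with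
  | nil => simp [ψw]
  | cons j w ih => simp only [ψw, ih, S.δ_ψ, List.length_cons, pow_succ]; ring

/-- Weight along a word. -/
def P (u : S.E) : List J → S.E
  | [] => oneE S
  | j :: w => compL j (mulL u (P u w))

/-- Composition along a word. -/
def compW : List J → S.E → S.E
  | [], f => f
  | j :: w, f => compL j (compW w f)

@[simp] theorem fn_compW (w : List J) (f : S.E) (x : X) : fn (compW w f) x = fn f (S.ψw w x) := by
  induction w generalizing x with
  | nil => rfl
  | cons j w ih => simp [compW, ψw, ih]

theorem norm_compW_le (w : List J) (f : S.E) : ‖compW w f‖ ≤ ‖f‖ := by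
  induction w with
  | nil => rfl
  | cons j w ih => exact (norm_compL_le _ _).trans ih

/-- Weighted composition along a word. -/
def Lw (u : S.E) (w : List J) (f : S.E) : S.E := mulL (P u w) (compW w f)

@[simp] theorem fn_Lw (u : S.E) (w : List J) (f : S.E) (x : X) :
    fn (Lw u w f) x = fn (P u w) x * fn f (S.ψw w x) := by simp [Lw]

theorem norm_Lw_le (u : S.E) (w : List J) (f : S.E) : ‖Lw u w f‖ ≤ 2 * ‖P u w‖ * ‖f‖ := by
  refine (norm_mulL_le _ _).trans ?_
  gcongr
  exact norm_compW_le w f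

theorem Lw_cons (u : S.E) (j : J) (w : List J) (f : S.E) :
    Lw u (j :: w) f = compL j (mulL u (Lw u w f)) := by
  apply E_ext
  intro x
  simp [P, ψw, mul_assoc]

theorem Lw_nil (u : S.E) (f : S.E) : Lw u [] f = f := by
  apply E_ext
  intro x
  simp [P, ψw]

theorem P_append (u : S.E) (w w' : List J) : P u (w ++ w') = Lw u w (P u w') := by
  induction w with
  | nil => simp [Lw_nil]
  | cons j w ih => rw [Lw_cons, List.cons_append, P, ih]

theorem contDiff_P (w : List J) {n : WithTop ℕ∞} : ContDiff ℂ n fun u : S.E => P u w := by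
  induction w with
  | nil => exact contDiff_const
  | cons j w ih =>
    have : ContDiff ℂ n fun u : S.E => mulL u (P u w) :=
      (mulL (S := S)).contDiff.clm_apply ih
    exact (compL (S := S) j).contDiff.comp this

theorem norm_fn_P_le (v : S.E) {c : ℝ} (hc : ∀ x, ‖fn v x‖ ≤ c) (w : List J) (x : X) :
    ‖fn (P v w) x‖ ≤ c ^ w.length := by
  induction w generalizing x with
  | nil => simp [P]
  | cons j w ih =>
    simp only [P, fn_compL, fn_mulL, norm_mul, List.length_cons, pow_succ']
    exact mul_le_mul (hc _) (ih _) (norm_nonneg _) ((norm_nonneg _).trans (hc x))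

variable [Fintype J]

theorem LL_pow (u : S.E) (n : ℕ) (f : S.E) :
    ((LL S u) ^ n) f = wsum n (fun w => Lw u w f) := by
  induction n with
  | zero => simp [wsum_zero, Lw_nil]
  | succ n ih =>
    rw [pow_succ', mul_apply_eq_comp, ih, wsum_succ, LL_apply]
    refine Finset.sum_congr rfl fun j _ => ?_
    unfold wsum
    simp only [map_sum, Lw_cons]

/-- Sums of norms of the weights. -/
def Ssum (u : S.E) (n : ℕ) : ℝ := wsum n (fun w => ‖P u w‖)

theorem Ssum_nonneg (u : S.E) (n : ℕ) : 0 ≤ Ssum u n := wsum_nonneg fun _ => norm_nonneg _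

theorem Ssum_add (u : S.E) (m n : ℕ) : 2 * Ssum u (m + n) ≤ (2 * Ssum u m) * (2 * Ssum u n) := by
  have : Ssum u (m + n) ≤ 2 * Ssum u m * Ssum u n := by
    unfold Ssum
    rw [wsum_append]
    have : ∀ w : List J, wsum n (fun w' => ‖P u (w ++ w')‖) ≤
        (2 * wsum n (fun w' => ‖P u w'‖)) * ‖P u w‖ := by
      intro w
      rw [show (2 * wsum n (fun w' => ‖P u w'‖)) * ‖P u w‖ =
        (2 * ‖P u w‖) * wsum n (fun w' => ‖P u w'‖) by ring, ← wsum_mul_left]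
      refine wsum_mono fun w' _ => ?_
      rw [P_append]
      exact norm_Lw_le _ _ _
    refine (wsum_mono fun w _ => this w).trans_eq ?_
    rw [wsum_mul_left]; ring
  linarith

theorem continuous_Ssum (n : ℕ) : Continuous fun u : S.E => Ssum u n := by
  unfold Ssum wsum
  exact continuous_finsetSum _ fun w _ => ((contDiff_P (n := 0) _).continuous).norm

theorem Cone.P {a b : ℝ} (ha : 0 ≤ a) (haa : S.κ * (b + a) ≤ a) {u : S.E} (hu : Cone b u)
    (w : List J) : Cone a (P u w) := by
  induction w with
  | nil => exact Cone.one ha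
  | cons j w ih => exact ((hu.mul ih).comp j).mono haa

theorem Ssum_le {a b : ℝ} (ha : 0 ≤ a) (haa : S.κ * (b + a) ≤ a) {u h : S.E} (hu : Cone b u)
    {l : ℝ} (x0 : X) (hh : Cone a h) (hx : fn h x0 = 1) (hLh : LL S u h = (l : ℂ) • h) (n : ℕ) :
    Ssum u n ≤ ((1 + a) * Real.exp (2 * a) * Real.exp a) * l ^ n := by
  set K := (1 + a) * Real.exp (2 * a)
  have hpowh : ∀ n : ℕ, ((LL S u) ^ n) h = ((l ^ n : ℝ) : ℂ) • h := by
    intro n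
    induction n with
    | zero => simp
    | succ n ih =>
      rw [pow_succ', mul_apply_eq_comp, ih, map_smul, hLh, smul_smul]
      push_cast
      ring_nf
  have h1 := congrArg (fun e => (fn e x0).re) (hpowh n)
  simp only [LL_pow, fn_smul, hx, mul_one, Complex.ofReal_re] at h1
  rw [← h1]
  unfold wsum
  rw [fn_sum, Complex.re_sum, Finset.mul_sum]
  unfold Ssum wsum
  refine Finset.sum_le_sum fun w _ => ?_
  have hP := Cone.P ha haa hu (List.ofFn w)
  refine (hP.norm_le ha x0).trans ?_
  have hK0 : 0 ≤ K := by positivity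
  change K * _ ≤ K * Real.exp a * _
  rw [mul_assoc K]
  refine mul_le_mul_of_nonneg_left ?_ hK0
  rw [fn_Lw, Complex.mul_re, hP.im, zero_mul, sub_zero]
  have h2 := hh.le_exp ha x0 (S.ψw (List.ofFn w) x0)
  rw [hx, Complex.one_re] at h2
  nlinarith [hP.nonneg x0]

end Sys

namespace Sys
variable {X J : Type} [TopologicalSpace X] [DiscreteTopology X] {S : Sys X J} [Fintype J]

/-- The partition sums over periodic words. -/
def Zs (fx : List J → X) (u : S.E) (n : ℕ) : ℂ := wsum n (fun w => fn (P u w) (fx w))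

/-- Quotient estimate. -/
theorem quot_diff (G h : S.E) {c : ℝ} (hc : 0 < c) (hh : ∀ x, c ≤ ‖fn h x‖) (x y : X) :
    ‖fn G x / fn h x - fn G y / fn h y‖ ≤ (2 * ‖h‖ / c ^ 2) * ‖G‖ * S.δ x y := by
  have hx : fn h x ≠ 0 := norm_pos_iff.1 (hc.trans_le (hh x))
  have hy : fn h y ≠ 0 := norm_pos_iff.1 (hc.trans_le (hh y))
  have hd := S.δ_nonneg x y
  have e : fn G x / fn h x - fn G y / fn h y =
      ((fn G x - fn G y) * fn h y + fn G y * (fn h y - fn h x)) / (fn h x * fn h y) := by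
    field_simp
    ring
  rw [e, norm_div, norm_mul]
  have h1 : ‖(fn G x - fn G y) * fn h y + fn G y * (fn h y - fn h x)‖ ≤
      2 * ‖h‖ * ‖G‖ * S.δ x y := by
    refine (norm_add_le _ _).trans ?_
    rw [norm_mul, norm_mul]
    have a1 := mul_le_mul (norm_fn_diff_le G x y) (norm_fn_le h y) (norm_nonneg _)
      (mul_nonneg (norm_nonneg _) hd)
    have a2 := mul_le_mul (norm_fn_le G y) (norm_fn_diff_le h y x) (norm_nonneg _) (norm_nonneg _)
    rw [S.δ_symm y x] at a2
    linarith
  have h2 : c ^ 2 ≤ ‖fn h x‖ * ‖fn h y‖ := by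
    rw [sq]; exact mul_le_mul (hh x) (hh y) hc.le (norm_nonneg _)
  calc _ ≤ (2 * ‖h‖ * ‖G‖ * S.δ x y) / c ^ 2 := by
        apply div_le_div₀ (by positivity) h1 (by positivity) h2
    _ = _ := by ring

/-- Telescoping estimate comparing periodic sums with powers of the eigenvalue. -/
theorem telescope (x0 : X) (fx : List J → X) (hfx : ∀ w, S.ψw w (fx w) = fx w) {u h : S.E} {l : ℂ}
    {c C1 C2 H θ ρ : ℝ} (hc : 0 < c) (hh : ∀ x, c ≤ ‖fn h x‖) (hH : ‖h‖ ≤ H) (hx : fn h x0 = 1)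
    (hLh : LL S u h = l • h) (hθ : 0 < θ) (hρ : θ < ρ) (hC1 : 1 + H ≤ C1)
    (hM : ∀ n, ‖Mop x0 u h ^ n‖ ≤ C1 * θ ^ n) (hS : ∀ n, Ssum u n ≤ C2 * (ρ / S.κ) ^ n) (n : ℕ) :
    ‖Zs fx u n - l ^ n‖ ≤ (2 * H / c ^ 2 * C1 * (2 * H) * (C2 * (ρ / S.κ)) / (ρ - θ)) * ρ ^ n := by
  have hκ := S.κ_pos
  have hρ0 : 0 < ρ := hθ.trans hρ
  have hH0 : 0 ≤ H := (norm_nonneg _).trans hH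
  have hC10 : 0 ≤ C1 := by linarith
  have hC20 : 0 ≤ C2 := by
    have := (Ssum_nonneg u 0).trans (hS 0)
    simpa using this
  have hne : ∀ x, fn h x ≠ 0 := fun x => norm_pos_iff.1 (hc.trans_le (hh x))
  set L := LL S u with hL
  have hpowh : ∀ n : ℕ, (L ^ n) h = (l ^ n) • h := by
    intro n
    induction n with
    | zero => simp
    | succ n ih =>
      rw [pow_succ', mul_apply_eq_comp, ih, map_smul, hLh, smul_smul]
      ring_nf
  -- the projected iterates
  have hG : ∀ (k : ℕ) (f : S.E), ‖(L ^ k) f - fn ((L ^ k) f) x0 • h‖ ≤ C1 * θ ^ k * ‖f‖ := by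
    intro k f
    rcases k with _ | k
    · simp only [pow_zero, mul_one, one_apply_eq_self]
      refine (norm_sub_le _ _).trans ?_
      rw [norm_smul]
      have := mul_le_mul (norm_fn_le f x0) hH (norm_nonneg _) (norm_nonneg _)
      nlinarith [norm_nonneg f]
    · rw [← Mop_pow_apply hx hLh]
      exact ((Mop x0 u h ^ (k + 1)).le_opNorm f).trans
        (mul_le_mul_of_nonneg_right (hM _) (norm_nonneg _))
  set φ : ℕ → List J → X → ℂ := fun k w x => fn ((L ^ k) (Lw u w h)) x / fn h x with hφ
  set T : ℕ → ℂ := fun m => wsum m (fun w => φ (n - m) w (fx w)) with hT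
  have hT0 : T 0 = l ^ n := by
    simp only [hT, hφ, wsum_zero, Lw_nil, Nat.sub_zero, hpowh, fn_smul]
    exact mul_div_cancel_right₀ _ (hne _)
  have hTn : T n = Zs fx u n := by
    simp only [hT, hφ, Nat.sub_self, pow_zero, one_apply_eq_self, fn_Lw, hfx, Zs]
    refine wsum_congr fun w _ => mul_div_cancel_right₀ _ (hne _)
  have hφd : ∀ k w x y, ‖φ k w x - φ k w y‖ ≤
      (2 * H / c ^ 2 * C1 * (2 * H)) * θ ^ k * ‖P u w‖ * S.δ x y := by
    intro k w x y
    set F := (L ^ k) (Lw u w h) with hF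
    set G := F - fn F x0 • h with hGd
    have e : ∀ z, φ k w z = fn F x0 + fn G z / fn h z := by
      intro z
      simp only [hφ, hGd, fn_sub, fn_smul, ← hF]
      have := hne z
      field_simp
      ring
    rw [e, e, add_sub_add_left_eq_sub]
    refine (quot_diff G h hc hh x y).trans ?_
    have hd := S.δ_nonneg x y
    have g1 : ‖G‖ ≤ C1 * θ ^ k * (2 * ‖P u w‖ * H) :=
      (hG k _).trans (mul_le_mul_of_nonneg_left ((norm_Lw_le u w h).trans
        (mul_le_mul_of_nonneg_left hH (by positivity))) (by positivity))
    calc _ ≤ (2 * H / c ^ 2) * (C1 * θ ^ k * (2 * ‖P u w‖ * H)) * S.δ x y := by gcongr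
      _ = _ := by ring
  have hstep : ∀ m < n, ‖T (m + 1) - T m‖ ≤
      (2 * H / c ^ 2 * C1 * (2 * H) * (C2 * (ρ / S.κ))) * (ρ ^ m * θ ^ (n - 1 - m)) := by
    intro m hm
    have e1 : T (m + 1) = ∑ j : J, wsum m (fun w => φ (n - 1 - m) (j :: w) (fx (j :: w))) := by
      simp only [hT, wsum_succ]
      rw [show n - (m + 1) = n - 1 - m by omega]
    have e2 : T m = ∑ j : J, wsum m (fun w => φ (n - 1 - m) (j :: w) (fx w)) := by
      simp only [hT]
      unfold wsum
      rw [Finset.sum_comm]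
      refine Finset.sum_congr rfl fun w _ => ?_
      simp only [hφ]
      rw [← Finset.sum_div, show n - m = (n - 1 - m) + 1 by omega, pow_succ, mul_apply_eq_comp,
        hL, LL_apply]
      simp only [map_sum, fn_sum, Lw_cons]
    have e3 : Ssum u (m + 1) = ∑ j : J, wsum m (fun w => ‖P u (j :: w)‖) := by
      simp only [Ssum, wsum_succ]
    rw [e1, e2, ← Finset.sum_sub_distrib]
    have hw : ∀ j : J, ‖wsum m (fun w => φ (n - 1 - m) (j :: w) (fx (j :: w))) -
        wsum m (fun w => φ (n - 1 - m) (j :: w) (fx w))‖ ≤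
        ((2 * H / c ^ 2 * C1 * (2 * H)) * θ ^ (n - 1 - m) * S.κ ^ m) *
          wsum m (fun w => ‖P u (j :: w)‖) := by
      intro j
      rw [← wsum_mul_left]
      have : wsum m (fun w => φ (n - 1 - m) (j :: w) (fx (j :: w))) -
        wsum m (fun w => φ (n - 1 - m) (j :: w) (fx w)) =
        wsum m (fun w => φ (n - 1 - m) (j :: w) (fx (j :: w)) - φ (n - 1 - m) (j :: w) (fx w)) := by
        unfold wsum; rw [Finset.sum_sub_distrib]
      rw [this]
      refine (norm_wsum_le _ _).trans (wsum_mono fun w hwl => ?_)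
      refine (hφd _ _ _ _).trans ?_
      have hδ : S.δ (fx (j :: w)) (fx w) ≤ S.κ ^ m := by
        have f1 : fx (j :: w) = S.ψw w (S.ψ j (fx (j :: w))) := (hfx (j :: w)).symm
        have f2 := (hfx w).symm
        rw [f1, f2, δ_ψw, hwl]
        exact mul_le_of_le_one_right (by positivity) (S.δ_le _ _)
      calc _ ≤ (2 * H / c ^ 2 * C1 * (2 * H)) * θ ^ (n - 1 - m) * ‖P u (j :: w)‖ * S.κ ^ m := by
            gcongr
        _ = _ := by ring
    refine (norm_sum_le _ _).trans ((Finset.sum_le_sum fun j _ => hw j).trans ?_)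
    rw [← Finset.mul_sum, ← e3]
    calc _ ≤ ((2 * H / c ^ 2 * C1 * (2 * H)) * θ ^ (n - 1 - m) * S.κ ^ m) *
          (C2 * (ρ / S.κ) ^ (m + 1)) := by
            gcongr
            exact hS _
      _ = _ := by
        rw [pow_succ, div_pow]
        field_simp
        ring
  rw [← hTn, ← hT0]
  have hsum : T n - T 0 = ∑ m ∈ Finset.range n, (T (m + 1) - T m) := (Finset.sum_range_sub T n).symm
  rw [hsum]
  refine (norm_sum_le _ _).trans ((Finset.sum_le_sum fun m hm =>
    hstep m (Finset.mem_range.1 hm)).trans ?_)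
  rw [← Finset.mul_sum]
  have hg := (Commute.all ρ θ).geom_sum₂_mul n
  have hg2 : ∑ i ∈ Finset.range n, ρ ^ i * θ ^ (n - 1 - i) ≤ ρ ^ n / (ρ - θ) := by
    rw [le_div_iff₀ (by linarith), hg]
    have : 0 ≤ θ ^ n := by positivity
    linarith
  calc _ ≤ (2 * H / c ^ 2 * C1 * (2 * H) * (C2 * (ρ / S.κ))) * (ρ ^ n / (ρ - θ)) := by gcongr
    _ = _ := by ring

/-- Continuity of the reduced operator. -/
theorem continuous_Mop (x0 : X) : Continuous fun p : S.E × S.E => Mop x0 p.1 p.2 := by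
  have h1 : Continuous fun p : S.E × S.E => LL S p.1 := (LL S).continuous.comp continuous_fst
  have h2 : Continuous fun p : S.E × S.E => (ev (S := S) x0).comp (LL S p.1) :=
    ((ContinuousLinearMap.compL ℂ S.E S.E ℂ (ev (S := S) x0)).continuous).comp h1
  have h3 : Continuous fun p : S.E × S.E =>
      (ContinuousLinearMap.smulRightL ℂ S.E S.E ((ev (S := S) x0).comp (LL S p.1))) p.2 :=
    (((ContinuousLinearMap.smulRightL ℂ S.E S.E).continuous).comp h2).clm_apply continuous_snd
  exact h1.sub h3

end Sys

/-- Submultiplicative growth bounds are stable under perturbation. -/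
theorem submul_nhds {A : Type} [TopologicalSpace A] {b : A → ℕ → ℝ} {a0 : A} {C θ0 θ : ℝ}
    (hb : ∀ a n, 0 ≤ b a n) (hs : ∀ a m n, b a (m + n) ≤ b a m * b a n)
    (hcont : ∀ n, ContinuousAt (fun a => b a n) a0) (h0 : 0 < θ0) (hθ : θ0 < θ)
    (hC : ∀ n, b a0 n ≤ C * θ0 ^ n) :
    ∃ B, 0 ≤ B ∧ ∀ᶠ a in 𝓝 a0, ∀ n, b a n ≤ B * θ ^ n := by
  have hθ0 : 0 < θ := h0.trans hθ
  have hlim : Tendsto (fun n : ℕ => C * (θ0 / θ) ^ n) atTop (𝓝 (C * 0)) :=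
    (tendsto_pow_atTop_nhds_zero_of_lt_one (by positivity) ((div_lt_one hθ0).2 hθ)).const_mul C
  rw [mul_zero] at hlim
  obtain ⟨p, hp1, hp⟩ := ((hlim.eventually_lt_const zero_lt_one).and (eventually_gt_atTop 0)).exists
  have hbp : b a0 p < θ ^ p := by
    refine (hC p).trans_lt ?_
    rw [div_pow, ← mul_div_assoc, div_lt_one (by positivity)] at hp1
    exact hp1
  set B := ∑ r ∈ Finset.range p, (b a0 r + 1) / θ ^ r with hB
  have hBt : ∀ r ∈ Finset.range p, 0 ≤ (b a0 r + 1) / θ ^ r := fun r _ => by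
    have := hb a0 r; positivity
  refine ⟨B, Finset.sum_nonneg hBt, ?_⟩
  have e1 : ∀ᶠ a in 𝓝 a0, b a p < θ ^ p := (hcont p).eventually_lt_const hbp
  have e2 : ∀ᶠ a in 𝓝 a0, ∀ r ∈ Finset.range p, b a r < b a0 r + 1 := by
    rw [Filter.eventually_all_finset]
    intro r _
    exact (hcont r).eventually_lt_const (lt_add_one _)
  filter_upwards [e1, e2] with a h1 h2
  refine submul_bound hp hθ0 (hb a) (hs a p) h1.le fun r hr => ?_
  have hr' := Finset.mem_range.2 hr
  have := Finset.single_le_sum hBt hr'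
  calc b a r ≤ b a0 r + 1 := (h2 r hr').le
    _ = (b a0 r + 1) / θ ^ r * θ ^ r := by field_simp
    _ ≤ B * θ ^ r := by gcongr

namespace Sys
variable {X J : Type} [TopologicalSpace X] [DiscreteTopology X] {S : Sys X J} [Fintype J]

/-- The smooth perturbation of the leading eigenfunction. -/
theorem eigen_perturb (x0 : X) {u0 h0 : S.E} {l θ0 C : ℝ} (hl : 0 < l) (hθ0 : 0 < θ0)
    (hθl : θ0 < l) (hx : fn h0 x0 = 1) (hLh : LL S u0 h0 = (l : ℂ) • h0)
    (hM : ∀ n, ‖Mop x0 u0 h0 ^ n‖ ≤ C * θ0 ^ n) {k : ℕ} (hk : k ≠ 0) :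
    ∃ φ : S.E → S.E, φ u0 = h0 ∧ ContDiffAt ℂ k φ u0 ∧
      ∀ᶠ u in 𝓝 u0, LL S u (φ u) = fn (LL S u (φ u)) x0 • φ u := by
  set F : S.E × S.E → S.E := fun p => LL S p.1 p.2 - (ev (S := S) x0 (LL S p.1 p.2)) • p.2 with hF
  have hb : ContDiff ℂ k fun p : S.E × S.E => LL S p.1 p.2 :=
    ((LL S).contDiff.comp contDiff_fst).clm_apply contDiff_snd
  have hFc : ContDiff ℂ k F :=
    hb.sub (((ev (S := S) x0).contDiff.comp hb).smul contDiff_snd)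
  have hl' : (l : ℂ) ≠ 0 := by exact_mod_cast hl.ne'
  have hunit : IsUnit (Mop x0 u0 h0 - (l : ℂ) • (1 : S.E →L[ℂ] S.E)) := by
    have hlim : Tendsto (fun n : ℕ => C * (θ0 / l) ^ n) atTop (𝓝 (C * 0)) :=
      (tendsto_pow_atTop_nhds_zero_of_lt_one (by positivity) ((div_lt_one hl).2 hθl)).const_mul C
    rw [mul_zero] at hlim
    obtain ⟨p, hp1⟩ := (hlim.eventually_lt_const zero_lt_one).exists
    have h1 : IsUnit (1 - (l : ℂ)⁻¹ • Mop x0 u0 h0) := by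
      apply isUnit_of_pow (p := p)
      rw [smul_pow, norm_smul, norm_pow, norm_inv, Complex.norm_real, Real.norm_of_nonneg hl.le]
      refine lt_of_le_of_lt ?_ hp1
      calc l⁻¹ ^ p * ‖Mop x0 u0 h0 ^ p‖ ≤ l⁻¹ ^ p * (C * θ0 ^ p) := by gcongr; exact hM p
        _ = _ := by rw [div_pow, inv_pow]; field_simp
    have h2 : Mop x0 u0 h0 - (l : ℂ) • (1 : S.E →L[ℂ] S.E) =
        (-(l : ℂ)) • (1 - (l : ℂ)⁻¹ • Mop x0 u0 h0) := by
      rw [smul_sub, smul_smul, neg_mul, mul_inv_cancel₀ hl', neg_smul, neg_smul, one_smul]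
      abel
    rw [h2]
    have h3 : IsUnit ((-(l : ℂ)) • (1 : S.E →L[ℂ] S.E)) := by
      have := (IsUnit.mk0 (-(l : ℂ)) (neg_ne_zero.2 hl')).map (algebraMap ℂ (S.E →L[ℂ] S.E))
      rwa [Algebra.algebraMap_eq_smul_one] at this
    have := h3.mul h1
    rwa [smul_one_mul] at this
  have hfx : ev (S := S) x0 (LL S u0 h0) = l := by
    change fn (LL S u0 h0) x0 = l
    rw [hLh, fn_smul, hx, mul_one]
  have hd : HasFDerivAt (fun y => F (u0, y)) (Mop x0 u0 h0 - (l : ℂ) • (1 : S.E →L[ℂ] S.E)) h0 := by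
    have d1 : HasFDerivAt (fun y => LL S u0 y) (LL S u0) h0 := (LL S u0).hasFDerivAt
    have d2 : HasFDerivAt (fun y => ev (S := S) x0 (LL S u0 y)) ((ev (S := S) x0).comp (LL S u0)) h0 :=
      ((ev (S := S) x0).comp (LL S u0)).hasFDerivAt
    have := d1.sub (d2.smul (hasFDerivAt_id h0))
    refine this.congr_fderiv ?_
    ext1 f
    simp [Mop, hfx, -fn_LL]
    abel
  have hinv : (Mop x0 u0 h0 - (l : ℂ) • (1 : S.E →L[ℂ] S.E)).IsInvertible := by
    obtain ⟨U, hU⟩ := hunit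
    exact ⟨ContinuousLinearEquiv.unitsEquiv ℂ S.E U, by rw [← hU]; rfl⟩
  obtain ⟨φ, h1, h2, h3⟩ := ift hk (hFc.contDiffAt (x := (u0, h0))) hinv hd (by
    simp only [hF]; rw [hfx, hLh, sub_self])
  refine ⟨φ, h1, h2, ?_⟩
  filter_upwards [h3] with u hu
  exact sub_eq_zero.1 hu

set_option maxHeartbeats 600000 in
/-- The perturbative spectral statement. -/
theorem partI [Nonempty J] (x0 : X) {u0 : S.E} {b : ℝ} (hb : 0 ≤ b) (hu : Cone b u0)
    (hup : ∀ x, 0 < (fn u0 x).re) (fx : List J → X) (hfx : ∀ w, S.ψw w (fx w) = fx w) (k : ℕ) :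
    ∃ l : ℝ, 0 < l ∧ (∃ h0 : X → ℝ, (∀ x, 0 < h0 x) ∧
      ∀ x, ∑ j : J, (fn u0 (S.ψ j x)).re * h0 (S.ψ j x) = l * h0 x) ∧
    ∃ ρ0 : ℝ, 0 < ρ0 ∧ ρ0 < l ∧ ∀ ρ, ρ0 < ρ → ρ < l → ∃ (Λ : S.E → ℂ) (V : Set S.E) (C : ℝ),
      IsOpen V ∧ u0 ∈ V ∧ 0 ≤ C ∧ Λ u0 = l ∧ ContDiffOn ℂ k Λ V ∧
      ∀ u ∈ V, ∀ n, ‖Zs fx u n - Λ u ^ n‖ ≤ C * ρ ^ n ∧ Ssum u n ≤ C * (ρ / S.κ) ^ n := by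
  have hκ0 := S.κ_pos
  have hκ1 : 0 < 1 - S.κ := by linarith [S.κ_lt]
  set a := (S.κ * b + 1) / (1 - S.κ) with ha_def
  have ha0 : 0 < a := by positivity
  have haa : S.κ * (b + a) < a := by
    have : a * (1 - S.κ) = S.κ * b + 1 := by rw [ha_def]; field_simp
    nlinarith
  have ha : 0 ≤ S.κ * (b + a) := by positivity
  obtain ⟨η, hη0, hη4, hη1, hη2⟩ := exists_eta ha haa
  obtain ⟨h0, l, hl, hc, hx, hLh⟩ := exists_eigen ha haa hη0 hη4 hη1 hη2 x0 hu hup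
  have hpos : ∀ x, 0 < (fn h0 x).re := cone_pos_of ha hc (by rw [hx]; simp)
  have hlow : ∀ x, Real.exp (-a) ≤ (fn h0 x).re := fun x => by
    have := (hc.mono haa.le).le_exp ha0.le x0 x
    rw [hx, Complex.one_re] at this
    rw [Real.exp_neg, inv_le_iff_one_le_mul₀ (Real.exp_pos a), mul_comm]
    exact this
  obtain ⟨C0, hC0, hgap⟩ := gap ha haa hη0 hη4 hη1 hη2 x0 hu hl hc hx hLh
  have hθ0 : 0 < l * (1 - η) := mul_pos hl (by linarith)
  set θ0 := l * (1 - η) with hθ0_def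
  have hθl : θ0 < l := by rw [hθ0_def]; nlinarith
  have hM : ∀ n, ‖Mop x0 u0 h0 ^ n‖ ≤ (1 + C0 / θ0) * θ0 ^ n := by
    intro n
    cases n with
    | zero =>
      have : 0 ≤ C0 / θ0 := by positivity
      rw [pow_zero, pow_zero, mul_one]
      exact (ContinuousLinearMap.norm_id_le).trans (by linarith)
    | succ n =>
      refine (hgap n).trans ?_
      have : 0 < θ0 ^ (n + 1) := by positivity
      rw [add_mul, pow_succ, one_mul]
      have : C0 / θ0 * (θ0 ^ n * θ0) = C0 * θ0 ^ n := by field_simp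
      rw [this]; nlinarith [mul_pos (pow_pos hθ0 n) hθ0]
  refine ⟨l, hl, ⟨fun x => (fn h0 x).re, hpos, fun x => ?_⟩, max θ0 (S.κ * l),
    lt_max_of_lt_left hθ0, max_lt hθl (by nlinarith), fun ρ hρ0 hρl => ?_⟩
  · have := congrArg (fun e => (fn e x).re) hLh
    simp only [fn_LL, Complex.re_sum, fn_smul, Complex.re_ofReal_mul] at this
    rw [← this]
    refine Finset.sum_congr rfl fun j _ => ?_
    rw [Complex.mul_re, hu.im, zero_mul, sub_zero]
  · have hρθ : θ0 < ρ := (le_max_left _ _).trans_lt hρ0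
    have hρκ : l < ρ / S.κ := by
      rw [lt_div_iff₀ hκ0, mul_comm]; exact (le_max_right _ _).trans_lt hρ0
    have hρ : 0 < ρ := hθ0.trans hρθ
    obtain ⟨θ, hθ1, hθ2⟩ := exists_between hρθ
    obtain ⟨φ, hφ0, hφc, hφ⟩ := eigen_perturb x0 hl hθ0 hθl hx hLh hM (Nat.succ_ne_zero k)
    have hφcont : ContinuousAt φ u0 := hφc.continuousAt
    set Λ : S.E → ℂ := fun u => fn (LL S u (φ u)) x0 with hΛ
    have hLφ : ContDiffAt ℂ (k + 1 : ℕ) (fun u => LL S u (φ u)) u0 :=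
      (LL S).contDiff.contDiffAt.clm_apply hφc
    have hΛc : ContDiffAt ℂ (k + 1 : ℕ) Λ u0 := (ev (S := S) x0).contDiff.contDiffAt.comp u0 hLφ
    have hΛ0 : Λ u0 = l := by
      simp only [hΛ]; rw [hφ0, hLh, fn_smul, hx, mul_one]
    -- the operator bound
    have hMc : ContinuousAt (fun u => Mop x0 u (φ u)) u0 := by
      have : ContinuousAt (fun u => ((u, φ u) : S.E × S.E)) u0 := continuousAt_id.prodMk hφcont
      have h2 : ContinuousAt (fun p : S.E × S.E => Mop x0 p.1 p.2) (u0, φ u0) :=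
        (continuous_Mop x0).continuousAt
      exact ContinuousAt.comp (f := fun u => ((u, φ u) : S.E × S.E))
        (g := fun p : S.E × S.E => Mop x0 p.1 p.2) (x := u0) h2 this
    have q1 : ∀ (u : S.E) (n : ℕ), 0 ≤ ‖Mop x0 u (φ u) ^ n‖ := fun _ _ => norm_nonneg _
    have q2 : ∀ (u : S.E) (m n : ℕ), ‖Mop x0 u (φ u) ^ (m + n)‖ ≤
        ‖Mop x0 u (φ u) ^ m‖ * ‖Mop x0 u (φ u) ^ n‖ := fun u m n => by
      rw [pow_add]; exact norm_mul_le _ _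
    have q3 : ∀ n : ℕ, ContinuousAt (fun u => ‖Mop x0 u (φ u) ^ n‖) u0 := fun n => (hMc.pow n).norm
    have q4 : ∀ n : ℕ, ‖Mop x0 u0 (φ u0) ^ n‖ ≤ (1 + C0 / θ0) * θ0 ^ n := by rw [hφ0]; exact hM
    obtain ⟨B1, hB1, hB1e⟩ := submul_nhds (b := fun u n => ‖Mop x0 u (φ u) ^ n‖) (a0 := u0)
      (C := 1 + C0 / θ0) (θ0 := θ0) (θ := θ) q1 q2 q3 hθ0 hθ1 q4
    have s1 : ∀ (u : S.E) (n : ℕ), 0 ≤ 2 * Ssum u n := fun u n => by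
      have := Ssum_nonneg u n; positivity
    have s4 : ∀ n : ℕ, 2 * Ssum u0 n ≤
        (2 * ((1 + a) * Real.exp (2 * a) * Real.exp a)) * l ^ n := fun n => by
      rw [mul_assoc 2]
      exact mul_le_mul_of_nonneg_left
        (Ssum_le ha0.le haa.le hu x0 (hc.mono haa.le) hx hLh n) zero_le_two
    have s3 : ∀ n : ℕ, ContinuousAt (fun u : S.E => 2 * Ssum u n) u0 := fun n =>
      ((continuous_Ssum n).const_mul 2).continuousAt
    obtain ⟨B2, hB2, hB2e⟩ := submul_nhds (b := fun u n => 2 * Ssum u n) (a0 := u0)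
      (C := 2 * ((1 + a) * Real.exp (2 * a) * Real.exp a)) (θ0 := l) (θ := ρ / S.κ)
      s1 (fun u m n => Ssum_add u m n) s3 hl hρκ s4
    set c := Real.exp (-a) / 2 with hc_def
    have hc0 : 0 < c := by positivity
    have e1 : ∀ᶠ u in 𝓝 u0, ‖φ u - h0‖ < c := by
      have : ContinuousAt (fun u => ‖φ u - h0‖) u0 := (hφcont.sub continuousAt_const).norm
      refine this.eventually_lt_const ?_
      change ‖φ u0 - h0‖ < c
      rw [hφ0, sub_self, norm_zero]; exact hc0
    have e2 : ∀ᶠ u in 𝓝 u0, Λ u ≠ 0 :=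
      hΛc.continuousAt.eventually_ne (by rw [hΛ0]; exact_mod_cast hl.ne')
    have e3 : ∀ᶠ u in 𝓝 u0, ContDiffAt ℂ k Λ u := by
      refine ContDiffAt.eventually (hΛc.of_le ?_) (by simp)
      exact_mod_cast Nat.le_succ k
    obtain ⟨V, hV, hVo, hu0⟩ := eventually_nhds_iff.1
      (hφ.and (hB1e.and (hB2e.and (e1.and (e2.and e3)))))
    set H := ‖h0‖ + c with hH
    set C1 := B1 + (1 + H) with hC1
    set K1 := (2 * H / c ^ 2 * C1 * (2 * H) * (B2 * (ρ / S.κ))) / (ρ - θ) with hK1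
    obtain ⟨Kt, hKt0, hKt⟩ : ∃ Kt : ℝ, 0 ≤ Kt ∧ ∀ u ∈ V, ∀ n, ‖Zs fx u n - Λ u ^ n‖ ≤ Kt * ρ ^ n := by
      refine ⟨_, ?_, fun u huV n => telescope (θ := θ) (c := c) (H := H) (C1 := C1) (C2 := B2) (h := φ u)
        x0 fx hfx hc0 ?_ ?_ ?_ ?_ (hθ0.trans hθ1) hθ2 ?_ ?_ ?_ n⟩
      · have : 0 < ρ - θ := by linarith
        have : 0 < θ := hθ0.trans hθ1
        positivity
      · intro x
        have h1 := norm_fn_le (φ u - h0) x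
        have h2 := (hV u huV).2.2.2.1
        have h3 := norm_sub_norm_le (fn h0 x) (fn (φ u) x)
        rw [norm_sub_rev, ← fn_sub] at h3
        have h4 := hc.norm_fn x
        have h5 := hlow x
        linarith
      · have h2 := (hV u huV).2.2.2.1
        have := norm_le_norm_add_norm_sub' (φ u) h0
        rw [hH]; linarith
      · have h1 := (hV u huV).1
        have h2 := (hV u huV).2.2.2.2.1
        have := congrArg (fun e => fn e x0) h1
        simp only [fn_smul] at this
        exact (mul_right_cancel₀ h2 (by rw [one_mul, mul_comm]; exact this)).symm
      · exact (hV u huV).1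
      · rw [hC1]; linarith
      · intro n
        refine ((hV u huV).2.1 n).trans ?_
        have : 0 < θ := hθ0.trans hθ1
        gcongr
        rw [hC1, hH]; linarith [norm_nonneg h0]
      · intro n
        have := (hV u huV).2.2.1 n
        have := Ssum_nonneg u n
        linarith
    refine ⟨Λ, V, max Kt B2, hVo, hu0, le_max_of_le_right hB2, hΛ0,
      fun u hu => (hV u hu).2.2.2.2.2.contDiffWithinAt, fun u huV n => ⟨?_, ?_⟩⟩
    · refine (hKt u huV n).trans ?_
      gcongr; exact le_max_left _ _
    · have h1 := (hV u huV).2.2.1 n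
      have h2 := Ssum_nonneg u n
      have h3 : 2 * Ssum u n ≤ max Kt B2 * (ρ / S.κ) ^ n := h1.trans (by gcongr; exact le_max_right _ _)
      linarith

end Sys

namespace Sys
variable {X J : Type} [TopologicalSpace X] [DiscreteTopology X] {S : Sys X J} [Fintype J]

/-- The dynamical sums over periodic points, written symbolically. -/
def Qn (fx : List J → X) (xs : X) (ε : ℂ) (u v : S.E) (n : ℕ) : ℂ :=
  wsum n (fun w => fn (P u w) (fx w) / (1 - fn (P v w) (fx w))) -
    ε ^ n * (fn u xs ^ n / (1 - fn v xs ^ n))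

/-- The dynamical sums with the leading term removed. -/
def Bn (fx : List J → X) (xs : X) (ε : ℂ) (Λ : S.E → ℂ) (u v : S.E) (n : ℕ) : ℂ :=
  Qn fx xs ε u v n - Λ u ^ n

theorem one_sub_ne {κ : ℝ} (hκ1 : κ < 1) {z : ℂ} (hz : ‖z‖ ≤ κ) :
    1 - κ ≤ ‖1 - z‖ ∧ 1 - z ≠ 0 := by
  have h := norm_sub_norm_le (1 : ℂ) z
  rw [norm_one] at h
  refine ⟨by linarith, norm_pos_iff.1 (by linarith)⟩

theorem norm_fP_le {κ : ℝ} (hκ0 : 0 ≤ κ) (hκ1 : κ < 1) {v : S.E} (hv : ∀ x, ‖fn v x‖ ≤ κ) {n : ℕ} (hn : n ≠ 0)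
    {w : List J} (hw : w.length = n) (x : X) : ‖fn (P v w) x‖ ≤ κ ^ n ∧ κ ^ n ≤ κ := by
  refine ⟨hw ▸ norm_fn_P_le v hv w x, ?_⟩
  exact pow_le_of_le_one hκ0 hκ1.le hn

theorem Bn_bound {fx : List J → X} {xs : X} {ε : ℂ} (hε : ‖ε‖ ≤ 1) {Λ : S.E → ℂ} {u v : S.E}
    {C ρ : ℝ} (hρ : 0 < ρ) (hC : 0 ≤ C) (hv : ∀ x, ‖fn v x‖ ≤ S.κ) (hus : ‖fn u xs‖ ≤ ρ)
    (h : ∀ n, ‖Zs fx u n - Λ u ^ n‖ ≤ C * ρ ^ n ∧ Ssum u n ≤ C * (ρ / S.κ) ^ n) {n : ℕ} (hn : n ≠ 0) :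
    ‖Bn fx xs ε Λ u v n‖ ≤ (C + C / (1 - S.κ) + 1 / (1 - S.κ)) * ρ ^ n := by
  have hκ0 := S.κ_pos
  have hκ1 := S.κ_lt
  have hκ : 0 < 1 - S.κ := by linarith
  have e : Bn fx xs ε Λ u v n = (Zs fx u n - Λ u ^ n) +
      wsum n (fun w => fn (P u w) (fx w) * (fn (P v w) (fx w) / (1 - fn (P v w) (fx w)))) -
      ε ^ n * (fn u xs ^ n / (1 - fn v xs ^ n)) := by
    have : wsum n (fun w => fn (P u w) (fx w) / (1 - fn (P v w) (fx w))) = Zs fx u n +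
      wsum n (fun w => fn (P u w) (fx w) * (fn (P v w) (fx w) / (1 - fn (P v w) (fx w)))) := by
      have h1 : Zs fx u n +
        wsum n (fun w => fn (P u w) (fx w) * (fn (P v w) (fx w) / (1 - fn (P v w) (fx w)))) =
        wsum n (fun w => fn (P u w) (fx w) +
          fn (P u w) (fx w) * (fn (P v w) (fx w) / (1 - fn (P v w) (fx w)))) := by
        unfold Zs wsum; rw [Finset.sum_add_distrib]
      rw [h1]
      refine wsum_congr fun w hw => ?_
      obtain ⟨a1, a2⟩ := norm_fP_le hκ0.le hκ1 hv hn hw (fx w)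
      have := (one_sub_ne hκ1 (a1.trans a2)).2
      field_simp
      ring
    rw [Bn, Qn, this]; ring
  rw [e]
  have b2 : ‖wsum n (fun w => fn (P u w) (fx w) * (fn (P v w) (fx w) / (1 - fn (P v w) (fx w))))‖ ≤
      C / (1 - S.κ) * ρ ^ n := by
    have : ∀ w : List J, w.length = n →
        ‖fn (P u w) (fx w) * (fn (P v w) (fx w) / (1 - fn (P v w) (fx w)))‖ ≤
          (S.κ ^ n / (1 - S.κ)) * ‖P u w‖ := fun w hw => by
      obtain ⟨a1, a2⟩ := norm_fP_le hκ0.le hκ1 hv hn hw (fx w)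
      have := (one_sub_ne hκ1 (a1.trans a2)).1
      rw [norm_mul, norm_div, mul_comm]
      gcongr
      exact norm_fn_le _ _
    refine (norm_wsum_le _ _).trans ((wsum_mono this).trans ?_)
    rw [wsum_mul_left]
    calc _ ≤ S.κ ^ n / (1 - S.κ) * (C * (ρ / S.κ) ^ n) := by
          gcongr; exact (h n).2
      _ = _ := by rw [div_pow]; field_simp
  have b3 : ‖ε ^ n * (fn u xs ^ n / (1 - fn v xs ^ n))‖ ≤ 1 / (1 - S.κ) * ρ ^ n := by
    have a1 : ‖fn v xs ^ n‖ ≤ S.κ := by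
      rw [norm_pow]
      exact (pow_le_pow_left₀ (norm_nonneg _) (hv xs) n).trans (pow_le_of_le_one hκ0.le hκ1.le hn)
    have a2 := (one_sub_ne hκ1 a1).1
    rw [norm_mul, norm_div, norm_pow, norm_pow]
    calc _ ≤ 1 * (ρ ^ n / (1 - S.κ)) := by
          gcongr
          exact pow_le_one₀ (norm_nonneg _) hε
      _ = _ := by ring
  have b1 := (h n).1
  have := norm_sub_le ((Zs fx u n - Λ u ^ n) +
      wsum n (fun w => fn (P u w) (fx w) * (fn (P v w) (fx w) / (1 - fn (P v w) (fx w)))))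
      (ε ^ n * (fn u xs ^ n / (1 - fn v xs ^ n)))
  have h2 := norm_add_le (Zs fx u n - Λ u ^ n)
      (wsum n (fun w => fn (P u w) (fx w) * (fn (P v w) (fx w) / (1 - fn (P v w) (fx w)))))
  rw [add_mul, add_mul]
  linarith

/-- Smoothness of the remainder terms. -/
theorem contDiffOn_Bn {fx : List J → X} {xs : X} {ε : ℂ} {Λ : S.E → ℂ} {V : Set (S.E × S.E)} {k : ℕ}
    (hΛ : ContDiffOn ℂ k (fun p : S.E × S.E => Λ p.1) V)
    (hv : ∀ p ∈ V, ∀ x, ‖fn p.2 x‖ ≤ S.κ) {n : ℕ} (hn : n ≠ 0) :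
    ContDiffOn ℂ k (fun p : S.E × S.E => Bn fx xs ε Λ p.1 p.2 n) V := by
  have hκ0 := S.κ_pos
  have hκ1 := S.κ_lt
  have cev : ∀ x : X, ContDiff ℂ k fun e : S.E => fn e x := fun x => (ev (S := S) x).contDiff
  unfold Bn Qn wsum
  refine ContDiffOn.sub (ContDiffOn.sub ?_ ?_) (hΛ.pow n)
  · refine ContDiffOn.sum fun w _ => ?_
    refine ContDiffOn.div ?_ ?_ ?_
    · exact ((cev _).comp ((contDiff_P _).comp contDiff_fst)).contDiffOn
    · exact contDiffOn_const.sub ((cev _).comp ((contDiff_P _).comp contDiff_snd)).contDiffOn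
    · intro p hp
      obtain ⟨a1, a2⟩ := norm_fP_le hκ0.le hκ1 (hv p hp) hn (w := List.ofFn w) (by simp) (fx (List.ofFn w))
      exact (one_sub_ne hκ1 (a1.trans a2)).2
  · refine contDiffOn_const.mul (ContDiffOn.div ?_ ?_ ?_)
    · exact (((cev xs).comp contDiff_fst).pow n).contDiffOn
    · exact contDiffOn_const.sub (((cev xs).comp contDiff_snd).pow n).contDiffOn
    · intro p hp
      have a1 : ‖fn p.2 xs ^ n‖ ≤ S.κ := by
        rw [norm_pow]
        exact (pow_le_pow_left₀ (norm_nonneg _) (hv p hp xs) n).trans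
          (pow_le_of_le_one hκ0.le hκ1.le hn)
      exact (one_sub_ne hκ1 a1).2

/-- The logarithm of the determinant without its zero, symbolically. -/
def logE (fx : List J → X) (xs : X) (ε : ℂ) (Λ : S.E → ℂ) (p : ℂ × (S.E × S.E)) : ℂ :=
  ∑' n : ℕ, (n : ℂ)⁻¹ * Bn fx xs ε Λ p.2.1 p.2.2 n * p.1 ^ n

/-- The analytic part of the proof. -/
theorem analytic_part {fx : List J → X} {xs : X} {ε : ℂ} (hε : ‖ε‖ ≤ 1) {Λ : S.E → ℂ}
    {V : Set S.E} {u0 v0 : S.E} {C ρ : ℝ} {k : ℕ} (hV : IsOpen V) (hu0 : u0 ∈ V) (hρ : 0 < ρ)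
    (hC : 0 ≤ C) (hΛ : ContDiffOn ℂ (k + 1 : ℕ) Λ V)
    (h : ∀ u ∈ V, ∀ n, ‖Zs fx u n - Λ u ^ n‖ ≤ C * ρ ^ n ∧ Ssum u n ≤ C * (ρ / S.κ) ^ n)
    {c : ℝ} (hc : c < S.κ) (hv0 : ∀ x, ‖fn v0 x‖ ≤ c) (hus : ‖fn u0 xs‖ < ρ)
    {R : ℝ} (hR : R < 1 / ρ) :
    ∃ (V' : Set (S.E × S.E)) (K : ℝ), IsOpen V' ∧ (u0, v0) ∈ V' ∧
      (∀ p ∈ V', p.1 ∈ V ∧ (∀ x, ‖fn p.2 x‖ ≤ S.κ) ∧ ‖fn p.1 xs‖ ≤ ρ ∧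
        ∀ n, n ≠ 0 → ‖Bn fx xs ε Λ p.1 p.2 n‖ ≤ K * ρ ^ n) ∧
      ContDiffOn ℂ k (logE fx xs ε Λ) (Metric.ball 0 R ×ˢ V') := by
  have hκ0 := S.κ_pos
  have hκ1 := S.κ_lt
  have hκ : 0 < 1 - S.κ := by linarith
  set V' : Set (S.E × S.E) := {p | p.1 ∈ V ∧ ‖p.2 - v0‖ < S.κ - c ∧ ‖fn p.1 xs‖ < ρ} with hV'
  set K := C + C / (1 - S.κ) + 1 / (1 - S.κ) with hK
  have hK0 : 0 ≤ K := by positivity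
  have cev : ∀ x : X, Continuous fun e : S.E => fn e x := fun x => (ev (S := S) x).continuous
  have hV'o : IsOpen V' := by
    refine (hV.preimage continuous_fst).inter (IsOpen.inter ?_ ?_)
    · exact isOpen_lt ((continuous_snd.sub continuous_const).norm) continuous_const
    · exact isOpen_lt ((cev xs).comp continuous_fst).norm continuous_const
  have hvV : ∀ p ∈ V', ∀ x, ‖fn p.2 x‖ ≤ S.κ := by
    rintro p ⟨-, hp, -⟩ x
    have h1 := norm_fn_le (p.2 - v0) x
    rw [fn_sub] at h1
    have h2 := norm_le_norm_add_norm_sub' (fn p.2 x) (fn v0 x)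
    have := hv0 x
    linarith
  have hb : ∀ p ∈ V', ∀ n, n ≠ 0 → ‖Bn fx xs ε Λ p.1 p.2 n‖ ≤ K * ρ ^ n := fun p hp n hn =>
    Bn_bound hε hρ hC (hvV p hp) hp.2.2.le (h _ hp.1) hn
  refine ⟨V', K, hV'o, ⟨hu0, ?_, hus⟩, fun p hp => ⟨hp.1, hvV p hp, hp.2.2.le, hb p hp⟩, ?_⟩
  · simpa using hc
  have hΛV : ContDiffOn ℂ (k + 1 : ℕ) (fun p : S.E × S.E => Λ p.1) V' :=
    hΛ.comp contDiff_fst.contDiffOn fun p hp => hp.1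
  have hmap : MapsTo (Prod.snd : ℂ × (S.E × S.E) → S.E × S.E) (Metric.ball 0 R ×ˢ V') V' :=
    fun p hp => hp.2
  have hkk : ((k : ℕ) : WithTop ℕ∞) ≤ (k + 1 : ℕ) := by exact_mod_cast Nat.le_succ k
  unfold logE
  rcases le_or_gt R 0 with hR0 | hR0
  · rw [Metric.ball_eq_empty.2 hR0, empty_prod]; exact fun x hx => hx.elim
  refine holo_sum (c := fun n => K * (ρ * R) ^ n) k (Metric.isOpen_ball.prod hV'o) ?_ ?_ ?_
  · refine (summable_geometric_of_lt_one (by positivity) ?_).mul_left K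
    rwa [lt_div_iff₀ hρ, mul_comm] at hR
  · intro n
    rcases eq_or_ne n 0 with rfl | hn
    · simp only [Nat.cast_zero, inv_zero, zero_mul]; exact contDiffOn_const
    · exact (contDiffOn_const.mul ((contDiffOn_Bn hΛV hvV hn).comp contDiff_snd.contDiffOn hmap)).mul
        (contDiff_fst.contDiffOn.pow n)
  · rintro n ⟨z, p⟩ ⟨hz, hp⟩
    simp only
    rcases eq_or_ne n 0 with rfl | hn
    · simp [hK0]
    · have hz' : ‖z‖ ≤ R := by simpa using (mem_ball_zero_iff.1 hz).le
      have hn1 : ‖(n : ℂ)⁻¹‖ ≤ 1 := by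
        rw [norm_inv, Complex.norm_natCast]
        exact inv_le_one_of_one_le₀ (by exact_mod_cast Nat.one_le_iff_ne_zero.2 hn)
      rw [norm_mul, norm_mul, norm_pow]
      calc _ ≤ 1 * (K * ρ ^ n) * R ^ n := by
            gcongr
            exact hb p hp n hn
        _ = _ := by rw [mul_pow]; ring

end Sys

/-- If `z n` are real and positive and `z n = L ^ n (1 + o(1))` then `L` is real positive. -/
theorem real_pos_of_ratio {z : ℕ → ℝ} (hz : ∀ n, 0 < z n) {L : ℂ} (hL : L ≠ 0)
    (h : Tendsto (fun n => (z n : ℂ) / L ^ n) atTop (𝓝 1)) : ∃ l : ℝ, 0 < l ∧ L = l := by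
  have h1 : Tendsto (fun n => (z (n + 1) : ℂ) / L ^ (n + 1)) atTop (𝓝 1) :=
    h.comp (tendsto_add_atTop_nat 1)
  have h2 := (h1.div h one_ne_zero).mul_const L
  have h3 : Tendsto (fun n => ((z (n + 1) / z n : ℝ) : ℂ)) atTop (𝓝 L) := by
    refine (h2.congr fun n => ?_).trans (by simp)
    have : (z n : ℂ) ≠ 0 := by exact_mod_cast (hz n).ne'
    simp only [Pi.div_apply]
    push_cast
    rw [pow_succ]
    field_simp
  have hre := (Complex.continuous_re.tendsto L).comp h3
  have him := (Complex.continuous_im.tendsto L).comp h3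
  simp only [Function.comp_def, Complex.ofReal_re, Complex.ofReal_im] at hre him
  have him0 : L.im = 0 := (tendsto_nhds_unique him tendsto_const_nhds)
  have hre0 : 0 ≤ L.re := ge_of_tendsto' hre fun n => (div_pos (hz _) (hz _)).le
  have hLr : L = (L.re : ℂ) := Complex.ext (by simp) (by simp [him0])
  refine ⟨L.re, lt_of_le_of_ne hre0 fun h0 => hL ?_, hLr⟩
  rw [hLr, ← h0]; simp

/-- Convergence of normalised sums. -/
theorem ratio_tendsto {z : ℕ → ℂ} {L : ℂ} {K ρ : ℝ} (hρ : 0 < ρ) (hL : ρ < ‖L‖)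
    (h : ∀ n, n ≠ 0 → ‖z n - L ^ n‖ ≤ K * ρ ^ n) : Tendsto (fun n => z n / L ^ n) atTop (𝓝 1) := by
  have hLp : 0 < ‖L‖ := hρ.trans hL
  have hL0 : L ≠ 0 := norm_pos_iff.1 hLp
  rw [tendsto_iff_norm_sub_tendsto_zero]
  have hlim : Tendsto (fun n : ℕ => K * (ρ / ‖L‖) ^ n) atTop (𝓝 (K * 0)) :=
    (tendsto_pow_atTop_nhds_zero_of_lt_one (by positivity) ((div_lt_one hLp).2 hL)).const_mul K
  rw [mul_zero] at hlim
  refine squeeze_zero' (Eventually.of_forall fun _ => norm_nonneg _) ?_ hlim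
  filter_upwards [eventually_ne_atTop 0] with n hn
  have : z n / L ^ n - 1 = (z n - L ^ n) / L ^ n := by field_simp
  rw [this, norm_div, norm_pow, div_pow, ← mul_div_assoc]
  gcongr
  exact h n hn

/-- The logarithmic growth rate. -/
theorem log_tendsto {y : ℕ → ℝ} {l : ℝ} (hl : 0 < l)
    (h : Tendsto (fun n => (y n : ℂ) / (l : ℂ) ^ n) atTop (𝓝 1)) :
    Tendsto (fun n : ℕ => Real.log (y n) / n) atTop (𝓝 (Real.log l)) := by
  have h1 : Tendsto (fun n => y n / l ^ n) atTop (𝓝 1) := by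
    have := (Complex.continuous_re.tendsto 1).comp h
    simp only [Complex.one_re] at this
    refine this.congr fun n => ?_
    simp only [Function.comp_def]
    rw [← Complex.ofReal_pow, ← Complex.ofReal_div, Complex.ofReal_re]
  have h2 : Tendsto (fun n => Real.log (y n / l ^ n)) atTop (𝓝 0) := by
    have := (Real.continuousAt_log one_ne_zero).tendsto.comp h1
    rwa [Real.log_one] at this
  have h3 : Tendsto (fun n : ℕ => Real.log (y n / l ^ n) * (n : ℝ)⁻¹ + Real.log l) atTop
      (𝓝 (0 * 0 + Real.log l)) :=
    (h2.mul tendsto_inv_atTop_nhds_zero_nat).add tendsto_const_nhds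
  rw [zero_mul, zero_add] at h3
  refine h3.congr' ?_
  filter_upwards [h1.eventually (eventually_gt_nhds zero_lt_one), eventually_ne_atTop 0] with n h4 hn
  have hn' : (n : ℝ) ≠ 0 := by exact_mod_cast hn
  have hln : 0 < l ^ n := by positivity
  have hy : 0 < y n := by
    by_contra hc
    push Not at hc
    exact absurd h4 (not_lt.2 (div_nonpos_of_nonpos_of_nonneg hc hln.le))
  rw [Real.log_div hy.ne' hln.ne', Real.log_pow]
  field_simp
  ring

namespace Sys
variable {X J : Type} [TopologicalSpace X] [DiscreteTopology X] {S : Sys X J} [Fintype J]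

theorem fn_P_real {u : S.E} (hu : ∀ x, (fn u x).im = 0 ∧ 0 < (fn u x).re) (w : List J) (x : X) :
    (fn (P u w) x).im = 0 ∧ 0 < (fn (P u w) x).re := by
  induction w generalizing x with
  | nil => simp [P]
  | cons j w ih =>
    simp only [P, fn_compL, fn_mulL, Complex.mul_re, Complex.mul_im]
    have h1 := hu (S.ψ j x); have h2 := ih (S.ψ j x)
    refine ⟨by rw [h1.1, h2.1]; ring, ?_⟩
    rw [h1.1, zero_mul, sub_zero]
    exact mul_pos h1.2 h2.2

theorem Zs_real [Nonempty J] {u : S.E} (hu : ∀ x, (fn u x).im = 0 ∧ 0 < (fn u x).re)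
    (fx : List J → X) (n : ℕ) : ∃ z : ℝ, 0 < z ∧ Zs fx u n = z := by
  refine ⟨(Zs fx u n).re, ?_, ?_⟩
  · unfold Zs wsum
    rw [Complex.re_sum]
    exact Finset.sum_pos (fun w _ => (fn_P_real hu _ _).2) Finset.univ_nonempty
  · refine Complex.ext (by simp) ?_
    unfold Zs wsum
    rw [Complex.im_sum, Complex.ofReal_im]
    exact Finset.sum_eq_zero fun w _ => (fn_P_real hu _ _).1

set_option maxHeartbeats 1000000 in
/-- Final assembly. -/
theorem assembly [Nonempty J] (x0 : X) (fx : List J → X) (hfx : ∀ w, S.ψw w (fx w) = fx w)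
    (xs : X) {ε : ℂ} (hε : ‖ε‖ ≤ 1) {Pm : Type} [NormedAddCommGroup Pm] [NormedSpace ℝ Pm]
    {W0 : Set Pm} (hW0 : IsOpen W0) (h0 : (0 : Pm) ∈ W0) (uv : Pm → S.E × S.E) {k : ℕ}
    (hcd : ContDiffOn ℝ k uv W0) {b : ℝ} (hb : 0 ≤ b) (hcone : Cone b (uv 0).1)
    (hreal : ∀ t ∈ W0, ∀ x, (fn (uv t).1 x).im = 0 ∧ 0 < (fn (uv t).1 x).re)
    {c : ℝ} (hc : c < S.κ) (hv0 : ∀ x, ‖fn (uv 0).2 x‖ ≤ c)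
    (hus : ∀ (l : ℝ) (h : X → ℝ), 0 < l → (∀ x, 0 < h x) →
      (∀ x, ∑ j : J, (fn (uv 0).1 (S.ψ j x)).re * h (S.ψ j x) = l * h x) → ‖fn (uv 0).1 xs‖ < l)
    (T G : Pm → ℝ → ℝ)
    (hZ : ∀ t ∈ W0, ∀ n, n ≠ 0 →
      ((∑ᶠ x ∈ periodicPtsIn (T t) n, Real.exp (birkhoff (T t) (G t) n x) : ℝ) : ℂ) =
        Zs fx (uv t).1 n - ε ^ n * fn (uv t).1 xs ^ n)
    (hQ : ∀ t ∈ W0, ∀ n, n ≠ 0 → ∑ᶠ x ∈ periodicPtsIn (T t) n,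
      ((Real.exp (birkhoff (T t) (G t) n x) / (1 - (deriv ((T t)^[n]) x)⁻¹) : ℝ) : ℂ) =
        Qn fx xs ε (uv t).1 (uv t).2 n) :
    ∃ R : ℝ, Real.exp (-pressureExp (T 0) (G 0)) < R ∧
    ∃ W : Set Pm, IsOpen W ∧ (0 : Pm) ∈ W ∧ W ⊆ W0 ∧
    ∃ d : ℂ → Pm → ℂ,
      (∀ t ∈ W, ∃ ρ : ℝ, 0 < ρ ∧ ∀ z : ℂ, ‖z‖ < ρ →
        Summable fun n : ℕ => detCoeff (T t) (G t) n * z ^ n) ∧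
      (∀ t ∈ W,
        DifferentiableOn ℂ (fun z => d z t) (Metric.ball 0 R) ∧
        ∃ ρ : ℝ, 0 < ρ ∧ ∀ z : ℂ, ‖z‖ < ρ →
          d z t = Complex.exp (-∑' n : ℕ, detCoeff (T t) (G t) n * z ^ n)) ∧
      (∀ t ∈ W,
        d ((Real.exp (-pressureExp (T t) (G t)) : ℝ) : ℂ) t = 0 ∧
        (∀ z ∈ Metric.ball (0 : ℂ) R, d z t = 0 →
          z = ((Real.exp (-pressureExp (T t) (G t)) : ℝ) : ℂ)) ∧
        deriv (fun z => d z t) ((Real.exp (-pressureExp (T t) (G t)) : ℝ) : ℂ) ≠ 0) ∧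
      ContDiffOn ℝ k (fun p : ℂ × Pm => d p.1 p.2) (Metric.ball 0 R ×ˢ W) := by
  obtain ⟨l, hl, ⟨h, hh, hlh⟩, ρ0, hρ00, hρzl, hρ⟩ :=
    partI x0 hb hcone (fun x => (hreal 0 h0 x).2) fx hfx (k + 2)
  obtain ⟨ρ, hρ1, hρl⟩ := exists_between (max_lt hρzl (hus l h hl hh hlh))
  have hρzρ := (le_max_left _ _).trans_lt hρ1
  have husρ := (le_max_right _ _).trans_lt hρ1
  have hρp : 0 < ρ := hρ00.trans hρzρ
  obtain ⟨Λ, V, C, hV, huV, hC, hΛ0, hΛ, hZb⟩ := hρ ρ hρzρ hρl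
  obtain ⟨R, hR1, hR2⟩ := exists_between (one_div_lt_one_div_of_lt hρp hρl)
  have hR0 : 0 < R := lt_trans (by positivity) hR1
  obtain ⟨V', K, hV', huvV', hVb, hlog⟩ := analytic_part (k := k + 1) hε hV huV hρp hC hΛ hZb hc hv0 husρ hR2
  have hΛc : ContinuousOn (fun p : S.E × S.E => ‖Λ p.1‖) V' :=
    (hΛ.continuousOn.comp continuousOn_fst fun p hp => (hVb p hp).1).norm
  set V'' : Set (S.E × S.E) := V' ∩ (fun p : S.E × S.E => ‖Λ p.1‖) ⁻¹' Ioi (1 / R) with hV''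
  have hV''o : IsOpen V'' := hΛc.isOpen_inter_preimage hV' isOpen_Ioi
  set W : Set Pm := W0 ∩ uv ⁻¹' V'' with hW
  have hWo : IsOpen W := hcd.continuousOn.isOpen_inter_preimage hW0 hV''o
  have hRρ : ρ < 1 / R := by
    rw [lt_div_iff₀ hR0]; rwa [lt_div_iff₀ hρp, mul_comm] at hR2
  have h0W : (0 : Pm) ∈ W := by
    refine ⟨h0, huvV', ?_⟩
    change 1 / R < ‖Λ (uv 0).1‖
    rw [hΛ0, Complex.norm_real, Real.norm_of_nonneg hl.le, div_lt_iff₀ hR0]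
    rwa [div_lt_iff₀ hl, mul_comm] at hR1
  -- the leading eigenvalue is the exponential of the pressure
  have key : ∀ t ∈ W, ∃ lt : ℝ, 0 < lt ∧ Λ (uv t).1 = lt ∧ 1 / R < lt ∧
      Real.exp (-pressureExp (T t) (G t)) = lt⁻¹ := by
    rintro t ⟨htW, htV, htΛ⟩
    obtain ⟨q1, q2, q3, q4⟩ := hVb _ htV
    have hΛn : ρ < ‖Λ (uv t).1‖ := hRρ.trans htΛ
    choose z hz hzZ using Zs_real (hreal t htW) fx
    have r1 := ratio_tendsto (z := fun n => Zs fx (uv t).1 n) hρp hΛn fun n _ => (hZb _ q1 n).1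
    simp only [hzZ] at r1
    obtain ⟨lt, hlt, hΛlt⟩ := real_pos_of_ratio hz (norm_pos_iff.1 (hρp.trans hΛn)) r1
    have hnorm : ‖Λ (uv t).1‖ = lt := by
      rw [hΛlt, Complex.norm_real, Real.norm_of_nonneg hlt.le]
    refine ⟨lt, hlt, hΛlt, hnorm ▸ htΛ, ?_⟩
    have r2 := ratio_tendsto (z := fun n => ((∑ᶠ x ∈ periodicPtsIn (T t) n,
      Real.exp (birkhoff (T t) (G t) n x) : ℝ) : ℂ)) (L := Λ (uv t).1) (K := C + 1) hρp hΛn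
      fun n hn => by
        rw [hZ t htW n hn]
        have e1 := (hZb _ q1 n).1
        have e2 : ‖ε ^ n * fn (uv t).1 xs ^ n‖ ≤ ρ ^ n := by
          rw [norm_mul, norm_pow, norm_pow]
          calc _ ≤ 1 * ρ ^ n := by gcongr; exact pow_le_one₀ (norm_nonneg _) hε
            _ = _ := one_mul _
        have e3 := norm_sub_le (Zs fx (uv t).1 n - Λ (uv t).1 ^ n) (ε ^ n * fn (uv t).1 xs ^ n)
        rw [sub_right_comm] at e3
        rw [add_mul, one_mul]
        linarith
    rw [hΛlt] at r2
    have r3 := (log_tendsto hlt r2).limsup_eq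
    have : pressureExp (T t) (G t) = Real.log lt := r3
    rw [this, Real.exp_neg, Real.exp_log hlt]
  set d : ℂ → Pm → ℂ := fun z t => (1 - z * Λ (uv t).1) * Complex.exp (-logE fx xs ε Λ (z, uv t)) with hd
  have hdl : ∀ t ∈ W, DifferentiableOn ℂ (fun z => Complex.exp (-logE fx xs ε Λ (z, uv t)))
      (Metric.ball 0 R) := by
    rintro t ⟨htW, htV, htΛ⟩
    have h1 : ContDiffOn ℂ (k + 1 : ℕ) (fun z : ℂ => logE fx xs ε Λ (z, uv t)) (Metric.ball 0 R) :=
      hlog.comp (contDiff_id.prodMk contDiff_const).contDiffOn fun z hz => ⟨hz, htV⟩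
    exact ((h1.differentiableOn (by simp)).neg).cexp
  have hcoef : ∀ t ∈ W, ∀ n, detCoeff (T t) (G t) n =
      (n : ℂ)⁻¹ * Bn fx xs ε Λ (uv t).1 (uv t).2 n + (n : ℂ)⁻¹ * Λ (uv t).1 ^ n := by
    rintro t ⟨htW, htV, htΛ⟩ n
    rcases eq_or_ne n 0 with rfl | hn
    · simp [detCoeff]
    · rw [detCoeff, hQ t htW n hn, Bn]; ring
  have hsum : ∀ t ∈ W, ∀ z : ℂ, ‖z‖ < R → Summable fun n : ℕ =>
      (n : ℂ)⁻¹ * Bn fx xs ε Λ (uv t).1 (uv t).2 n * z ^ n := by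
    rintro t ⟨htW, htV, htΛ⟩ z hz
    obtain ⟨q1, q2, q3, q4⟩ := hVb _ htV
    have hK0 : 0 ≤ K := by
      have := (norm_nonneg _).trans (q4 1 one_ne_zero)
      rw [pow_one] at this
      exact nonneg_of_mul_nonneg_left this hρp
    refine Summable.of_norm_bounded (g := fun n => K * (ρ * R) ^ n)
      ((summable_geometric_of_lt_one (by positivity) ?_).mul_left K) fun n => ?_
    · rwa [lt_div_iff₀ hρp, mul_comm] at hR2
    · rcases eq_or_ne n 0 with rfl | hn
      · simp [hK0]
      · have hn1 : ‖(n : ℂ)⁻¹‖ ≤ 1 := by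
          rw [norm_inv, Complex.norm_natCast]
          exact inv_le_one_of_one_le₀ (by exact_mod_cast Nat.one_le_iff_ne_zero.2 hn)
        rw [norm_mul, norm_mul, norm_pow]
        calc _ ≤ 1 * (K * ρ ^ n) * R ^ n := by
              gcongr
              exact q4 n hn
          _ = _ := by rw [mul_pow]; ring
  have hseries : ∀ t ∈ W, ∀ z : ℂ, ‖z‖ < R → ‖z * Λ (uv t).1‖ < 1 →
      HasSum (fun n : ℕ => detCoeff (T t) (G t) n * z ^ n)
        (logE fx xs ε Λ (z, uv t) + -Complex.log (1 - z * Λ (uv t).1)) := by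
    intro t ht z hz hz1
    have a1 := (hsum t ht z hz).hasSum
    have a2 := Complex.hasSum_taylorSeries_neg_log hz1
    refine (a1.add a2).congr_fun ?_
    intro n
    rw [hcoef t ht n, mul_pow]
    ring
  have hsmall : ∀ t ∈ W, ∃ r : ℝ, 0 < r ∧ ∀ z : ℂ, ‖z‖ < r → ‖z‖ < R ∧ ‖z * Λ (uv t).1‖ < 1 := by
    intro t ht
    obtain ⟨lt, hlt, hΛlt, hRl, -⟩ := key t ht
    refine ⟨lt⁻¹, by positivity, fun z hz => ⟨hz.trans ?_, ?_⟩⟩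
    · rw [one_div] at hRl
      exact inv_lt_of_inv_lt₀ hR0 hRl
    · rw [hΛlt, norm_mul, Complex.norm_real, Real.norm_of_nonneg hlt.le]
      calc _ < lt⁻¹ * lt := by gcongr
        _ = 1 := inv_mul_cancel₀ hlt.ne'
  refine ⟨R, ?_, W, hWo, h0W, inter_subset_left, d, ?_, ?_, ?_, ?_⟩
  · obtain ⟨lt, hlt, hΛlt, hRl, hpr⟩ := key 0 h0W
    rw [hpr]
    rw [one_div] at hRl
    exact inv_lt_of_inv_lt₀ hR0 hRl
  · intro t ht
    obtain ⟨r, hr, hrz⟩ := hsmall t ht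
    exact ⟨r, hr, fun z hz => (hseries t ht z (hrz z hz).1 (hrz z hz).2).summable⟩
  · intro t ht
    refine ⟨?_, ?_⟩
    · exact DifferentiableOn.mul (by fun_prop) (hdl t ht)
    · obtain ⟨r, hr, hrz⟩ := hsmall t ht
      refine ⟨r, hr, fun z hz => ?_⟩
      rw [(hseries t ht z (hrz z hz).1 (hrz z hz).2).tsum_eq, neg_add, neg_neg, Complex.exp_add,
        Complex.exp_log, mul_comm]
      intro h0
      have := (hrz z hz).2
      rw [← sub_eq_zero.1 h0, norm_one] at this
      exact lt_irrefl _ this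
  · intro t ht
    obtain ⟨lt, hlt, hΛlt, hRl, hpr⟩ := key t ht
    have hlt' : (lt : ℂ) ≠ 0 := by exact_mod_cast hlt.ne'
    have hmem : ((lt⁻¹ : ℝ) : ℂ) ∈ Metric.ball (0 : ℂ) R := by
      rw [mem_ball_zero_iff, Complex.norm_real, Real.norm_of_nonneg (by positivity)]
      rw [one_div] at hRl
      exact inv_lt_of_inv_lt₀ hR0 hRl
    have hz0 : 1 - ((lt⁻¹ : ℝ) : ℂ) * Λ (uv t).1 = 0 := by
      rw [hΛlt, Complex.ofReal_inv, inv_mul_cancel₀ hlt', sub_self]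
    rw [hpr]
    refine ⟨?_, fun z hz hdz => ?_, ?_⟩
    · simp only [hd]; rw [hz0, zero_mul]
    · rcases mul_eq_zero.1 hdz with h1 | h1
      · rw [hΛlt] at h1
        rw [Complex.ofReal_inv]
        exact eq_inv_of_mul_eq_one_left (sub_eq_zero.1 h1).symm
      · exact absurd h1 (Complex.exp_ne_zero _)
    · have d1 : HasDerivAt (fun z : ℂ => 1 - z * Λ (uv t).1) (-Λ (uv t).1) ((lt⁻¹ : ℝ) : ℂ) := by
        simpa using ((hasDerivAt_id ((lt⁻¹ : ℝ) : ℂ)).mul_const (Λ (uv t).1)).const_sub 1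
      have d2 := ((hdl t ht).differentiableAt (Metric.isOpen_ball.mem_nhds hmem)).hasDerivAt
      have d3 := d1.mul d2
      have d4 : deriv (fun z => d z t) ((lt⁻¹ : ℝ) : ℂ) = _ := d3.deriv
      rw [d4, hz0, zero_mul, add_zero, hΛlt]
      exact mul_ne_zero (neg_ne_zero.2 hlt') (Complex.exp_ne_zero _)
  · have m1 : ContDiffOn ℝ k (fun p : ℂ × Pm => ((p.1, uv p.2) : ℂ × (S.E × S.E)))
        (Metric.ball 0 R ×ˢ W) :=
      contDiff_fst.contDiffOn.prodMk (hcd.comp contDiff_snd.contDiffOn fun p hp => hp.2.1)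
    have hk1 : ((k : ℕ) : WithTop ℕ∞) ≤ (k + 1 : ℕ) := by exact_mod_cast Nat.le_succ k
    have hk2 : ((k : ℕ) : WithTop ℕ∞) ≤ (k + 2 : ℕ) := by exact_mod_cast Nat.le_add_right k 2
    have m2 : ContDiffOn ℝ k (fun p : ℂ × (S.E × S.E) =>
        (1 - p.1 * Λ p.2.1) * Complex.exp (-logE fx xs ε Λ p)) (Metric.ball 0 R ×ˢ V') := by
      have : ContDiffOn ℂ k (fun p : ℂ × (S.E × S.E) =>
        (1 - p.1 * Λ p.2.1) * Complex.exp (-logE fx xs ε Λ p)) (Metric.ball 0 R ×ˢ V') := by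
        refine ContDiffOn.mul ?_ ((hlog.of_le hk1).neg.cexp)
        refine contDiffOn_const.sub (contDiff_fst.contDiffOn.mul ?_)
        exact (hΛ.of_le hk2).comp (contDiff_fst.comp contDiff_snd).contDiffOn
          fun p hp => (hVb _ hp.2).1
      exact this.restrict_scalars ℝ
    exact m2.comp m1 fun p hp => ⟨hp.1, hp.2.2.1⟩

end Sys

theorem HasFDerivAt.mem_range_isometry {P E E' : Type} [NormedAddCommGroup P] [NormedSpace ℝ P]
    [NormedAddCommGroup E] [NormedSpace ℝ E] [CompleteSpace E]
    [NormedAddCommGroup E'] [NormedSpace ℝ E'] (i : E →ₗᵢ[ℝ] E') {f : P → E} {x : P}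
    {L : P →L[ℝ] E'} (h : HasFDerivAt (fun y => i (f y)) L x) (v : P) :
    L v ∈ LinearMap.range i.toLinearMap := by
  have hcl : IsClosed (LinearMap.range i.toLinearMap : Set E') := by
    have := i.isometry.isClosedEmbedding.isClosed_range
    rw [LinearMap.coe_range]
    exact this
  have h1 : HasDerivAt (fun s : ℝ => i (f (x + s • v))) (L v) 0 := by
    have h2 : HasDerivAt (fun s : ℝ => x + s • v) v 0 := by
      simpa using ((hasDerivAt_id (0:ℝ)).smul_const v).const_add x
    have h3 : HasFDerivAt (fun y => i (f y)) L (x + (0:ℝ) • v) := by simpa using h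
    exact h3.comp_hasDerivAt (0:ℝ) h2
  rw [hasDerivAt_iff_tendsto_slope] at h1
  refine hcl.mem_of_tendsto h1 (Eventually.of_forall fun s => ?_)
  refine ⟨(s - 0)⁻¹ • (f (x + s • v) - f (x + (0:ℝ) • v)), ?_⟩
  simp [slope]

/-- Smoothness can be tested after a linear isometry with complete source. -/
theorem contDiffOn_of_isometry {P : Type} [NormedAddCommGroup P] [NormedSpace ℝ P] {s : Set P}
    (hs : IsOpen s) (n : ℕ) : ∀ {E E' : Type} [NormedAddCommGroup E] [NormedSpace ℝ E]
    [CompleteSpace E] [NormedAddCommGroup E'] [NormedSpace ℝ E'] (i : E →ₗᵢ[ℝ] E') {f : P → E},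
    ContDiffOn ℝ n (fun y => i (f y)) s → ContDiffOn ℝ n f s := by
  induction n with
  | zero =>
    intro E E' _ _ _ _ _ i f hf
    rw [Nat.cast_zero, contDiffOn_zero] at *
    exact i.isometry.isEmbedding.continuousOn_iff.2 hf
  | succ n ih =>
    intro E E' _ _ _ _ _ i f hf
    push_cast at *
    rw [contDiffOn_succ_iff_fderiv_of_isOpen hs] at *
    have key : ∀ x ∈ s, ∃ D : P →L[ℝ] E, HasFDerivAt f D x ∧
        i.toContinuousLinearMap.comp D = fderiv ℝ (fun y => i (f y)) x := by
      intro x hx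
      have hL := ((hf.1 x hx).differentiableAt (hs.mem_nhds hx)).hasFDerivAt
      set L := fderiv ℝ (fun y => i (f y)) x
      set D : P →L[ℝ] E := (i.equivRange.symm.toContinuousLinearEquiv :
        LinearMap.range i.toLinearMap →L[ℝ] E).comp (L.codRestrict _ (hL.mem_range_isometry i)) with hD
      have hiD : ∀ v, i (D v) = L v := by
        intro v
        have : i.equivRange (i.equivRange.symm ((L.codRestrict _ (hL.mem_range_isometry i)) v)) =
          (L.codRestrict _ (hL.mem_range_isometry i)) v := LinearIsometryEquiv.apply_symm_apply _ _
        have := congrArg Subtype.val this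
        exact this
      refine ⟨D, ?_, ContinuousLinearMap.ext hiD⟩
      rw [hasFDerivAt_iff_isLittleO] at hL ⊢
      rw [← Asymptotics.isLittleO_norm_left] at hL ⊢
      refine hL.congr_left fun y => ?_
      rw [← hiD, ← map_sub, ← map_sub, i.norm_map]
    refine ⟨fun x hx => (key x hx).choose_spec.1.differentiableAt.differentiableWithinAt,
      fun h => by simp at h, ?_⟩
    let j : (P →L[ℝ] E) →ₗᵢ[ℝ] (P →L[ℝ] E') :=
      { toFun := fun D => i.toContinuousLinearMap.comp D
        map_add' := fun a b => by ext; simp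
        map_smul' := fun a b => by ext; simp
        norm_map' := fun D => i.norm_toContinuousLinearMap_comp }
    refine ih j (hf.2.2.congr fun x hx => ?_)
    obtain ⟨D, h1, h2⟩ := key x hx
    rw [h1.fderiv, ← h2]; rfl

/-- Iterated primitives from `0`. -/
def jint : ℕ → (ℝ → ℝ) → ℝ → ℝ
  | 0, f => f
  | m + 1, f => fun x => ∫ s in (0:ℝ)..x, jint m f s

theorem jint_hasDerivAt_aux {f : ℝ → ℝ} (hf : Continuous f) (m : ℕ) :
    Continuous (jint m f) ∧ ∀ x, HasDerivAt (jint (m + 1) f) (jint m f x) x := by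
  induction m with
  | zero =>
    exact ⟨hf, fun x => intervalIntegral.integral_hasDerivAt_right (hf.intervalIntegrable _ _)
      (hf.stronglyMeasurableAtFilter _ _) hf.continuousAt⟩
  | succ m ih =>
    have hc : Continuous (jint (m + 1) f) :=
      continuous_iff_continuousAt.2 fun x => (ih.2 x).continuousAt
    exact ⟨hc, fun x => intervalIntegral.integral_hasDerivAt_right (hc.intervalIntegrable _ _)
      (hc.stronglyMeasurableAtFilter _ _) hc.continuousAt⟩

theorem jint_continuous {f : ℝ → ℝ} (hf : Continuous f) (m : ℕ) : Continuous (jint m f) :=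
  (jint_hasDerivAt_aux hf m).1

theorem jint_hasDerivAt {f : ℝ → ℝ} (hf : Continuous f) (m : ℕ) (x : ℝ) :
    HasDerivAt (jint (m + 1) f) (jint m f x) x := (jint_hasDerivAt_aux hf m).2 x

theorem jint_succ_zero (f : ℝ → ℝ) (m : ℕ) : jint (m + 1) f 0 = 0 := by simp [jint]

theorem jint_add {f g : ℝ → ℝ} (hf : Continuous f) (hg : Continuous g) (m : ℕ) (x : ℝ) :
    jint m (fun y => f y + g y) x = jint m f x + jint m g x := by
  induction m generalizing x with
  | zero => rfl
  | succ m ih =>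
    simp only [jint]
    rw [← intervalIntegral.integral_add ((jint_continuous hf m).intervalIntegrable _ _)
      ((jint_continuous hg m).intervalIntegrable _ _)]
    exact intervalIntegral.integral_congr fun y _ => ih y

theorem jint_smul {f : ℝ → ℝ} (c : ℝ) (m : ℕ) (x : ℝ) :
    jint m (fun y => c * f y) x = c * jint m f x := by
  induction m generalizing x with
  | zero => rfl
  | succ m ih =>
    simp only [jint]
    rw [← intervalIntegral.integral_const_mul]
    exact intervalIntegral.integral_congr fun y _ => ih y

theorem jint_bound {f : ℝ → ℝ} {C : ℝ} (hC : ∀ x, |f x| ≤ C) (m : ℕ) (x : ℝ) :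
    |jint m f x| ≤ |x| ^ m * C := by
  induction m generalizing x with
  | zero => simpa [jint] using hC x
  | succ m ih =>
    have hC0 : 0 ≤ C := (abs_nonneg _).trans (hC 0)
    have := intervalIntegral.norm_integral_le_of_norm_le_const (a := (0:ℝ)) (b := x)
      (f := jint m f) (C := |x| ^ m * C) (fun y hy => by
        refine (ih y).trans ?_
        have : |y| ≤ |x| := by
          rcases le_total 0 x with h | h
          · rw [uIoc_of_le h] at hy
            rw [abs_of_pos hy.1, abs_of_nonneg h]; exact hy.2
          · rw [uIoc_of_ge h] at hy
            rw [abs_of_nonpos hy.2, abs_of_nonpos h]; linarith [hy.1]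
        gcongr)
    simp only [jint]
    rw [Real.norm_eq_abs] at this
    refine this.trans (le_of_eq ?_)
    rw [sub_zero, pow_succ]; ring

theorem jint_taylor {f f' : ℝ → ℝ} (hf : ∀ x, HasDerivAt f (f' x) x) (hf' : Continuous f')
    (i : ℕ) (x : ℝ) : jint i f x = f 0 * ((i.factorial : ℝ)⁻¹ * x ^ i) + jint (i + 1) f' x := by
  induction i generalizing x with
  | zero =>
    have := intervalIntegral.integral_eq_sub_of_hasDerivAt (fun y _ => hf y)
      (hf'.intervalIntegrable 0 x)
    simp only [jint, this]; simp
  | succ i ih =>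
    have h1 : jint (i + 1) f x = ∫ s in (0:ℝ)..x,
        (f 0 * ((i.factorial : ℝ)⁻¹ * s ^ i) + jint (i + 1) f' s) :=
      intervalIntegral.integral_congr fun y _ => ih y
    rw [h1, intervalIntegral.integral_add
      ((by fun_prop : Continuous fun s : ℝ => f 0 * ((i.factorial : ℝ)⁻¹ * s ^ i)).intervalIntegrable
        _ _) ((jint_continuous hf' (i + 1)).intervalIntegrable _ _),
      intervalIntegral.integral_const_mul, intervalIntegral.integral_const_mul, integral_pow]
    congr 1
    rw [Nat.factorial_succ]
    have : ((i : ℝ) + 1) ≠ 0 := by positivity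
    push_cast
    rw [zero_pow (Nat.succ_ne_zero i), sub_zero]
    field_simp

theorem jint_taylor2 {f : ℝ → ℝ} (hf : Continuous f) {C : ℝ} (hC : ∀ x, |f x| ≤ C) (m : ℕ)
    (a h : ℝ) : |jint (m + 2) f (a + h) - jint (m + 2) f a - h * jint (m + 1) f a| ≤
      (|a| + |h|) ^ m * C * |h| * |h| := by
  have hC0 : 0 ≤ C := (abs_nonneg _).trans (hC 0)
  have hseg : ∀ y ∈ uIcc a (a + h), |y - a| ≤ |h| := by
    intro y hy
    have := abs_sub_left_of_mem_uIcc hy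
    simpa using this
  have h1 : ∀ y ∈ uIcc a (a + h), ‖jint m f y‖ ≤ (|a| + |h|) ^ m * C := by
    intro y hy
    refine (jint_bound hC m y).trans ?_
    have : |y| ≤ |a| + |h| := by
      have := abs_add_le a (y - a)
      rw [add_sub_cancel] at this
      linarith [hseg y hy]
    gcongr
  have h2 : ∀ y ∈ uIcc a (a + h), ‖jint (m + 1) f y - jint (m + 1) f a‖ ≤
      (|a| + |h|) ^ m * C * |h| := by
    intro y hy
    have := Convex.norm_image_sub_le_of_norm_hasDerivWithin_le (s := uIcc a (a + h))
      (fun y _ => (jint_hasDerivAt hf m y).hasDerivWithinAt) h1 (convex_uIcc _ _)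
      left_mem_uIcc hy
    refine this.trans ?_
    gcongr
    exact hseg y hy
  have h3 := Convex.norm_image_sub_le_of_norm_hasDerivWithin_le (s := uIcc a (a + h))
      (f := fun y => jint (m + 2) f y - y * jint (m + 1) f a)
      (f' := fun y => jint (m + 1) f y - jint (m + 1) f a)
      (fun y _ => ((jint_hasDerivAt hf (m + 1) y).sub
        (by simpa using (hasDerivAt_id y).mul_const _)).hasDerivWithinAt) h2 (convex_uIcc _ _)
      left_mem_uIcc right_mem_uIcc
  rw [Real.norm_eq_abs, Real.norm_eq_abs, add_sub_cancel_left] at h3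
  refine le_trans (le_of_eq ?_) h3
  congr 1; ring

section NJ
set_option maxSynthPendingDepth 3
variable {I : Type} [TopologicalSpace I]

/-- Composition of iterated primitives with a bounded continuous function. -/
def NJ (m : ℕ) (η : I →ᵇ ℝ) : (ℝ →ᵇ ℝ) →L[ℝ] (I →ᵇ ℝ) :=
  LinearMap.mkContinuous
    { toFun := fun f => BoundedContinuousFunction.ofNormedAddCommGroup
        (fun x => jint m f (η x)) ((jint_continuous f.continuous m).comp η.continuous)
        (‖η‖ ^ m * ‖f‖) (fun x => (jint_bound (f.norm_coe_le_norm) m (η x)).trans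
          (by gcongr; exact η.norm_coe_le_norm x))
      map_add' := fun f g => by
        ext x
        exact jint_add f.continuous g.continuous m (η x)
      map_smul' := fun c f => by
        ext x
        exact jint_smul c m (η x) }
    (‖η‖ ^ m) (fun f => (BoundedContinuousFunction.norm_le (by positivity)).2 fun x =>
      (jint_bound (f.norm_coe_le_norm) m (η x)).trans (by gcongr; exact η.norm_coe_le_norm x))

@[simp] theorem NJ_apply (m : ℕ) (η : I →ᵇ ℝ) (f : ℝ →ᵇ ℝ) (x : I) :
    NJ m η f x = jint m f (η x) := rfl

theorem NJ_lipschitz : LipschitzWith 1 (fun η : I →ᵇ ℝ => NJ 1 η) := by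
  refine LipschitzWith.of_dist_le_mul fun η η' => ?_
  rw [dist_eq_norm, dist_eq_norm, NNReal.coe_one, one_mul]
  refine ContinuousLinearMap.opNorm_le_bound _ (norm_nonneg _) fun f => ?_
  refine (BoundedContinuousFunction.norm_le (by positivity)).2 fun x => ?_
  have := Convex.norm_image_sub_le_of_norm_hasDerivWithin_le (s := univ) (C := ‖f‖)
      (fun y _ => (jint_hasDerivAt f.continuous 0 y).hasDerivWithinAt)
      (fun y _ => f.norm_coe_le_norm y) convex_univ (mem_univ (η' x)) (mem_univ (η x))
  have h2 : ‖η x - η' x‖ ≤ ‖η - η'‖ := (η - η').norm_coe_le_norm x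
  change ‖jint (0 + 1) f (η x) - jint (0 + 1) f (η' x)‖ ≤ _
  refine this.trans ?_
  rw [mul_comm]
  gcongr


/-- `A ↦ (h ↦ (f ↦ h * A f))`. -/
def NJder : ((ℝ →ᵇ ℝ) →L[ℝ] (I →ᵇ ℝ)) →L[ℝ] (I →ᵇ ℝ) →L[ℝ] ((ℝ →ᵇ ℝ) →L[ℝ] (I →ᵇ ℝ)) :=
  ((ContinuousLinearMap.compL ℝ (ℝ →ᵇ ℝ) (I →ᵇ ℝ) (I →ᵇ ℝ)).comp
    (ContinuousLinearMap.mul ℝ (I →ᵇ ℝ))).flip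


theorem NJder_apply (A : (ℝ →ᵇ ℝ) →L[ℝ] (I →ᵇ ℝ)) (h : I →ᵇ ℝ) (f : ℝ →ᵇ ℝ) :
    NJder A h f = h * A f := rfl

theorem hasFDerivAt_of_sq {E F : Type} [NormedAddCommGroup E] [NormedSpace ℝ E]
    [NormedAddCommGroup F] [NormedSpace ℝ F] {f : E → F} {L : E →L[ℝ] F} {x : E} {C : ℝ}
    (h : ∀ v : E, ‖v‖ ≤ 1 → ‖f (x + v) - f x - L v‖ ≤ C * ‖v‖ * ‖v‖) : HasFDerivAt f L x := by
  rw [hasFDerivAt_iff_isLittleO_nhds_zero]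
  have h1 : (fun v => f (x + v) - f x - L v) =O[𝓝 0] fun v : E => ‖v‖ ^ 2 := by
    refine Asymptotics.IsBigO.of_bound C ?_
    filter_upwards [Metric.closedBall_mem_nhds (0 : E) one_pos] with v hv
    have := h v (by simpa using hv)
    rw [norm_pow, norm_norm]
    linarith
  refine h1.trans_isLittleO ?_
  have := Asymptotics.isLittleO_norm_pow_id (E' := E) one_lt_two
  exact this


theorem NJ_hasFDerivAt (m : ℕ) (η : I →ᵇ ℝ) :
    HasFDerivAt (fun η : I →ᵇ ℝ => NJ (m + 2) η) (NJder (NJ (m + 1) η)) η := by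
  refine hasFDerivAt_of_sq (C := (‖η‖ + 1) ^ m) fun v hv => ?_
  refine ContinuousLinearMap.opNorm_le_bound _ (by positivity) fun f => ?_
  refine (BoundedContinuousFunction.norm_le (by positivity)).2 fun x => ?_
  have := jint_taylor2 f.continuous (f.norm_coe_le_norm) m (η x) (v x)
  change |jint (m + 2) f (η x + v x) - jint (m + 2) f (η x) - v x * jint (m + 1) f (η x)| ≤ _
  refine this.trans ?_
  have h1 : |η x| ≤ ‖η‖ := η.norm_coe_le_norm x
  have h2 : |v x| ≤ ‖v‖ := v.norm_coe_le_norm x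
  calc (|η x| + |v x|) ^ m * ‖f‖ * |v x| * |v x| ≤ (‖η‖ + 1) ^ m * ‖f‖ * ‖v‖ * ‖v‖ := by
        gcongr
        exact h2.trans hv
    _ = _ := by ring


theorem NJ_contDiff (m : ℕ) : ContDiff ℝ m (fun η : I →ᵇ ℝ => NJ (m + 1) η) := by
  induction m with
  | zero =>
    rw [Nat.cast_zero, contDiff_zero]
    exact NJ_lipschitz.continuous
  | succ m ih =>
    push_cast
    rw [contDiff_succ_iff_hasFDerivAt]
    exact ⟨fun η => NJder (NJ (m + 1) η), NJder.contDiff.comp ih, NJ_hasFDerivAt m⟩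

/-- Joint smoothness of `(t, η) ↦ J^i (F t) ∘ η`. -/
theorem nemytskii {P : Type} [NormedAddCommGroup P] [NormedSpace ℝ P] {U : Set P} {n : ℕ} (m : ℕ) :
    ∀ (i : ℕ) (F : ℕ → P → (ℝ →ᵇ ℝ)), (∀ j ≤ m, ContDiffOn ℝ n (F j) U) →
    (∀ j < m, ∀ t ∈ U, ∀ x, HasDerivAt (F j t) (F (j + 1) t x) x) → n + 1 ≤ i + m →
    ContDiffOn ℝ n (fun p : P × (I →ᵇ ℝ) => NJ i p.2 (F 0 p.1)) (U ×ˢ univ) := by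
  have hfst : ∀ {F : P → (ℝ →ᵇ ℝ)}, ContDiffOn ℝ n F U →
      ContDiffOn ℝ n (fun p : P × (I →ᵇ ℝ) => F p.1) (U ×ˢ univ) := fun hF =>
    hF.comp contDiff_fst.contDiffOn fun p hp => hp.1
  induction m with
  | zero =>
    intro i F hF _ hi
    obtain ⟨i, rfl⟩ : ∃ i', i = i' + 1 := ⟨i - 1, by omega⟩
    have h1 : ContDiff ℝ n (fun η : I →ᵇ ℝ => NJ (i + 1) η) :=
      (NJ_contDiff i).of_le (by exact_mod_cast (by omega : n ≤ i))
    exact (h1.comp contDiff_snd).contDiffOn.clm_apply (hfst (hF 0 le_rfl))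
  | succ m ih =>
    intro i F hF hd hi
    have h1 := ih (i + 1) (fun j => F (j + 1)) (fun j hj => hF _ (by omega))
      (fun j hj => hd _ (by omega)) (by omega)
    have h2 : ContDiffOn ℝ n (fun p : P × (I →ᵇ ℝ) =>
        (F 0 p.1 0 * (i.factorial : ℝ)⁻¹) • p.2 ^ i) (U ×ˢ univ) := by
      have hp : ContDiff ℝ n (fun p : P × (I →ᵇ ℝ) => p.2 ^ i) := contDiff_snd.pow i
      refine ContDiffOn.smul (?_ : ContDiffOn ℝ n
        (fun p : P × (I →ᵇ ℝ) => F 0 p.1 0 * (i.factorial : ℝ)⁻¹) (U ×ˢ univ)) hp.contDiffOn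
      refine ContDiffOn.mul (?_ : ContDiffOn ℝ n
        (fun p : P × (I →ᵇ ℝ) => F 0 p.1 0) (U ×ˢ univ)) contDiffOn_const
      exact (BoundedContinuousFunction.evalCLM ℝ (0:ℝ) : (ℝ →ᵇ ℝ) →L[ℝ] ℝ).contDiff.comp_contDiffOn
        (hfst (hF 0 (by omega)))
    refine (h2.add h1).congr fun p hp => ?_
    ext x
    have := jint_taylor (fun y => hd 0 (by omega) p.1 hp.1 y) (F 1 p.1).continuous i (p.2 x)
    rw [NJ_apply, this]
    simp
    ring

end NJ

set_option maxSynthPendingDepth 3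
/-- The symbolic space, with the discrete topology. -/
structure Xq (q : ℕ) : Type where
  /-- the letters -/
  s : ℕ → Fin (q + 1)

instance (q : ℕ) : TopologicalSpace (Xq q) := ⊥
instance (q : ℕ) : DiscreteTopology (Xq q) := ⟨rfl⟩

namespace Xq
variable {q : ℕ}

theorem ext_s {x y : Xq q} (h : ∀ n, x.s n = y.s n) : x = y := by
  cases x; cases y; congr; exact funext h

/-- The shift. -/
def sh (x : Xq q) : Xq q := ⟨fun n => x.s (n + 1)⟩
/-- The first letter. -/
def hd (x : Xq q) : Fin (q + 1) := x.s 0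
/-- Adding a letter. -/
def cons (a : Fin (q + 1)) (x : Xq q) : Xq q := ⟨fun n => Nat.casesOn n a x.s⟩

@[simp] theorem sh_cons (a : Fin (q + 1)) (x : Xq q) : sh (cons a x) = x := rfl
@[simp] theorem hd_cons (a : Fin (q + 1)) (x : Xq q) : hd (cons a x) = a := rfl

theorem cons_hd_sh (x : Xq q) : cons (hd x) (sh x) = x :=
  ext_s fun n => by cases n <;> rfl

open scoped Classical in
/-- The ultrametric. -/
def dl (κ : ℝ) (x y : Xq q) : ℝ :=
  if h : ∃ n, x.s n ≠ y.s n then κ ^ (Nat.find h) else 0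

theorem dl_self (κ : ℝ) (x : Xq q) : dl κ x x = 0 := by simp [dl]

theorem dl_ne (κ : ℝ) {x y : Xq q} (h : hd x ≠ hd y) : dl κ x y = 1 := by
  classical
  have h1 : ∃ n, x.s n ≠ y.s n := ⟨0, h⟩
  rw [dl, dif_pos h1, (Nat.find_eq_zero h1).2 h, pow_zero]

theorem dl_eq (κ : ℝ) {x y : Xq q} (h : hd x = hd y) : dl κ x y = κ * dl κ (sh x) (sh y) := by
  classical
  by_cases h1 : ∃ n, x.s n ≠ y.s n
  · obtain ⟨n, hn⟩ := id h1
    have h2 : ∃ n, x.s (n + 1) ≠ y.s (n + 1) := by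
      cases n with
      | zero => exact absurd h hn
      | succ n => exact ⟨n, hn⟩
    have h3 : ∃ n, (sh x).s n ≠ (sh y).s n := h2
    rw [dl, dif_pos h1, dl, dif_pos h3, Nat.find_comp_succ h1 h2 (fun hc => hc h), pow_succ']
    rfl
  · have h3 : ¬ ∃ n, (sh x).s n ≠ (sh y).s n := fun ⟨n, hn⟩ => h1 ⟨n + 1, hn⟩
    rw [dl, dif_neg h1, dl, dif_neg h3, mul_zero]

theorem dl_symm (κ : ℝ) (x y : Xq q) : dl κ x y = dl κ y x := by
  classical
  have h : (fun n => x.s n ≠ y.s n) = fun n => y.s n ≠ x.s n := by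
    funext n; exact propext ne_comm
  unfold dl
  split_ifs with h1 h2 h2
  · congr 1
    exact le_antisymm (Nat.find_min' _ (Nat.find_spec h2).symm)
      (Nat.find_min' _ (Nat.find_spec h1).symm)
  · exact absurd (h ▸ h1) h2
  · exact absurd (h ▸ h2) h1
  · rfl

theorem dl_nonneg {κ : ℝ} (hκ : 0 < κ) (x y : Xq q) : 0 ≤ dl κ x y := by
  rw [dl]; split_ifs <;> positivity

theorem dl_le {κ : ℝ} (hκ : 0 < κ) (hκ1 : κ < 1) (x y : Xq q) : dl κ x y ≤ 1 := by
  rw [dl]; split_ifs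
  · exact pow_le_one₀ hκ.le hκ1.le
  · exact zero_le_one

/-- The system of inverse branches. -/
def sys (q : ℕ) (κ : ℝ) (hκ : 0 < κ) (hκ1 : κ < 1) : Sys (Xq q) (Fin q) where
  κ := κ
  κ_pos := hκ
  κ_lt := hκ1
  δ := dl κ
  δ_self := dl_self κ
  δ_pos := by
    intro x y h
    have : ∃ n, x.s n ≠ y.s n := by
      by_contra hc; push Not at hc; exact h (ext_s hc)
    rw [dl, dif_pos this]; positivity
  δ_le := dl_le hκ hκ1
  δ_symm := dl_symm κ
  ψ := fun j x => cons j.castSucc x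
  δ_ψ := by
    intro j x y
    rw [dl_eq κ (by simp), sh_cons, sh_cons]

end Xq

/-- A bounded function with a contraction property vanishes. -/
theorem eq_zero_of_contr {Y : Type} {f : Y → ℝ} {B c : ℝ} (hB : ∀ y, |f y| ≤ B) (hc0 : 0 ≤ c)
    (hc : c < 1) (h : ∀ y, ∃ y', |f y| ≤ c * |f y'|) (y : Y) : f y = 0 := by
  have h1 : ∀ n : ℕ, ∀ y, |f y| ≤ c ^ n * B := by
    intro n
    induction n with
    | zero => intro y; simpa using hB y
    | succ n ih =>
      intro y
      obtain ⟨y', hy⟩ := h y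
      calc |f y| ≤ c * |f y'| := hy
        _ ≤ c * (c ^ n * B) := by gcongr; exact ih y'
        _ = _ := by ring
  have h2 : Tendsto (fun n : ℕ => c ^ n * B) atTop (𝓝 0) := by
    simpa using (tendsto_pow_atTop_nhds_zero_of_lt_one hc0 hc).mul_const B
  have := ge_of_tendsto' h2 fun n => h1 n y
  exact abs_nonpos_iff.1 this

section BCFtools
variable {I I' : Type} [TopologicalSpace I] [TopologicalSpace I']

/-- A bounded continuous function which is bounded away from zero is a unit. -/
theorem bcf_isUnit {a : I →ᵇ ℝ} {α : ℝ} (hα : 0 < α) (ha : ∀ x, α ≤ |a x|) : IsUnit a := by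
  have hne : ∀ x, a x ≠ 0 := fun x h => by have := ha x; rw [h, abs_zero] at this; linarith
  let b : I →ᵇ ℝ := BoundedContinuousFunction.ofNormedAddCommGroup (fun x => (a x)⁻¹)
    (a.continuous.inv₀ hne) α⁻¹ (fun x => by
      rw [norm_inv, Real.norm_eq_abs]; exact inv_anti₀ hα (ha x))
  refine IsUnit.of_mul_eq_one b ?_
  ext x
  exact mul_inv_cancel₀ (hne x)

theorem bcf_inverse_apply {a : I →ᵇ ℝ} (ha : IsUnit a) (x : I) : (Ring.inverse a) x = (a x)⁻¹ := by
  have h := Ring.mul_inverse_cancel a ha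
  have h1 : a x * (Ring.inverse a) x = 1 := by
    have := congrArg (fun f : I →ᵇ ℝ => f x) h
    simpa using this
  exact eq_inv_of_mul_eq_one_right h1

/-- `M_a - B` is invertible as soon as `|a|` dominates `‖B‖`. -/
theorem mul_sub_isUnit {a : I →ᵇ ℝ} {α : ℝ} (ha : ∀ x, α ≤ |a x|)
    {B : (I →ᵇ ℝ) →L[ℝ] (I →ᵇ ℝ)} (hB : ‖B‖ < α) :
    IsUnit (ContinuousLinearMap.mul ℝ (I →ᵇ ℝ) a - B) := by
  have hα : 0 < α := (norm_nonneg _).trans_lt hB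
  obtain ⟨u, rfl⟩ := bcf_isUnit hα ha
  set A := ContinuousLinearMap.mul ℝ (I →ᵇ ℝ) (u : I →ᵇ ℝ)
  set A' := ContinuousLinearMap.mul ℝ (I →ᵇ ℝ) ((u⁻¹ : (I →ᵇ ℝ)ˣ) : I →ᵇ ℝ)
  have h1 : A * A' = 1 := by
    refine ContinuousLinearMap.ext fun f => ?_
    change (u : I →ᵇ ℝ) * (((u⁻¹ : (I →ᵇ ℝ)ˣ) : I →ᵇ ℝ) * f) = f
    rw [← mul_assoc, Units.mul_inv, one_mul]
  have h2 : A' * A = 1 := by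
    refine ContinuousLinearMap.ext fun f => ?_
    change ((u⁻¹ : (I →ᵇ ℝ)ˣ) : I →ᵇ ℝ) * ((u : I →ᵇ ℝ) * f) = f
    rw [← mul_assoc, Units.inv_mul, one_mul]
  have hA : IsUnit A := ⟨⟨A, A', h1, h2⟩, rfl⟩
  have h3 : A - B = A * (1 - A' * B) := by
    rw [mul_sub, mul_one, ← mul_assoc, h1, one_mul]
  rw [h3]
  refine hA.mul ?_
  refine isUnit_one_sub_of_norm_lt_one ?_
  have h4 : ‖A'‖ ≤ α⁻¹ := by
    refine (ContinuousLinearMap.opNorm_mul_apply_le ℝ _ _).trans ?_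
    refine (BoundedContinuousFunction.norm_le (by positivity)).2 fun x => ?_
    have : ((u⁻¹ : (I →ᵇ ℝ)ˣ) : I →ᵇ ℝ) x = ((u : I →ᵇ ℝ) x)⁻¹ := by
      rw [← Ring.inverse_unit, bcf_inverse_apply u.isUnit]
    rw [this, norm_inv, Real.norm_eq_abs]
    exact inv_anti₀ hα (ha x)
  calc ‖A' * B‖ ≤ ‖A'‖ * ‖B‖ := norm_mul_le _ _
    _ ≤ α⁻¹ * ‖B‖ := by gcongr
    _ < α⁻¹ * α := by gcongr
    _ = 1 := inv_mul_cancel₀ hα.ne'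

/-- Composition with a continuous map. -/
def bcomp (f : I → I') (hf : Continuous f) : (I' →ᵇ ℝ) →L[ℝ] (I →ᵇ ℝ) :=
  LinearMap.mkContinuous
    { toFun := fun a => a.compContinuous ⟨f, hf⟩
      map_add' := fun a b => rfl
      map_smul' := fun c a => rfl } 1
    (fun a => (BoundedContinuousFunction.norm_le (by positivity)).2 fun x => by
      rw [one_mul]; exact a.norm_coe_le_norm _)

@[simp] theorem bcomp_apply (f : I → I') (hf : Continuous f) (a : I' →ᵇ ℝ) (x : I) :
    bcomp f hf a x = a (f x) := rfl

theorem norm_bcomp_le (f : I → I') (hf : Continuous f) : ‖bcomp f hf‖ ≤ 1 :=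
  LinearMap.mkContinuous_norm_le _ zero_le_one _

theorem bcf_exp_apply (a : I →ᵇ ℝ) (x : I) : (NormedSpace.exp a) x = Real.exp (a x) := by
  let e : (I →ᵇ ℝ) →+* ℝ :=
    { toFun := fun f => f x, map_one' := rfl, map_mul' := fun _ _ => rfl, map_zero' := rfl,
      map_add' := fun _ _ => rfl }
  have he : Continuous e := (BoundedContinuousFunction.evalCLM ℝ x :
    (I →ᵇ ℝ) →L[ℝ] ℝ).continuous
  have := NormedSpace.map_exp e he a
  rw [Real.exp_eq_exp_ℝ]
  exact this

theorem contDiff_bcf_exp {n : ℕ} : ContDiff ℝ n (fun a : I →ᵇ ℝ => NormedSpace.exp a) := by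
  rw [contDiff_iff_contDiffAt]
  intro a
  exact (NormedSpace.exp_analytic (𝕂 := ℝ) a).contDiffAt

/-- The convex combinations parameter. -/
def clampR (s : ℝ) : ℝ := max 0 (min 1 s)

theorem clampR_cont : Continuous clampR := by unfold clampR; fun_prop
theorem clampR_mem {s : ℝ} (hs : s ∈ uIcc (0:ℝ) 1) : clampR s = s := by
  rw [uIcc_of_le zero_le_one] at hs
  simp [clampR, hs.1, hs.2]
theorem clampR_bd (s : ℝ) : 0 ≤ clampR s ∧ clampR s ≤ 1 :=
  ⟨le_max_left _ _, max_le zero_le_one (min_le_left _ _)⟩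

/-- Segments between values. -/
def segL : (I →ᵇ ℝ) →L[ℝ] (((I × I) × ℝ) →ᵇ ℝ) :=
  LinearMap.mkContinuous
    { toFun := fun a => BoundedContinuousFunction.ofNormedAddCommGroup
        (fun p : (I × I) × ℝ => clampR p.2 * a p.1.1 + (1 - clampR p.2) * a p.1.2)
        (by have := clampR_cont; fun_prop) (‖a‖) (fun p => by
          obtain ⟨h1, h2⟩ := clampR_bd p.2
          refine (norm_add_le _ _).trans ?_
          rw [norm_mul, norm_mul, Real.norm_of_nonneg h1, Real.norm_of_nonneg (sub_nonneg.2 h2)]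
          have h3 := a.norm_coe_le_norm p.1.1
          have h4 := a.norm_coe_le_norm p.1.2
          nlinarith)
      map_add' := fun a b => by ext p; simp; ring
      map_smul' := fun c a => by ext p; simp; ring } 1
    (fun a => (BoundedContinuousFunction.norm_le (by positivity)).2 fun p => by
          rw [one_mul]
          obtain ⟨h1, h2⟩ := clampR_bd p.2
          refine (norm_add_le _ _).trans ?_
          rw [norm_mul, norm_mul, Real.norm_of_nonneg h1, Real.norm_of_nonneg (sub_nonneg.2 h2)]
          have h3 := a.norm_coe_le_norm p.1.1
          have h4 := a.norm_coe_le_norm p.1.2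
          nlinarith)

theorem segL_apply (a : I →ᵇ ℝ) (x y : I) (s : ℝ) :
    segL a ((x, y), s) = clampR s * a x + (1 - clampR s) * a y := rfl

/-- Averages. -/
def avgL [DiscreteTopology I] : ((I × ℝ) →ᵇ ℝ) →L[ℝ] (I →ᵇ ℝ) :=
  LinearMap.mkContinuous
    { toFun := fun a => BoundedContinuousFunction.ofNormedAddCommGroup
        (fun p : I => ∫ s in (0:ℝ)..1, a (p, s)) continuous_of_discreteTopology (‖a‖) (fun p => by
          have := intervalIntegral.norm_integral_le_of_norm_le_const (a := (0:ℝ)) (b := 1)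
            (f := fun s => a (p, s)) (C := ‖a‖) (fun s _ => a.norm_coe_le_norm _)
          simpa using this)
      map_add' := fun a b => by
        ext p
        exact intervalIntegral.integral_add
          ((by fun_prop : Continuous fun s => a (p, s)).intervalIntegrable _ _)
          ((by fun_prop : Continuous fun s => b (p, s)).intervalIntegrable _ _)
      map_smul' := fun c a => by
        ext p
        exact intervalIntegral.integral_const_mul c (fun s => a (p, s)) } 1
    (fun a => (BoundedContinuousFunction.norm_le (by positivity)).2 fun p => by
          have := intervalIntegral.norm_integral_le_of_norm_le_const (a := (0:ℝ)) (b := 1)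
            (f := fun s => a (p, s)) (C := ‖a‖) (fun s _ => a.norm_coe_le_norm _)
          simpa using this)

theorem avgL_apply [DiscreteTopology I] (a : (I × ℝ) →ᵇ ℝ) (p : I) :
    avgL a p = ∫ s in (0:ℝ)..1, a (p, s) := rfl

/-- Hadamard's lemma. -/
theorem hadamard [DiscreteTopology I] {φ φ' : ℝ → ℝ} (hφ : ∀ x, HasDerivAt φ (φ' x) x)
    (hc : Continuous φ')
    (a : I →ᵇ ℝ) (b : ((I × I) × ℝ) →ᵇ ℝ) (hb : ∀ p, b p = φ' (segL a p)) (x y : I) :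
    φ (a x) - φ (a y) = (a x - a y) * avgL b (x, y) := by
  rw [avgL_apply]
  have h1 : ∀ s ∈ uIcc (0:ℝ) 1, HasDerivAt (fun s : ℝ => φ (s * a x + (1 - s) * a y))
      ((a x - a y) * φ' (s * a x + (1 - s) * a y)) s := by
    intro s _
    have h2 : HasDerivAt (fun s : ℝ => s * a x + (1 - s) * a y) (a x - a y) s := by
      have := ((hasDerivAt_id s).mul_const (a x)).add
        (((hasDerivAt_id s).const_sub 1).mul_const (a y))
      simp only [id, one_mul, neg_mul] at this
      exact this
    have := (hφ (s * a x + (1 - s) * a y)).comp s h2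
    rw [mul_comm]
    exact this
  have h3 := intervalIntegral.integral_eq_sub_of_hasDerivAt h1
    ((by fun_prop : Continuous fun s : ℝ =>
      (a x - a y) * φ' (s * a x + (1 - s) * a y)).intervalIntegrable _ _)
  rw [← intervalIntegral.integral_const_mul]
  have h4 : (∫ s in (0:ℝ)..1, (a x - a y) * b ((x, y), s)) =
      ∫ s in (0:ℝ)..1, (a x - a y) * φ' (s * a x + (1 - s) * a y) := by
    refine intervalIntegral.integral_congr fun s hs => ?_
    change (a x - a y) * b ((x, y), s) = (a x - a y) * φ' (s * a x + (1 - s) * a y)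
    rw [hb, segL_apply, clampR_mem hs]
  rw [h4, h3]
  simp

end BCFtools

/-- The regularity hypotheses on the families, in terms of derivatives. -/
structure Fam {P : Type} [NormedAddCommGroup P] [NormedSpace ℝ P] (U : Set P) (n r : ℕ) (lam : ℝ)
    (T G : P → ℝ → ℝ) (τ γ : ℕ → P → (ℝ →ᵇ ℝ)) : Prop where
  hU : IsOpen U
  T0 : ContDiffOn ℝ n (fun t => T t 0) U
  Td : ∀ t ∈ U, ∀ x, HasDerivAt (T t) (τ 0 t x) x
  τc : ∀ j ≤ r, ContDiffOn ℝ n (τ j) U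
  τd : ∀ j < r, ∀ t ∈ U, ∀ x, HasDerivAt (τ j t) (τ (j + 1) t x) x
  Gg : ∀ t ∈ U, ∀ x, γ 0 t x = G t x
  γc : ∀ j ≤ r, ContDiffOn ℝ n (γ j) U
  γd : ∀ j < r, ∀ t ∈ U, ∀ x, HasDerivAt (γ j t) (γ (j + 1) t x) x
  ex : ∀ t ∈ U, ∀ x, lam⁻¹ ≤ |τ 0 t x|
  n1 : 1 ≤ n
  nr : n + 2 ≤ r
  l0 : 0 < lam
  l1 : lam < 1

/-- A continuous function bounded away from zero has a constant sign. -/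
theorem const_sign {φ : ℝ → ℝ} (hφ : Continuous φ) {α : ℝ} (hα : 0 < α) (h : ∀ x, α ≤ |φ x|) :
    (∀ x, α ≤ φ x) ∨ ∀ x, φ x ≤ -α := by
  have hne : ∀ x, φ x ≠ 0 := fun x hx => by have := h x; rw [hx, abs_zero] at this; linarith
  have key : (∀ x, 0 < φ x) ∨ ∀ x, φ x < 0 := by
    by_contra hc
    push Not at hc
    obtain ⟨⟨x, hx⟩, ⟨y, hy⟩⟩ := hc
    have := mem_range_of_exists_le_of_exists_ge hφ ⟨x, hx⟩ ⟨y, hy⟩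
    obtain ⟨z, hz⟩ := this
    exact hne z hz
  rcases key with k | k
  · left; intro x; have := h x; rwa [abs_of_pos (k x)] at this
  · right; intro x; have := h x; rw [abs_of_neg (k x)] at this; linarith

theorem avgL_lower {I : Type} [TopologicalSpace I] [DiscreteTopology I] {φ : ℝ → ℝ}
    (hφ : Continuous φ) {α : ℝ} (hα : 0 < α) (h : ∀ x, α ≤ |φ x|)
    (b : (I × ℝ) →ᵇ ℝ) (a : (I × ℝ) →ᵇ ℝ) (hb : ∀ p, b p = φ (a p)) (p : I) :
    α ≤ |avgL b p| := by
  rw [avgL_apply]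
  have hi : IntervalIntegrable (fun s => b (p, s)) volume 0 1 :=
    (by fun_prop : Continuous fun s => b (p, s)).intervalIntegrable _ _
  rcases const_sign hφ hα h with k | k
  · have := intervalIntegral.integral_mono_on (zero_le_one (α := ℝ))
      (intervalIntegrable_const (c := α)) hi (fun s _ => by rw [hb]; exact k _)
    simp only [intervalIntegral.integral_const, sub_zero, one_smul] at this
    exact this.trans (le_abs_self _)
  · have := intervalIntegral.integral_mono_on (zero_le_one (α := ℝ)) hi
      (intervalIntegrable_const (c := -α)) (fun s _ => by rw [hb]; exact k _)
    simp only [intervalIntegral.integral_const, sub_zero, one_smul] at this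
    have h2 := neg_abs_le (∫ s in (0:ℝ)..1, b (p, s))
    linarith

/-- Derivative of `η ↦ J¹ f ∘ η`. -/
theorem NJ1_hasFDerivAt {I : Type} [TopologicalSpace I] {f f' : ℝ →ᵇ ℝ}
    (hf : ∀ x, HasDerivAt f (f' x) x) (η : I →ᵇ ℝ) :
    HasFDerivAt (fun η : I →ᵇ ℝ => NJ 1 η f) (ContinuousLinearMap.mul ℝ (I →ᵇ ℝ) (NJ 0 η f)) η := by
  refine hasFDerivAt_of_sq (C := ‖f'‖) fun v hv => ?_
  refine (BoundedContinuousFunction.norm_le (by positivity)).2 fun x => ?_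
  have h := jint_taylor2 f'.continuous (f'.norm_coe_le_norm) 0 (η x) (v x)
  have e0 := fun y => jint_taylor hf f'.continuous 0 y
  have e1 := fun y => jint_taylor hf f'.continuous 1 y
  change |jint 1 f (η x + v x) - jint 1 f (η x) - jint 0 f (η x) * v x| ≤ _
  rw [e1, e1, e0]
  have h2 : |v x| ≤ ‖v‖ := v.norm_coe_le_norm x
  have h3 : |jint (0 + 2) f' (η x + v x) - jint (0 + 2) f' (η x) - v x * jint (0 + 1) f' (η x)| ≤
      ‖f'‖ * ‖v‖ * ‖v‖ := by
    refine h.trans ?_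
    rw [pow_zero, one_mul]
    gcongr
  refine le_trans (le_of_eq ?_) h3
  congr 1
  simp
  ring

section
variable {P : Type} [NormedAddCommGroup P] [NormedSpace ℝ P] {U : Set P} {n r : ℕ}
  {lam : ℝ} {T G : P → ℝ → ℝ} {τ γ : ℕ → P → (ℝ →ᵇ ℝ)}

variable {I : Type} [TopologicalSpace I]

theorem Fam.compT_apply (hF : Fam U n r lam T G τ γ) {t : P} (ht : t ∈ U) (y : ℝ) : T t 0 + jint 1 (τ 0 t) y = T t y := by
  have := jint_taylor (hF.Td t ht) (τ 0 t).continuous 0 y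
  simp only [jint, Nat.factorial_zero, Nat.cast_one, inv_one, pow_zero, mul_one] at this ⊢
  exact this.symm

theorem Fam.compT (hF : Fam U n r lam T G τ γ) : ContDiffOn ℝ n (fun p : P × (I →ᵇ ℝ) =>
    (T p.1 0) • (1 : I →ᵇ ℝ) + NJ 1 p.2 (τ 0 p.1)) (U ×ˢ univ) := by
  have h1 : ContDiffOn ℝ n (fun p : P × (I →ᵇ ℝ) => T p.1 0) (U ×ˢ univ) :=
    hF.T0.comp contDiff_fst.contDiffOn fun p hp => hp.1
  exact (h1.smul contDiffOn_const).add
    (nemytskii r 1 τ hF.τc hF.τd (by have := hF.nr; omega))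

theorem Fam.compτ (hF : Fam U n r lam T G τ γ) (j : ℕ) (hj : j ≤ 1) : ContDiffOn ℝ n (fun p : P × (I →ᵇ ℝ) =>
    NJ 0 p.2 (τ j p.1)) (U ×ˢ univ) := by
  have hnr := hF.nr
  have := nemytskii (I := I) (U := U) (n := n) (r - 1) 0 (fun i => τ (i + j))
    (fun i hi => hF.τc _ (by omega))
    (fun i hi t ht x => by
      have := hF.τd (i + j) (by omega) t ht x
      rwa [show i + j + 1 = i + 1 + j by omega] at this) (by omega)
  simpa using this

theorem Fam.compγ (hF : Fam U n r lam T G τ γ) (j : ℕ) (hj : j ≤ 1) : ContDiffOn ℝ n (fun p : P × (I →ᵇ ℝ) =>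
    NJ 0 p.2 (γ j p.1)) (U ×ˢ univ) := by
  have hnr := hF.nr
  have := nemytskii (I := I) (U := U) (n := n) (r - 1) 0 (fun i => γ (i + j))
    (fun i hi => hF.γc _ (by omega))
    (fun i hi t ht x => by
      have := hF.γd (i + j) (by omega) t ht x
      rwa [show i + j + 1 = i + 1 + j by omega] at this) (by omega)
  simpa using this

/-- Expansion on the line. -/
theorem Fam.expand (hF : Fam U n r lam T G τ γ) {t : P} (ht : t ∈ U) (x y : ℝ) : lam⁻¹ * |x - y| ≤ |T t x - T t y| := by
  have hl : 0 < lam⁻¹ := inv_pos.2 hF.l0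
  let a : Bool →ᵇ ℝ := BoundedContinuousFunction.ofNormedAddCommGroup (fun b => if b then x else y)
    continuous_of_discreteTopology (max ‖x‖ ‖y‖) (fun b => by cases b <;> simp)
  have h := hadamard (hF.Td t ht) (τ 0 t).continuous a (NJ 0 (segL a) (τ 0 t)) (fun p => rfl)
    true false
  have h2 := avgL_lower (τ 0 t).continuous hl (hF.ex t ht) (NJ 0 (segL a) (τ 0 t)) (segL a)
    (fun p => rfl) (true, false)
  have e : T t x - T t y = (x - y) * avgL (NJ 0 (segL a) (τ 0 t)) (true, false) := h
  rw [e, abs_mul, mul_comm]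
  gcongr

end

theorem lift_int {T : ℝ → ℝ} {d : ℤ} (h : IsCircleLift T d) (k : ℤ) (x : ℝ) :
    T (x + k) = T x + k * d := by
  induction k using Int.induction_on generalizing x with
  | zero => simp
  | succ i ih =>
    have := h (x + i)
    push_cast at ih ⊢
    rw [← add_assoc, this, ih]; ring
  | pred i ih =>
    have h1 := h (x + (-(i:ℝ) - 1))
    have h2 := ih x
    push_cast at h2 ⊢
    rw [show x + (-(i:ℝ) - 1) + 1 = x + -(i:ℝ) by ring, h2] at h1
    linarith

theorem lift_surj {T : ℝ → ℝ} {d : ℤ} (h : IsCircleLift T d) (hd : d ≠ 0) (hc : Continuous T) :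
    Function.Surjective T := by
  have key : ∀ y : ℝ, ∃ x, T x ≤ y := by
    intro y
    obtain ⟨m, hm⟩ := exists_nat_ge (T 0 - y)
    refine ⟨((-(m:ℤ) * d.sign : ℤ) : ℝ), ?_⟩
    have := lift_int h (-(m:ℤ) * d.sign) 0
    rw [zero_add] at this
    rw [this]
    have h1 : (-(m:ℤ) * d.sign) * d ≤ -(m:ℤ) := by
      rw [mul_assoc, Int.sign_mul_self_eq_abs]
      have : 1 ≤ |d| := Int.one_le_abs hd
      nlinarith
    have h2 : ((-(m:ℤ) * d.sign : ℤ) : ℝ) * d ≤ -(m : ℝ) := by exact_mod_cast h1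
    linarith
  have key2 : ∀ y : ℝ, ∃ x, y ≤ T x := by
    intro y
    obtain ⟨m, hm⟩ := exists_nat_ge (y - T 0)
    refine ⟨(((m:ℤ) * d.sign : ℤ) : ℝ), ?_⟩
    have := lift_int h ((m:ℤ) * d.sign) 0
    rw [zero_add] at this
    rw [this]
    have h1 : (m:ℤ) ≤ ((m:ℤ) * d.sign) * d := by
      rw [mul_assoc, Int.sign_mul_self_eq_abs]
      have : 1 ≤ |d| := Int.one_le_abs hd
      nlinarith
    have h2 : (m : ℝ) ≤ (((m:ℤ) * d.sign : ℤ) : ℝ) * d := by exact_mod_cast h1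
    linarith
  exact fun y => mem_range_of_exists_le_of_exists_ge hc (key y) (key2 y)

/-- The first letter as a bounded function. -/
def digB (q : ℕ) : Xq q →ᵇ ℝ := BoundedContinuousFunction.ofNormedAddCommGroup
  (fun x => ((x.hd : ℕ) : ℝ)) continuous_of_discreteTopology q (fun x => by
    rw [Real.norm_of_nonneg (by positivity)]
    exact_mod_cast Nat.lt_succ_iff.1 x.hd.2)

/-- Composition with the shift. -/
def shB (q : ℕ) : (Xq q →ᵇ ℝ) →L[ℝ] (Xq q →ᵇ ℝ) := bcomp Xq.sh continuous_of_discreteTopology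

theorem exists_H0 (q : ℕ) {T : ℝ → ℝ} {lam : ℝ} (l0 : 0 < lam) (l1 : lam < 1)
    (hs : Function.Surjective T) (hexp : ∀ x y, lam⁻¹ * |x - y| ≤ |T x - T y|) :
    ∃ η : Xq q →ᵇ ℝ, ∀ x, T (η x) = ((x.hd : ℕ) : ℝ) + η x.sh := by
  set inv := Function.surjInv hs
  have hinv : ∀ y, T (inv y) = y := Function.surjInv_eq hs
  have hl : ∀ a b, |inv a - inv b| ≤ lam * |a - b| := by
    intro a b
    have := hexp (inv a) (inv b)
    rw [hinv, hinv] at this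
    calc |inv a - inv b| = lam * (lam⁻¹ * |inv a - inv b|) := by field_simp
      _ ≤ _ := by gcongr
  have hd : ∀ η η' : Xq q →ᵇ ℝ, ∀ x, (digB q + shB q η) x - (digB q + shB q η') x =
      η x.sh - η' x.sh := by
    intro η η' x
    change (digB q x + η x.sh) - (digB q x + η' x.sh) = _
    ring
  have hdd : ∀ η : Xq q →ᵇ ℝ, ∀ x : Xq q,
      (digB q + shB q η) x = ((x.hd : ℕ) : ℝ) + η x.sh := fun _ _ => rfl
  generalize hD : (fun η : Xq q →ᵇ ℝ => digB q + shB q η) = Dg at *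
  have hD' : ∀ η, digB q + shB q η = Dg η := fun η => by rw [← hD]
  simp only [hD'] at hd hdd
  have hex : ∀ η : Xq q →ᵇ ℝ, ∃ ζ : Xq q →ᵇ ℝ, ∀ x, ζ x = inv (Dg η x) := by
    intro η
    refine ⟨BoundedContinuousFunction.ofNormedAddCommGroup
      (fun x => inv ((Dg η) x)) continuous_of_discreteTopology
      (|inv 0| + lam * ‖Dg η‖) (fun x => ?_), fun x => rfl⟩
    have h1 := hl ((Dg η) x) 0
    have h2 := (Dg η).norm_coe_le_norm x
    rw [sub_zero] at h1
    rw [Real.norm_eq_abs] at *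
    have h3 := abs_sub_abs_le_abs_sub (inv ((Dg η) x)) (inv 0)
    nlinarith
  choose Φ hΦx using hex
  have hΦ : ContractingWith lam.toNNReal Φ := by
    refine ⟨by rw [← NNReal.coe_lt_coe, Real.coe_toNNReal _ l0.le]; exact l1, ?_⟩
    refine LipschitzWith.of_dist_le_mul fun η η' => ?_
    rw [Real.coe_toNNReal _ l0.le]
    refine (BoundedContinuousFunction.dist_le (by positivity)).2 fun x => ?_
    rw [hΦx, hΦx]
    refine (hl _ _).trans ?_
    rw [hd η η' x]
    have h2 : dist (η x.sh) (η' x.sh) ≤ dist η η' := BoundedContinuousFunction.dist_coe_le_dist _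
    rw [Real.dist_eq] at h2
    gcongr
  obtain ⟨ζ, hζ⟩ : ∃ ζ, Φ ζ = ζ := ⟨hΦ.fixedPoint, hΦ.fixedPoint_isFixedPt⟩
  refine ⟨ζ, fun x => ?_⟩
  rw [← hdd, ← hinv (Dg ζ x), ← hΦx, hζ]

theorem isInvertible_of_isUnit {E : Type} [NormedAddCommGroup E] [NormedSpace ℝ E]
    {A : E →L[ℝ] E} (h : IsUnit A) : A.IsInvertible := by
  obtain ⟨u, rfl⟩ := h
  exact ⟨ContinuousLinearEquiv.unitsEquiv ℝ E u, rfl⟩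

section
variable {P : Type} [NormedAddCommGroup P] [NormedSpace ℝ P] [CompleteSpace P] {U : Set P} {n r : ℕ}
  {lam : ℝ} {T G : P → ℝ → ℝ} {τ γ : ℕ → P → (ℝ →ᵇ ℝ)}

/-- The conjugacy with the symbolic model depends smoothly on the parameter. -/
theorem Fam.exists_H (hF : Fam U n r lam T G τ γ) (h0 : 0 ∈ U) (q : ℕ)
    (hs : Function.Surjective (T 0)) :
    ∃ H : P → (Xq q →ᵇ ℝ), ContDiffAt ℝ n H 0 ∧
      ∀ᶠ t in 𝓝 0, ∀ x, T t (H t x) = ((x.hd : ℕ) : ℝ) + H t x.sh := by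
  obtain ⟨η, hη⟩ := exists_H0 q hF.l0 hF.l1 hs (hF.expand h0)
  have hl : 1 < lam⁻¹ := (one_lt_inv₀ hF.l0).2 hF.l1
  have hUn : U ×ˢ (univ : Set (Xq q →ᵇ ℝ)) ∈ 𝓝 ((0 : P), η) :=
    prod_mem_nhds (hF.hU.mem_nhds h0) univ_mem
  have hc := (hF.compT (I := Xq q)).contDiffAt hUn
  have hc2 : ContDiffAt ℝ n (fun p : P × (Xq q →ᵇ ℝ) =>
      ((T p.1 0) • (1 : Xq q →ᵇ ℝ) + NJ 1 p.2 (τ 0 p.1)) - digB q - shB q p.2) (0, η) :=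
    (hc.sub contDiffAt_const).sub ((shB q).contDiff.contDiffAt.comp _ contDiffAt_snd)
  have hA : IsUnit (ContinuousLinearMap.mul ℝ (Xq q →ᵇ ℝ) (NJ 0 η (τ 0 0)) - shB q) :=
    mul_sub_isUnit (a := NJ 0 η (τ 0 0)) (α := lam⁻¹) (fun x => hF.ex 0 h0 (η x))
      ((norm_bcomp_le _ _).trans_lt hl)
  have hpt : ∀ t ∈ U, ∀ (ζ : Xq q →ᵇ ℝ) (x : Xq q),
      (((T t 0) • (1 : Xq q →ᵇ ℝ) + NJ 1 ζ (τ 0 t)) - digB q - shB q ζ) x =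
        T t (ζ x) - ((x.hd : ℕ) : ℝ) - ζ x.sh := by
    intro t ht ζ x
    have := hF.compT_apply ht (ζ x)
    change (T t 0 * 1 + jint 1 (τ 0 t) (ζ x)) - _ - _ = _
    rw [mul_one, this]; rfl
  obtain ⟨H, hH0, hH, hz⟩ := ift (𝕜 := ℝ) (n := n) (by have := hF.n1; omega) hc2
    (isInvertible_of_isUnit hA) (by
      have := (((NJ1_hasFDerivAt (hF.τd 0 (by have := hF.nr; omega) 0 h0) η).const_add
        ((T 0 0) • (1 : Xq q →ᵇ ℝ))).sub_const (digB q)).sub (shB q).hasFDerivAt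
      exact this) (by
      ext x
      rw [hpt 0 h0, hη]
      simp)
  refine ⟨H, hH, ?_⟩
  filter_upwards [hz, hF.hU.mem_nhds h0] with t h1 h2 x
  have := hpt t h2 (H t) x
  rw [h1] at this
  simp only [BoundedContinuousFunction.coe_zero, Pi.zero_apply] at this
  linarith

end

open Xq in
/-- Pointwise analysis of the equation satisfied by the difference quotients. -/
theorem quotient_eq {q : ℕ} {κ lam : ℝ} (hκ : 0 < κ) (l0 : 0 < lam) (l1 : lam < 1)
    (hlk : lam < κ) (hk : κ < 1) (H : Xq q →ᵇ ℝ) (Ψ Q : (Xq q × Xq q) →ᵇ ℝ) {T : ℝ → ℝ}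
    (hH : ∀ x, T (H x) = ((x.hd : ℕ) : ℝ) + H x.sh)
    (hΨ : ∀ p, lam⁻¹ ≤ |Ψ p|) (hT : ∀ x y, T (H x) - T (H y) = (H x - H y) * Ψ (x, y))
    (h1 : ∀ x y, hd x = hd y → Ψ (x, y) * Q (x, y) = κ⁻¹ * Q (x.sh, y.sh))
    (h2 : ∀ x y, hd x ≠ hd y → Ψ (x, y) * Q (x, y) = Ψ (x, y) * (H x - H y)) :
    (∀ x y, H x - H y = dl κ x y * Q (x, y)) ∧ ∀ x, Q (x, x) = 0 := by
  have hl : 0 < lam⁻¹ := inv_pos.2 l0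
  have hne : ∀ p, Ψ p ≠ 0 := fun p h => by have := hΨ p; rw [h, abs_zero] at this; linarith
  have hdiv : ∀ p (a b : ℝ), Ψ p * a = b → |a| ≤ lam * |b| := by
    intro p a b hab
    rw [← hab, abs_mul]
    have : 1 ≤ lam * |Ψ p| := by
      have := mul_le_mul_of_nonneg_left (hΨ p) l0.le
      rwa [mul_inv_cancel₀ l0.ne'] at this
    nlinarith [abs_nonneg a]
  constructor
  · have key := eq_zero_of_contr (Y := Xq q × Xq q)
        (f := fun p => H p.1 - H p.2 - dl κ p.1 p.2 * Q p) (B := ‖H‖ + ‖H‖ + ‖Q‖) (c := lam)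
        (fun p => by
          have a1 := H.norm_coe_le_norm p.1
          have a2 := H.norm_coe_le_norm p.2
          have a3 := Q.norm_coe_le_norm p
          have a4 : |dl κ p.1 p.2| ≤ 1 := by
            rw [abs_of_nonneg (dl_nonneg hκ p.1 p.2)]; exact dl_le hκ hk p.1 p.2
          have a5 : |dl κ p.1 p.2 * Q p| ≤ ‖Q‖ := by
            rw [abs_mul]
            calc _ ≤ 1 * ‖Q‖ := by gcongr; exact a3
              _ = _ := one_mul _
          have a6 := abs_sub (H p.1 - H p.2) (dl κ p.1 p.2 * Q p)
          have a7 := abs_sub (H p.1) (H p.2)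
          rw [Real.norm_eq_abs] at a1 a2
          linarith) l0.le l1 (fun p => by
          by_cases hp : hd p.1 = hd p.2
          · refine ⟨(p.1.sh, p.2.sh), ?_⟩
            refine hdiv p _ _ ?_
            have e1 := h1 p.1 p.2 hp
            have e2 := hT p.1 p.2
            rw [hH, hH, hp] at e2
            rw [dl_eq κ hp]
            change Ψ p * Q p = _ at e1
            change _ = (H p.1 - H p.2) * Ψ p at e2
            simp only
            have : κ * κ⁻¹ = 1 := mul_inv_cancel₀ hκ.ne'
            linear_combination (-e2) - κ * dl κ p.1.sh p.2.sh * e1 - dl κ p.1.sh p.2.sh * Q (p.1.sh, p.2.sh) * this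
          · refine ⟨p, ?_⟩
            have e1 := h2 p.1 p.2 hp
            have e2 := mul_left_cancel₀ (hne _) e1
            have e3 : H p.1 - H p.2 - dl κ p.1 p.2 * Q p = 0 := by
              change Q p = _ at e2
              rw [dl_ne κ hp, e2]; ring
            rw [e3]; simp)
    intro x y
    have := key (x, y)
    simp only at this
    linarith
  · intro x
    have hc : lam * κ⁻¹ < 1 := by
      rw [← div_eq_mul_inv, div_lt_one hκ]; exact hlk
    refine eq_zero_of_contr (f := fun x => Q (x, x)) (B := ‖Q‖) (c := lam * κ⁻¹)
      (fun x => Q.norm_coe_le_norm _) (by positivity) hc (fun x => ⟨x.sh, ?_⟩) x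
    have := hdiv _ _ _ (h1 x x rfl)
    rw [abs_mul, abs_of_pos (inv_pos.2 hκ)] at this
    linarith

/-- Complexification. -/
def castB (Y : Type) [TopologicalSpace Y] : (Y →ᵇ ℝ) →L[ℝ] (Y →ᵇ ℂ) :=
  ContinuousLinearMap.compLeftContinuousBounded Y Complex.ofRealCLM

@[simp] theorem castB_apply {Y : Type} [TopologicalSpace Y] (a : Y →ᵇ ℝ) (y : Y) :
    castB Y a y = (a y : ℂ) := rfl

/-- The inclusion of `E` in the product of spaces of bounded functions. -/
def Sys.incl {X J : Type} [TopologicalSpace X] [DiscreteTopology X] (S : Sys X J) :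
    S.E →ₗᵢ[ℝ] ((X →ᵇ ℂ) × ((X × X) →ᵇ ℂ)) where
  toFun e := e.1
  map_add' _ _ := rfl
  map_smul' _ _ := rfl
  norm_map' _ := rfl

/-- The indicator of pairs with the same first letter. -/
def indB (q : ℕ) : (Xq q × Xq q) →ᵇ ℝ := BoundedContinuousFunction.ofNormedAddCommGroup
  (fun p => if p.1.hd = p.2.hd then 1 else 0) continuous_of_discreteTopology 1
  (fun p => by split_ifs <;> simp)

/-- Composition with the shift on pairs. -/
def shB2 (q : ℕ) : ((Xq q × Xq q) →ᵇ ℝ) →L[ℝ] ((Xq q × Xq q) →ᵇ ℝ) :=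
  bcomp (fun p => (p.1.sh, p.2.sh)) continuous_of_discreteTopology

/-- The first projection. -/
def prA (q : ℕ) : (Xq q →ᵇ ℝ) →L[ℝ] ((Xq q × Xq q) →ᵇ ℝ) := bcomp Prod.fst continuous_fst
/-- The second projection. -/
def prB (q : ℕ) : (Xq q →ᵇ ℝ) →L[ℝ] ((Xq q × Xq q) →ᵇ ℝ) := bcomp Prod.snd continuous_snd

/-- The perturbation in the equation for difference quotients. -/
def pertB (q : ℕ) (κ : ℝ) : ((Xq q × Xq q) →ᵇ ℝ) →L[ℝ] ((Xq q × Xq q) →ᵇ ℝ) :=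
  κ⁻¹ • (ContinuousLinearMap.mul ℝ _ (indB q)).comp (shB2 q)

theorem norm_pertB_le (q : ℕ) {κ : ℝ} (hκ : 0 < κ) : ‖pertB q κ‖ ≤ κ⁻¹ := by
  refine ContinuousLinearMap.opNorm_le_bound _ (by positivity) fun f => ?_
  refine (BoundedContinuousFunction.norm_le (by positivity)).2 fun p => ?_
  change ‖κ⁻¹ * ((if p.1.hd = p.2.hd then (1:ℝ) else 0) * f (p.1.sh, p.2.sh))‖ ≤ _
  have h := f.norm_coe_le_norm (p.1.sh, p.2.sh)
  have hk : 0 < κ⁻¹ := inv_pos.2 hκ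
  rw [norm_mul, Real.norm_of_nonneg hk.le]
  gcongr
  split_ifs
  · simpa using h
  · simp

section
variable {P : Type} [NormedAddCommGroup P] [NormedSpace ℝ P] [CompleteSpace P] {U : Set P} {n r : ℕ}
  {lam : ℝ} {T G : P → ℝ → ℝ} {τ γ : ℕ → P → (ℝ →ᵇ ℝ)}

theorem Fam.compτ_at (hF : Fam U n r lam T G τ γ) (h0 : 0 ∈ U) {I : Type} [TopologicalSpace I]
    {W : P → (I →ᵇ ℝ)} (hW : ContDiffAt ℝ n W 0) (j : ℕ) (hj : j ≤ 1) :
    ContDiffAt ℝ n (fun t => NJ 0 (W t) (τ j t)) 0 := by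
  have hc := (hF.compτ (I := I) j hj).contDiffAt
      (prod_mem_nhds (hF.hU.mem_nhds h0) univ_mem : _ ∈ 𝓝 ((0 : P), W 0))
  exact ContDiffAt.comp (f := fun t => (t, W t))
    (g := fun p : P × (I →ᵇ ℝ) => NJ 0 p.2 (τ j p.1)) 0 hc (contDiffAt_id.prodMk hW)

theorem Fam.compγ_at (hF : Fam U n r lam T G τ γ) (h0 : 0 ∈ U) {I : Type} [TopologicalSpace I]
    {W : P → (I →ᵇ ℝ)} (hW : ContDiffAt ℝ n W 0) (j : ℕ) (hj : j ≤ 1) :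
    ContDiffAt ℝ n (fun t => NJ 0 (W t) (γ j t)) 0 := by
  have hc := (hF.compγ (I := I) j hj).contDiffAt
      (prod_mem_nhds (hF.hU.mem_nhds h0) univ_mem : _ ∈ 𝓝 ((0 : P), W 0))
  exact ContDiffAt.comp (f := fun t => (t, W t))
    (g := fun p : P × (I →ᵇ ℝ) => NJ 0 p.2 (γ j p.1)) 0 hc (contDiffAt_id.prodMk hW)

theorem contDiffAt_clm {E F : Type} [NormedAddCommGroup E] [NormedSpace ℝ E]
    [NormedAddCommGroup F] [NormedSpace ℝ F] (L : E →L[ℝ] F) {W : P → E}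
    (hW : ContDiffAt ℝ n W 0) : ContDiffAt ℝ n (fun t => L (W t)) 0 :=
  L.contDiff.contDiffAt.comp 0 hW

set_option maxHeartbeats 1000000 in
theorem Fam.exists_Q (hF : Fam U n r lam T G τ γ) (h0 : 0 ∈ U) (q : ℕ) {κ : ℝ} (hlk : lam < κ)
    (hk1 : κ < 1) (H : P → (Xq q →ᵇ ℝ)) (hHc : ContDiffAt ℝ n H 0)
    (hH : ∀ᶠ t in 𝓝 0, ∀ x, T t (H t x) = ((x.hd : ℕ) : ℝ) + H t x.sh) :
    ∃ Q : P → ((Xq q × Xq q) →ᵇ ℝ), ContDiffAt ℝ n Q 0 ∧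
      ∀ᶠ t in 𝓝 0, (∀ x y, H t x - H t y = Xq.dl κ x y * Q t (x, y)) ∧ ∀ x, Q t (x, x) = 0 := by
  have l0 := hF.l0
  have hκ : 0 < κ := hF.l0.trans hlk
  obtain ⟨Ψ, hΨdef⟩ : ∃ Ψ : P → ((Xq q × Xq q) →ᵇ ℝ),
    Ψ = fun t => avgL (NJ 0 (segL (H t)) (τ 0 t)) := ⟨_, rfl⟩
  have hΨc : ContDiffAt ℝ n Ψ 0 := hΨdef ▸
    contDiffAt_clm avgL (hF.compτ_at h0 (contDiffAt_clm segL hHc) 0 (by omega))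
  have hΨ : ∀ t ∈ U, ∀ p, lam⁻¹ ≤ |Ψ t p| := fun t ht p => hΨdef ▸
    avgL_lower (τ 0 t).continuous (inv_pos.2 l0) (hF.ex t ht) _ (segL (H t)) (fun _ => rfl) p
  have hu : ∀ t ∈ U, IsUnit (ContinuousLinearMap.mul ℝ _ (Ψ t) - pertB q κ) := fun t ht =>
    mul_sub_isUnit (α := lam⁻¹) (hΨ t ht) ((norm_pertB_le q hκ).trans_lt
      ((inv_lt_inv₀ hκ l0).2 hlk))
  have hAc : ContDiffAt ℝ n (fun t => ContinuousLinearMap.mul ℝ _ (Ψ t) - pertB q κ) 0 :=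
    (contDiffAt_clm (ContinuousLinearMap.mul ℝ _) hΨc).sub contDiffAt_const
  have hbc : ContDiffAt ℝ n (fun t => (1 - indB q) * (Ψ t * (prA q (H t) - prB q (H t)))) 0 := by
    refine contDiffAt_const.mul (hΨc.mul ?_)
    exact (contDiffAt_clm (prA q) hHc).sub (contDiffAt_clm (prB q) hHc)
  have hRc : ContDiffAt ℝ n (fun t => Ring.inverse
      (ContinuousLinearMap.mul ℝ _ (Ψ t) - pertB q κ)) 0 := by
    obtain ⟨u, hu0⟩ := hu 0 h0
    have := contDiffAt_ringInverse ℝ u (n := (n : WithTop ℕ∞))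
    rw [hu0] at this
    exact ContDiffAt.comp (f := fun t => ContinuousLinearMap.mul ℝ _ (Ψ t) - pertB q κ)
      (g := Ring.inverse) 0 this hAc
  refine ⟨fun t => Ring.inverse (ContinuousLinearMap.mul ℝ _ (Ψ t) - pertB q κ)
    ((1 - indB q) * (Ψ t * (prA q (H t) - prB q (H t)))), hRc.clm_apply hbc, ?_⟩
  filter_upwards [hH, hF.hU.mem_nhds h0] with t hHt ht
  generalize hQ : Ring.inverse (ContinuousLinearMap.mul ℝ _ (Ψ t) - pertB q κ)
    ((1 - indB q) * (Ψ t * (prA q (H t) - prB q (H t)))) = Q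
  have heq : (ContinuousLinearMap.mul ℝ _ (Ψ t) - pertB q κ) Q =
      (1 - indB q) * (Ψ t * (prA q (H t) - prB q (H t))) := by
    rw [← hQ, ← mul_apply_eq_comp, Ring.mul_inverse_cancel _ (hu t ht), one_apply_eq_self]
  have hpt : ∀ x y : Xq q, Ψ t (x, y) * Q (x, y) -
      κ⁻¹ * ((if x.hd = y.hd then (1:ℝ) else 0) * Q (x.sh, y.sh)) =
      (1 - (if x.hd = y.hd then (1:ℝ) else 0)) * (Ψ t (x, y) * (H t x - H t y)) := by
    intro x y
    exact congrArg (fun f : (Xq q × Xq q) →ᵇ ℝ => f (x, y)) heq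
  refine quotient_eq hκ l0 hF.l1 hlk hk1 (H t) (Ψ t) Q hHt (hΨ t ht)
    (fun x y => hΨdef ▸ hadamard (hF.Td t ht) (τ 0 t).continuous (H t) _ (fun p => rfl) x y)
    (fun x y hxy => ?_) (fun x y hxy => ?_)
  · have := hpt x y
    rw [if_pos hxy] at this
    linear_combination this
  · have := hpt x y
    rw [if_neg hxy] at this
    linear_combination this

end

section
variable {P : Type} [NormedAddCommGroup P] [NormedSpace ℝ P] [CompleteSpace P] {U : Set P} {n r : ℕ}
  {lam : ℝ} {T G : P → ℝ → ℝ} {τ γ : ℕ → P → (ℝ →ᵇ ℝ)}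

/-- Real valued pairs (function, difference quotient). -/
def GoodPair {q : ℕ} (κ : ℝ) (a : Xq q →ᵇ ℝ) (α : (Xq q × Xq q) →ᵇ ℝ) : Prop :=
  (∀ x y, a x - a y = Xq.dl κ x y * α (x, y)) ∧ ∀ x, α (x, x) = 0

theorem Fam.exists_u (hF : Fam U n r lam T G τ γ) (h0 : 0 ∈ U) (q : ℕ) {κ : ℝ}
    (H : P → (Xq q →ᵇ ℝ)) (hHc : ContDiffAt ℝ n H 0)
    (Q : P → ((Xq q × Xq q) →ᵇ ℝ)) (hQc : ContDiffAt ℝ n Q 0)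
    (hQ : ∀ᶠ t in 𝓝 0, GoodPair κ (H t) (Q t)) :
    ∃ (a : P → (Xq q →ᵇ ℝ)) (α : P → ((Xq q × Xq q) →ᵇ ℝ)), ContDiffAt ℝ n a 0 ∧
      ContDiffAt ℝ n α 0 ∧ ∀ᶠ t in 𝓝 0, GoodPair κ (a t) (α t) ∧
        ∀ x, a t x = Real.exp (G t (H t x)) := by
  obtain ⟨g, hg⟩ : ∃ g : P → (Xq q →ᵇ ℝ), g = fun t => NJ 0 (H t) (γ 0 t) := ⟨_, rfl⟩
  have hgc : ContDiffAt ℝ n g 0 := hg ▸ hF.compγ_at h0 hHc 0 (by omega)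
  obtain ⟨k, hk⟩ : ∃ k : P → ((Xq q × Xq q) →ᵇ ℝ),
    k = fun t => avgL (NJ 0 (segL (H t)) (γ 1 t)) := ⟨_, rfl⟩
  have hkc : ContDiffAt ℝ n k 0 := hk ▸
    contDiffAt_clm avgL (hF.compγ_at h0 (contDiffAt_clm segL hHc) 1 (by omega))
  obtain ⟨e, he⟩ : ∃ e : P → ((Xq q × Xq q) →ᵇ ℝ),
    e = fun t => avgL (NormedSpace.exp (segL (g t))) := ⟨_, rfl⟩
  have hec : ContDiffAt ℝ n e 0 := he ▸
    contDiffAt_clm avgL (ContDiffAt.comp (f := fun t => segL (g t))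
      (g := fun a => NormedSpace.exp a) 0 contDiff_bcf_exp.contDiffAt (contDiffAt_clm segL hgc))
  refine ⟨fun t => NormedSpace.exp (g t), fun t => (e t * k t) * Q t,
    ContDiffAt.comp (f := g) (g := fun a => NormedSpace.exp a) 0 contDiff_bcf_exp.contDiffAt hgc,
    (hec.mul hkc).mul hQc, ?_⟩
  filter_upwards [hQ, hF.hU.mem_nhds h0] with t hQt ht
  have hgx : ∀ x, g t x = γ 0 t (H t x) := fun x => by rw [hg]; rfl
  have h1 : ∀ x y, g t x - g t y = (H t x - H t y) * k t (x, y) := by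
    intro x y
    rw [hgx, hgx, hk]
    exact hadamard (hF.γd 0 (by have := hF.nr; omega) t ht) (γ 1 t).continuous (H t) _
      (fun p => rfl) x y
  have h2 : ∀ x y, Real.exp (g t x) - Real.exp (g t y) = (g t x - g t y) * e t (x, y) := by
    intro x y
    rw [he]
    exact hadamard Real.hasDerivAt_exp Real.continuous_exp (g t) _
      (fun p => bcf_exp_apply _ p) x y
  refine ⟨⟨fun x y => ?_, fun x => ?_⟩, fun x => ?_⟩
  · rw [bcf_exp_apply, bcf_exp_apply, h2, h1, hQt.1]
    change _ = Xq.dl κ x y * ((e t (x, y) * k t (x, y)) * Q t (x, y))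
    ring
  · change (e t (x, x) * k t (x, x)) * Q t (x, x) = 0
    rw [hQt.2, mul_zero]
  · rw [bcf_exp_apply, hgx, hF.Gg t ht]

theorem Fam.exists_v (hF : Fam U n r lam T G τ γ) (h0 : 0 ∈ U) (q : ℕ) {κ : ℝ}
    (H : P → (Xq q →ᵇ ℝ)) (hHc : ContDiffAt ℝ n H 0)
    (Q : P → ((Xq q × Xq q) →ᵇ ℝ)) (hQc : ContDiffAt ℝ n Q 0)
    (hQ : ∀ᶠ t in 𝓝 0, GoodPair κ (H t) (Q t)) :
    ∃ (a : P → (Xq q →ᵇ ℝ)) (α : P → ((Xq q × Xq q) →ᵇ ℝ)), ContDiffAt ℝ n a 0 ∧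
      ContDiffAt ℝ n α 0 ∧ ∀ᶠ t in 𝓝 0, GoodPair κ (a t) (α t) ∧
        ∀ x, a t x = (τ 0 t (H t x))⁻¹ := by
  have hl : 0 < lam⁻¹ := inv_pos.2 hF.l0
  obtain ⟨g, hg⟩ : ∃ g : P → (Xq q →ᵇ ℝ), g = fun t => NJ 0 (H t) (τ 0 t) := ⟨_, rfl⟩
  have hgc : ContDiffAt ℝ n g 0 := hg ▸ hF.compτ_at h0 hHc 0 (by omega)
  obtain ⟨k, hk⟩ : ∃ k : P → ((Xq q × Xq q) →ᵇ ℝ),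
    k = fun t => avgL (NJ 0 (segL (H t)) (τ 1 t)) := ⟨_, rfl⟩
  have hkc : ContDiffAt ℝ n k 0 := hk ▸
    contDiffAt_clm avgL (hF.compτ_at h0 (contDiffAt_clm segL hHc) 1 (by omega))
  have hgx : ∀ t x, g t x = τ 0 t (H t x) := fun t x => by rw [hg]; rfl
  have hu : ∀ t ∈ U, IsUnit (g t) := fun t ht =>
    bcf_isUnit hl fun x => by rw [hgx]; exact hF.ex t ht _
  obtain ⟨v, hv⟩ : ∃ v : P → (Xq q →ᵇ ℝ), v = fun t => Ring.inverse (g t) := ⟨_, rfl⟩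
  have hvc : ContDiffAt ℝ n v 0 := by
    obtain ⟨u, hu0⟩ := hu 0 h0
    have := contDiffAt_ringInverse ℝ u (n := (n : WithTop ℕ∞))
    rw [hu0] at this
    rw [hv]
    exact ContDiffAt.comp (f := g) (g := Ring.inverse) 0 this hgc
  refine ⟨v, fun t => -((k t * Q t) * (prA q (v t) * prB q (v t))), hvc,
    ((hkc.mul hQc).mul ((contDiffAt_clm (prA q) hvc).mul (contDiffAt_clm (prB q) hvc))).neg, ?_⟩
  filter_upwards [hQ, hF.hU.mem_nhds h0] with t hQt ht
  have hvx : ∀ x, v t x = (τ 0 t (H t x))⁻¹ := fun x => by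
    rw [hv, ← hgx]; exact bcf_inverse_apply (hu t ht) x
  have hne : ∀ x, τ 0 t (H t x) ≠ 0 := fun x h => by
    have := hF.ex t ht (H t x); rw [h, abs_zero] at this; linarith
  have h1 : ∀ x y, τ 0 t (H t x) - τ 0 t (H t y) = (H t x - H t y) * k t (x, y) := by
    intro x y
    rw [hk]
    exact hadamard (hF.τd 0 (by have := hF.nr; omega) t ht) (τ 1 t).continuous (H t) _
      (fun p => rfl) x y
  refine ⟨⟨fun x y => ?_, fun x => ?_⟩, hvx⟩
  · change v t x - v t y = Xq.dl κ x y * -((k t (x, y) * Q t (x, y)) * (v t x * v t y))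
    have h2 := h1 x y
    rw [hQt.1] at h2
    rw [hvx, hvx]
    have := hne x
    have := hne y
    field_simp
    linear_combination -h2
  · change -((k t (x, x) * Q t (x, x)) * (v t x * v t x)) = 0
    rw [hQt.2]; ring

open Sys in
theorem exists_lift {q : ℕ} {κ : ℝ} (hκ : 0 < κ) (hk1 : κ < 1)
    (a : P → (Xq q →ᵇ ℝ)) (α : P → ((Xq q × Xq q) →ᵇ ℝ)) {W : Set P} (hW : IsOpen W)
    (ha : ContDiffOn ℝ n a W) (hα : ContDiffOn ℝ n α W) (hg : ∀ t ∈ W, GoodPair κ (a t) (α t)) :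
    ∃ u : P → (Xq.sys q κ hκ hk1).E, ContDiffOn ℝ n u W ∧ ∀ t ∈ W, ∀ x, fn (u t) x = (a t x : ℂ) := by
  have hex : ∀ t, ∃ e : (Xq.sys q κ hκ hk1).E, t ∈ W →
      (Xq.sys q κ hκ hk1).incl e = (castB _ (a t), castB _ (α t)) := by
    intro t
    by_cases ht : t ∈ W
    · refine ⟨⟨(castB _ (a t), castB _ (α t)), ?_, ?_⟩, fun _ => rfl⟩
      · intro x y
        change (a t x : ℂ) - (a t y : ℂ) = (Xq.dl κ x y : ℂ) * (α t (x, y) : ℂ)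
        exact_mod_cast (hg t ht).1 x y
      · intro x
        change (α t (x, x) : ℂ) = 0
        exact_mod_cast (hg t ht).2 x
    · exact ⟨0, fun h => absurd h ht⟩
  choose u hu using hex
  refine ⟨u, ?_, fun t ht x => ?_⟩
  · refine contDiffOn_of_isometry hW n (Xq.sys q κ hκ hk1).incl ?_
    have : ContDiffOn ℝ n (fun t => (castB _ (a t), castB _ (α t))) W :=
      ((castB _).contDiff.comp_contDiffOn ha).prodMk ((castB _).contDiff.comp_contDiffOn hα)
    exact this.congr fun t ht => hu t ht
  · have := hu t ht
    have h2 : ((Xq.sys q κ hκ hk1).incl (u t)).1 x = castB _ (a t) x := by rw [this]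
    exact h2

open Sys in
/-- Smooth dependence of the weights in the symbolic model. -/
theorem Fam.exists_uv (hF : Fam U n r lam T G τ γ) (h0 : 0 ∈ U) (q : ℕ) {κ : ℝ} (hκ : 0 < κ)
    (hlk : lam < κ) (hk1 : κ < 1) (hs : Function.Surjective (T 0)) :
    ∃ W : Set P, IsOpen W ∧ 0 ∈ W ∧ W ⊆ U ∧ ∃ (H : P → (Xq q →ᵇ ℝ))
      (uv : P → (Xq.sys q κ hκ hk1).E × (Xq.sys q κ hκ hk1).E), ContDiffOn ℝ n uv W ∧
      ∀ t ∈ W, (∀ x, T t (H t x) = ((x.hd : ℕ) : ℝ) + H t x.sh) ∧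
        (∀ x, fn (uv t).1 x = (Real.exp (G t (H t x)) : ℂ)) ∧
        ∀ x, fn (uv t).2 x = (((τ 0 t (H t x))⁻¹ : ℝ) : ℂ) := by
  obtain ⟨H, hHc, hH⟩ := hF.exists_H h0 q hs
  obtain ⟨Q, hQc, hQ⟩ := hF.exists_Q h0 q hlk hk1 H hHc hH
  obtain ⟨a, α, hac, hαc, ha⟩ := hF.exists_u h0 q H hHc Q hQc hQ
  obtain ⟨b, β, hbc, hβc, hb⟩ := hF.exists_v h0 q H hHc Q hQc hQ
  have hn : (n : WithTop ℕ∞) ≠ ((⊤ : ℕ∞) : WithTop ℕ∞) := by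
    exact_mod_cast (ENat.natCast_ne_top n)
  have hall := ((((((hac.eventually hn).and (hαc.eventually hn)).and (hbc.eventually hn)).and
    (hβc.eventually hn)).and (ha.and hb)).and (hH.and (hF.hU.mem_nhds h0)))
  obtain ⟨W, hW, hWo, hW0⟩ := eventually_nhds_iff.1 hall
  obtain ⟨u, huc, hu⟩ := exists_lift hκ hk1 a α hWo
    (fun t ht => (hW t ht).1.1.1.1.1.contDiffWithinAt)
    (fun t ht => (hW t ht).1.1.1.1.2.contDiffWithinAt) (fun t ht => (hW t ht).1.2.1.1)
  obtain ⟨v, hvc, hv⟩ := exists_lift hκ hk1 b β hWo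
    (fun t ht => (hW t ht).1.1.1.2.contDiffWithinAt)
    (fun t ht => (hW t ht).1.1.2.contDiffWithinAt) (fun t ht => (hW t ht).1.2.2.1)
  refine ⟨W, hWo, hW0, fun t ht => (hW t ht).2.2, H, fun t => (u t, v t), huc.prodMk hvc,
    fun t ht => ⟨(hW t ht).2.1, fun x => ?_, fun x => ?_⟩⟩
  · rw [hu t ht, (hW t ht).1.2.1.2]
  · rw [hv t ht, (hW t ht).1.2.2.2]

end

/-! ### Periodic points -/

theorem lift_iterate {T : ℝ → ℝ} {d : ℤ} (h : IsCircleLift T d) (n : ℕ) :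
    IsCircleLift (T^[n]) (d ^ n) := by
  induction n with
  | zero => intro x; simp
  | succ n ih =>
    intro x
    rw [Function.iterate_succ_apply', Function.iterate_succ_apply', ih x, lift_int h]
    push_cast; ring

theorem expand_iterate {T : ℝ → ℝ} {μ : ℝ} (hμ : 0 < μ)
    (h : ∀ x y, μ * |x - y| ≤ |T x - T y|) (n : ℕ) (x y : ℝ) :
    μ ^ n * |x - y| ≤ |T^[n] x - T^[n] y| := by
  induction n with
  | zero => simp
  | succ n ih =>
    rw [Function.iterate_succ_apply', Function.iterate_succ_apply']
    calc μ ^ (n + 1) * |x - y| = μ * (μ ^ n * |x - y|) := by ring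
      _ ≤ μ * |T^[n] x - T^[n] y| := by gcongr
      _ ≤ _ := h _ _

/-- The solutions of `T x = x + k` for an expanding lift. -/
theorem exists_sol {T : ℝ → ℝ} {d : ℤ} (h : IsCircleLift T d) (hd : d ≠ 1) (hc : Continuous T)
    {μ : ℝ} (hμ : 1 < μ) (hx : ∀ x y, μ * |x - y| ≤ |T x - T y|) :
    ∃ X : ℤ → ℝ, (∀ k, T (X k) = X k + k) ∧ ∀ (k : ℤ) x, T x = x + k → x = X k := by
  have h1 : IsCircleLift (fun x => T x - x) (d - 1) := by
    intro x; dsimp only; rw [h x]; push_cast; ring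
  have hs := lift_surj h1 (sub_ne_zero.2 hd) (hc.sub continuous_id)
  choose X hX using fun k : ℤ => hs (k : ℝ)
  have hX' : ∀ k, T (X k) = X k + k := fun k => by have := hX k; simp only at this; linarith
  refine ⟨X, hX', fun k x hk => ?_⟩
  have h2 := hx x (X k)
  rw [hk, hX' k, add_sub_add_right_eq_sub] at h2
  by_contra hne
  have : 0 < |x - X k| := abs_pos.2 (sub_ne_zero.2 hne)
  nlinarith

/-- Sums over periodic points are sums over residues. -/
theorem fix_sum {T : ℝ → ℝ} {d : ℤ} (h : IsCircleLift T d) (hd : d ≠ 1) {X : ℤ → ℝ}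
    (hX : ∀ k, T (X k) = X k + k) (hXu : ∀ (k : ℤ) x, T x = x + k → x = X k)
    {f : ℝ → ℂ} (hf : ∀ x, f (x + 1) = f x) (a : ℤ) :
    ∑ᶠ x ∈ {x : ℝ | x ∈ Set.Ico (0:ℝ) 1 ∧ ∃ k : ℤ, T x = x + k}, f x =
      ∑ k ∈ Finset.Ico a (a + |d - 1|), f (X k) := by
  have hfi : ∀ (k : ℤ) x, f (x + k) = f x := by
    intro k x
    induction k using Int.induction_on generalizing x with
    | zero => simp
    | succ i ih => push_cast at ih ⊢; rw [← add_assoc, hf, ih]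
    | pred i ih =>
      push_cast at ih ⊢
      rw [← hf, ← ih x]; congr 1; ring
  have hM : 0 < |d - 1| := abs_pos.2 (sub_ne_zero.2 hd)
  rw [← finsum_mem_coe_finset]
  symm
  refine finsum_mem_eq_of_bijOn (fun k => Int.fract (X k)) ⟨?_, ?_, ?_⟩ ?_
  · intro k _
    refine ⟨⟨Int.fract_nonneg _, Int.fract_lt_one _⟩, ⟨k - ⌊X k⌋ * (d - 1), ?_⟩⟩
    have := lift_int h (-⌊X k⌋) (X k)
    have e : Int.fract (X k) = X k + ((-⌊X k⌋ : ℤ) : ℝ) := by rw [Int.fract]; push_cast; ring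
    simp only
    rw [e, this, hX]
    push_cast; ring
  · intro k hk k' hk' hkk
    simp only at hkk
    obtain ⟨l, hl⟩ := Int.fract_eq_fract.1 hkk
    have h1 : X k = X k' + l := by linarith
    have h2 := hX k
    rw [h1, lift_int h, hX] at h2
    have h3 : k - k' = l * (d - 1) := by
      have : (k : ℝ) - k' = l * (d - 1) := by linarith
      exact_mod_cast this
    rw [Finset.mem_coe, Finset.mem_Ico] at hk hk'
    have h4 : |l * (d - 1)| < |d - 1| := by rw [← h3, abs_lt]; constructor <;> linarith
    rw [abs_mul] at h4
    have h5 : |l| < 1 := by nlinarith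
    rw [Int.abs_lt_one_iff.1 h5, zero_mul] at h3
    linarith
  · rintro x ⟨⟨hx0, hx1⟩, k, hk⟩
    obtain ⟨m, hm⟩ : ∃ m : ℤ, k + m * (d - 1) ∈ Finset.Ico a (a + |d - 1|) := by
      refine ⟨-((k - a) / |d - 1| * (d - 1).sign), ?_⟩
      have e1 : k + -((k - a) / |d - 1| * (d - 1).sign) * (d - 1) = a + (k - a) % |d - 1| := by
        rw [Int.emod_def, neg_mul, mul_assoc, Int.sign_mul_self_eq_abs]; ring
      rw [e1, Finset.mem_Ico]
      have := Int.emod_nonneg (k - a) hM.ne'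
      have := Int.emod_lt_of_pos (k - a) hM
      omega
    refine ⟨_, Finset.mem_coe.2 hm, ?_⟩
    have : x + m = X (k + m * (d - 1)) := hXu _ _ (by rw [lift_int h, hk]; push_cast; ring)
    simp only
    rw [← this, Int.fract_add_intCast]
    exact Int.fract_eq_self.2 ⟨hx0, hx1⟩
  · intro k _
    have := hfi (-⌊X k⌋) (X k)
    have e : Int.fract (X k) = X k + ((-⌊X k⌋ : ℤ) : ℝ) := by rw [Int.fract]; push_cast; ring
    rw [e, this]

theorem sum_blocks {q : ℕ} (hq : 0 < q) (F : ℤ → ℂ) (a b : ℤ) :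
    ∑ j : Fin q, ∑ m ∈ Finset.Ico a b, F (((j : ℕ) : ℤ) + q * m) =
      ∑ k ∈ Finset.Ico (q * a) (q * b), F k := by
  have hq' : (0 : ℤ) < q := by exact_mod_cast hq
  have hlt : ∀ i : ℤ, (i % q).toNat < q := fun i => by
    have := Int.emod_lt_of_pos i hq'
    have := Int.emod_nonneg i hq'.ne'
    omega
  rw [← Finset.sum_product']
  refine Finset.sum_nbij' (fun p => ((p.1 : ℕ) : ℤ) + q * p.2) (fun i => (⟨(i % q).toNat, hlt i⟩, i / q))
    ?_ ?_ ?_ ?_ ?_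
  · rintro ⟨j, m⟩ hp
    have hj := j.2
    simp only [Finset.mem_product, Finset.mem_univ, true_and, Finset.mem_Ico] at hp ⊢
    constructor
    · nlinarith
    · have : ((j : ℕ) : ℤ) < q := by exact_mod_cast hj
      nlinarith
  · intro i hi
    simp only [Finset.mem_product, Finset.mem_univ, true_and, Finset.mem_Ico] at hi ⊢
    exact ⟨(Int.le_ediv_iff_mul_le hq').2 (by linarith), (Int.ediv_lt_iff_lt_mul hq').2 (by linarith)⟩
  · rintro ⟨j, m⟩ hp
    have hj : ((j : ℕ) : ℤ) < q := by exact_mod_cast j.2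
    have e1 : (((j : ℕ) : ℤ) + q * m) % q = (j : ℕ) := by
      rw [Int.add_mul_emod_self_left]; exact Int.emod_eq_of_lt (by positivity) hj
    have e2 : (((j : ℕ) : ℤ) + q * m) / q = m := by
      rw [Int.add_mul_ediv_left _ _ hq'.ne', Int.ediv_eq_zero_of_lt (by positivity) hj, zero_add]
    ext <;> simp [e1, e2]
  · intro i hi
    simp only
    rw [Int.toNat_of_nonneg (Int.emod_nonneg i hq'.ne')]
    exact Int.emod_add_mul_ediv i q
  · rintro ⟨j, m⟩ hp; rfl

theorem sum_blocks_neg {q : ℕ} (hq : 0 < q) (F : ℤ → ℂ) (a b : ℤ) :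
    ∑ j : Fin q, ∑ m ∈ Finset.Ico a b, F (((j : ℕ) : ℤ) + -q * m) =
      ∑ k ∈ Finset.Ico (q * (1 - b)) (q * (1 - a)), F k := by
  rw [← sum_blocks hq]
  refine Finset.sum_congr rfl fun j _ => ?_
  refine Finset.sum_nbij' (fun m => -m) (fun m => -m) ?_ ?_ ?_ ?_ ?_
  · intro m hm; simp only [Finset.mem_Ico] at hm ⊢; omega
  · intro m hm; simp only [Finset.mem_Ico] at hm ⊢; omega
  · intro m _; simp
  · intro m _; simp
  · intro m _; congr 1; ring

/-- The translation number of a word. -/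
def kw (d : ℤ) {q : ℕ} : List (Fin q) → ℤ
  | [] => 0
  | j :: w => ((j : ℕ) : ℤ) + d * kw d w

/-- The translation numbers of the special point. -/
def en (d c : ℤ) : ℕ → ℤ
  | 0 => 0
  | n + 1 => en d c n * d + c

/-- The distinguished letter. -/
def cd (q : ℕ) (d : ℤ) : ℕ := if 0 < d then 0 else q

theorem kw_sum {q : ℕ} (hq : 0 < q) {d : ℤ} (hd : d.natAbs = q) (F : ℤ → ℂ) (n : ℕ) :
    (0 < d ^ n → wsum n (fun w => F (kw d (q := q) w)) =
      ∑ k ∈ Finset.Ico (en d (cd q d) n) (en d (cd q d) n + (q : ℤ) ^ n), F k) ∧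
    (d ^ n < 0 → wsum n (fun w => F (kw d (q := q) w)) =
      ∑ k ∈ Finset.Ico (en d (cd q d) n - (q : ℤ) ^ n) (en d (cd q d) n), F k) := by
  induction n generalizing F with
  | zero =>
    constructor
    · intro _
      have : Finset.Ico (0:ℤ) 1 = {0} := by decide
      simp [wsum_zero, kw, en, this]
    · intro h; simp at h
  | succ n ih =>
    have hd0 : d ≠ 0 := by rintro rfl; simp at hd; omega
    have key : wsum (n + 1) (fun w => F (kw d (q := q) w)) =
        ∑ j : Fin q, wsum n (fun w => (fun k => F (((j : ℕ) : ℤ) + d * k)) (kw d (q := q) w)) := by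
      rw [wsum_succ]; rfl
    rcases lt_or_gt_of_ne hd0 with hneg | hpos
    · have hdq : d = -(q : ℤ) := by omega
      have hc : (cd q d : ℤ) = q := by rw [cd, if_neg (by omega)]
      rcases lt_or_gt_of_ne (pow_ne_zero n hd0) with h1 | h1
      · have h2 : 0 < d ^ (n + 1) := by rw [pow_succ]; exact mul_pos_of_neg_of_neg h1 hneg
        refine ⟨fun _ => ?_, fun h => absurd h h2.not_gt⟩
        rw [key]
        refine (Finset.sum_congr rfl fun (j : Fin q) _ => (ih fun k => F (((j : ℕ) : ℤ) + d * k)).2 h1).trans ?_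
        conv_lhs => rw [hdq]
        rw [sum_blocks_neg hq, ← hdq, hc, en]
        congr 2
        · rw [hdq]; ring
        · rw [hdq]; ring
      · have h2 : d ^ (n + 1) < 0 := by rw [pow_succ]; exact mul_neg_of_pos_of_neg h1 hneg
        refine ⟨fun h => absurd h h2.not_gt, fun _ => ?_⟩
        rw [key]
        refine (Finset.sum_congr rfl fun (j : Fin q) _ => (ih fun k => F (((j : ℕ) : ℤ) + d * k)).1 h1).trans ?_
        conv_lhs => rw [hdq]
        rw [sum_blocks_neg hq, ← hdq, hc, en]
        congr 2
        · rw [hdq]; ring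
        · rw [hdq]; ring
    · have hdq : d = (q : ℤ) := by omega
      have hc : (cd q d : ℤ) = 0 := by rw [cd, if_pos hpos]; rfl
      have h1 := pow_pos hpos n
      have h2 := pow_pos hpos (n + 1)
      refine ⟨fun _ => ?_, fun h => absurd h h2.not_gt⟩
      rw [key]
      refine (Finset.sum_congr rfl fun (j : Fin q) _ => (ih fun k => F (((j : ℕ) : ℤ) + d * k)).1 h1).trans ?_
      conv_lhs => rw [hdq]
      rw [sum_blocks hq, ← hdq, hc, en]
      congr 2
      · rw [hdq]; ring
      · rw [hdq]; ring

/-- The sign. -/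
def sg (d : ℤ) : ℂ := if 0 < d then 1 else -1

theorem norm_sg (d : ℤ) : ‖sg d‖ ≤ 1 := by unfold sg; split_ifs <;> simp

theorem sg_pow {d : ℤ} (hd : d ≠ 0) (n : ℕ) :
    (0 < d ^ n → sg d ^ n = 1) ∧ (d ^ n < 0 → sg d ^ n = -1) := by
  unfold sg
  split_ifs with h
  · exact ⟨fun _ => one_pow _, fun h1 => absurd (pow_pos h n) h1.not_gt⟩
  · have h' : d < 0 := lt_of_le_of_ne (not_lt.1 h) hd
    rcases n.even_or_odd with he | ho
    · exact ⟨fun _ => he.neg_one_pow, fun h1 => absurd (he.pow_pos hd) h1.not_gt⟩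
    · exact ⟨fun h1 => absurd (ho.pow_neg h') h1.not_gt, fun _ => ho.neg_one_pow⟩

/-- Periodic points in terms of words. -/
theorem fix_words {q : ℕ} (hq : 2 ≤ q) {d : ℤ} (hd : d.natAbs = q) {n : ℕ} (hn : n ≠ 0) {T : ℝ → ℝ}
    (h : IsCircleLift T (d ^ n)) {X : ℤ → ℝ}
    (hX : ∀ k, T (X k) = X k + k) (hXu : ∀ (k : ℤ) x, T x = x + k → x = X k)
    {f : ℝ → ℂ} (hf : ∀ x, f (x + 1) = f x) :
    ∑ᶠ x ∈ {x : ℝ | x ∈ Set.Ico (0:ℝ) 1 ∧ ∃ k : ℤ, T x = x + k}, f x =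
      wsum n (fun w => f (X (kw d (q := q) w))) - sg d ^ n * f (X (en d (cd q d) n)) := by
  have hd0 : d ≠ 0 := by rintro rfl; simp at hd; omega
  have hqn : (2 : ℤ) ≤ (q : ℤ) ^ n := by
    calc (2:ℤ) ≤ q := by exact_mod_cast hq
      _ ≤ (q : ℤ) ^ n := le_self_pow₀ (by exact_mod_cast (by omega : 1 ≤ q)) hn
  have habs : |d ^ n| = (q : ℤ) ^ n := by rw [abs_pow, Int.abs_eq_natAbs, hd]
  have hks := kw_sum (by omega : 0 < q) hd (fun k => f (X k)) n
  rcases lt_or_gt_of_ne (pow_ne_zero n hd0) with h1 | h1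
  · have e1 : d ^ n = -(q : ℤ) ^ n := by rw [← habs, abs_of_neg h1, neg_neg]
    have e2 : |d ^ n - 1| = (q : ℤ) ^ n + 1 := by
      rw [e1, abs_of_neg (by linarith)]; ring
    rw [fix_sum h (by omega) hX hXu hf (en d (cd q d) n - (q : ℤ) ^ n), hks.2 h1, (sg_pow hd0 n).2 h1, e2]
    rw [show en d (cd q d) n - (q : ℤ) ^ n + ((q : ℤ) ^ n + 1) = en d (cd q d) n + 1 by ring]
    have : Finset.Ico (en d (cd q d) n - (q : ℤ) ^ n) (en d (cd q d) n + 1) =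
        insert (en d (cd q d) n) (Finset.Ico (en d (cd q d) n - (q : ℤ) ^ n) (en d (cd q d) n)) := by
      ext k; simp only [Finset.mem_insert, Finset.mem_Ico]; omega
    rw [this, Finset.sum_insert (by simp)]
    ring
  · have e1 : d ^ n = (q : ℤ) ^ n := by rw [← habs, abs_of_pos h1]
    have e2 : |d ^ n - 1| = (q : ℤ) ^ n - 1 := by
      rw [e1, abs_of_pos (by linarith)]
    rw [fix_sum h (by omega) hX hXu hf (en d (cd q d) n + 1), hks.1 h1, (sg_pow hd0 n).1 h1, e2]
    rw [show en d (cd q d) n + 1 + ((q : ℤ) ^ n - 1) = en d (cd q d) n + (q : ℤ) ^ n by ring]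
    have : Finset.Ico (en d (cd q d) n) (en d (cd q d) n + (q : ℤ) ^ n) =
        insert (en d (cd q d) n) (Finset.Ico (en d (cd q d) n + 1) (en d (cd q d) n + (q : ℤ) ^ n)) := by
      ext k; simp only [Finset.mem_insert, Finset.mem_Ico]; omega
    rw [this, Finset.sum_insert (by simp)]
    ring

namespace Xq
variable {q : ℕ} {κ : ℝ} {hκ : 0 < κ} {hκ1 : κ < 1}

theorem s_foldr (l : List (Fin q)) (y : Xq q) (i : ℕ) :
    (l.foldr (fun j x => cons j.castSucc x) y).s i =
      if h : i < l.length then (l[i]).castSucc else y.s (i - l.length) := by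
  induction l generalizing i with
  | nil => simp
  | cons j l ih =>
    cases i with
    | zero => simp [cons]
    | succ i =>
      have : ((j :: l).foldr (fun j x => cons j.castSucc x) y).s (i + 1) =
        (l.foldr (fun j x => cons j.castSucc x) y).s i := rfl
      rw [this, ih]
      simp

theorem ψw_eq (w : List (Fin q)) (y : Xq q) :
    (sys q κ hκ hκ1).ψw w y = w.reverse.foldr (fun j x => cons j.castSucc x) y := by
  induction w generalizing y with
  | nil => rfl
  | cons j w ih =>
    rw [Sys.ψw, ih, List.reverse_cons, List.foldr_append]; rfl

theorem exists_fx : ∃ fx : List (Fin q) → Xq q, ∀ w, (sys q κ hκ hκ1).ψw w (fx w) = fx w := by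
  have : ∀ w : List (Fin q), ∃ x : Xq q, (sys q κ hκ hκ1).ψw w x = x := by
    intro w
    by_cases hw : w.length = 0
    · rw [List.length_eq_zero_iff] at hw
      subst hw
      exact ⟨⟨fun _ => 0⟩, rfl⟩
    · have hpos : 0 < w.reverse.length := by rw [List.length_reverse]; omega
      refine ⟨⟨fun i => (w.reverse[i % w.reverse.length]'(Nat.mod_lt _ hpos)).castSucc⟩, ?_⟩
      rw [ψw_eq]
      refine ext_s fun i => ?_
      rw [s_foldr]
      split_ifs with h
      · simp only [Nat.mod_eq_of_lt h]
      · simp only [← Nat.mod_eq_sub_mod (not_lt.1 h)]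
  choose fx hfx using this
  exact ⟨fx, hfx⟩

/-- The special point. -/
def xsp (q : ℕ) (d : ℤ) : Xq q := ⟨fun _ => ⟨cd q d, by unfold cd; split_ifs <;> omega⟩⟩

end Xq

theorem per_int {A : Type} {f : ℝ → A} (hf : ∀ x, f (x + 1) = f x) (k : ℤ) (x : ℝ) :
    f (x + k) = f x := by
  induction k using Int.induction_on generalizing x with
  | zero => simp
  | succ i ih => push_cast at ih ⊢; rw [← add_assoc, hf, ih]
  | pred i ih =>
    push_cast at ih ⊢
    rw [← hf, ← ih x]; congr 1; ring

section sym
variable {q : ℕ} {κ : ℝ} {hκ : 0 < κ} {hκ1 : κ < 1} {T : ℝ → ℝ} {d : ℤ} {H : Xq q → ℝ}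

open Sys

theorem iter_H (h : IsCircleLift T d) (hH : ∀ x, T (H x) = ((x.hd : ℕ) : ℝ) + H x.sh)
    (w : List (Fin q)) (y : Xq q) :
    T^[w.length] (H ((Xq.sys q κ hκ hκ1).ψw w y)) = H y + kw d w := by
  induction w generalizing y with
  | nil => simp [ψw, kw]
  | cons j w ih =>
    rw [ψw, List.length_cons, Function.iterate_succ_apply', ih, lift_int h, hH]
    simp only [kw]
    have : (Xq.sys q κ hκ hκ1).ψ j y = Xq.cons j.castSucc y := rfl
    rw [this, Xq.hd_cons, Xq.sh_cons]
    push_cast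
    simp
    ring

theorem P_H (h : IsCircleLift T d) (hH : ∀ x, T (H x) = ((x.hd : ℕ) : ℝ) + H x.sh)
    {φ : ℝ → ℝ} (hφ : ∀ x, φ (x + 1) = φ x) {u : (Xq.sys q κ hκ hκ1).E}
    (hu : ∀ x, fn u x = (φ (H x) : ℂ)) (w : List (Fin q)) (y : Xq q) :
    fn (P u w) y = ((∏ i ∈ Finset.range w.length, φ (T^[i] (H ((Xq.sys q κ hκ hκ1).ψw w y))) : ℝ) : ℂ) := by
  induction w generalizing y with
  | nil => simp [P]
  | cons j w ih =>
    rw [P, fn_compL, fn_mulL, ih, hu, List.length_cons, Finset.prod_range_succ, ψw,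
      iter_H h hH, per_int hφ]
    push_cast
    ring

theorem iter_xsp (h : IsCircleLift T d) (hH : ∀ x, T (H x) = ((x.hd : ℕ) : ℝ) + H x.sh) (n : ℕ) :
    T^[n] (H (Xq.xsp q d)) = H (Xq.xsp q d) + en d (cd q d) n := by
  induction n with
  | zero => simp [en]
  | succ n ih =>
    rw [Function.iterate_succ_apply', ih, lift_int h, hH]
    have e1 : (Xq.xsp q d).sh = Xq.xsp q d := rfl
    have e2 : (((Xq.xsp q d).hd : ℕ) : ℝ) = (cd q d : ℝ) := rfl
    rw [e1, e2, en]
    push_cast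
    ring

theorem prod_xsp (h : IsCircleLift T d) (hH : ∀ x, T (H x) = ((x.hd : ℕ) : ℝ) + H x.sh) (n : ℕ)
    {φ : ℝ → ℝ} (hφ : ∀ x, φ (x + 1) = φ x) :
    ∏ i ∈ Finset.range n, φ (T^[i] (H (Xq.xsp q d))) = φ (H (Xq.xsp q d)) ^ n := by
  rw [Finset.prod_congr rfl fun i _ => by rw [iter_xsp h hH, per_int hφ], Finset.prod_const,
    Finset.card_range]

theorem prod_periodic (h : IsCircleLift T d) (n : ℕ)
    {φ : ℝ → ℝ} (hφ : ∀ x, φ (x + 1) = φ x) (x : ℝ) :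
    ∏ i ∈ Finset.range n, φ (T^[i] (x + 1)) = ∏ i ∈ Finset.range n, φ (T^[i] x) :=
  Finset.prod_congr rfl fun i _ => by rw [lift_iterate h i x, per_int hφ]

theorem sum_fix_words (hq : 2 ≤ q) (hd : d.natAbs = q) (h : IsCircleLift T d) (hc : Continuous T)
    {μ : ℝ} (hμ : 1 < μ) (hx : ∀ x y, μ * |x - y| ≤ |T x - T y|)
    (hH : ∀ x, T (H x) = ((x.hd : ℕ) : ℝ) + H x.sh) {fx : List (Fin q) → Xq q}
    (hfx : ∀ w, (Xq.sys q κ hκ hκ1).ψw w (fx w) = fx w)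
    {n : ℕ} (hn : n ≠ 0) {f : ℝ → ℂ} (hf : ∀ x, f (x + 1) = f x) :
    ∑ᶠ x ∈ periodicPtsIn T n, f x =
      wsum n (fun w => f (H (fx w))) - sg d ^ n * f (H (Xq.xsp q d)) := by
  have hd1 : d ^ n ≠ 1 := by
    intro h1
    have h2 : (d ^ n).natAbs = 1 := by rw [h1]; rfl
    rw [Int.natAbs_pow, hd] at h2
    have := Nat.one_lt_pow hn (by omega : 1 < q)
    omega
  have hl := lift_iterate h n
  obtain ⟨X, hX, hXu⟩ := exists_sol hl hd1 (hc.iterate n) (one_lt_pow₀ hμ hn)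
    (expand_iterate (by linarith) hx n)
  rw [show periodicPtsIn T n = {x : ℝ | x ∈ Set.Ico (0:ℝ) 1 ∧ ∃ k : ℤ, T^[n] x = x + k} from rfl,
    fix_words hq hd hn hl hX hXu hf]
  rw [← hXu _ _ (iter_xsp h hH n)]
  congr 1
  refine wsum_congr fun w hw => ?_
  have := iter_H (hκ := hκ) (hκ1 := hκ1) h hH w (fx w)
  rw [hfx, hw] at this
  rw [← hXu _ _ this]

theorem exp_birkhoff (T G : ℝ → ℝ) (n : ℕ) (x : ℝ) :
    Real.exp (birkhoff T G n x) = ∏ i ∈ Finset.range n, Real.exp (G (T^[i] x)) := by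
  rw [birkhoff, Real.exp_sum]

theorem deriv_iter {τ : ℝ → ℝ} (hτ : ∀ x, HasDerivAt T (τ x) x) (n : ℕ) (x : ℝ) :
    HasDerivAt (T^[n]) (∏ i ∈ Finset.range n, τ (T^[i] x)) x := by
  induction n with
  | zero => simpa using hasDerivAt_id x
  | succ n ih =>
    rw [Function.iterate_succ', Finset.prod_range_succ, mul_comm]
    exact (hτ (T^[n] x)).comp x ih

theorem hZ_thm (hq : 2 ≤ q) (hd : d.natAbs = q) (h : IsCircleLift T d) (hc : Continuous T)
    {μ : ℝ} (hμ : 1 < μ) (hx : ∀ x y, μ * |x - y| ≤ |T x - T y|)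
    (hH : ∀ x, T (H x) = ((x.hd : ℕ) : ℝ) + H x.sh) {fx : List (Fin q) → Xq q}
    (hfx : ∀ w, (Xq.sys q κ hκ hκ1).ψw w (fx w) = fx w)
    {G : ℝ → ℝ} (hG : ∀ x, G (x + 1) = G x) {u : (Xq.sys q κ hκ hκ1).E}
    (hu : ∀ x, fn u x = (Real.exp (G (H x)) : ℂ)) {n : ℕ} (hn : n ≠ 0) :
    ((∑ᶠ x ∈ periodicPtsIn T n, Real.exp (birkhoff T G n x) : ℝ) : ℂ) =
        Zs fx u n - sg d ^ n * fn u (Xq.xsp q d) ^ n := by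
  have hφ : ∀ x, (fun x => Real.exp (G x)) (x + 1) = (fun x => Real.exp (G x)) x := fun x => by
    simp only [hG]
  have hf : ∀ x, ((Real.exp (birkhoff T G n (x + 1)) : ℝ) : ℂ) = (Real.exp (birkhoff T G n x) : ℝ) := by
    intro x
    rw [exp_birkhoff, exp_birkhoff, prod_periodic (φ := fun x => Real.exp (G x)) h n hφ]
  have h1 := sum_fix_words hq hd h hc hμ hx hH hfx hn
    (f := fun x => ((Real.exp (birkhoff T G n x) : ℝ) : ℂ)) hf
  have h2 : ((∑ᶠ x ∈ periodicPtsIn T n, Real.exp (birkhoff T G n x) : ℝ) : ℂ) =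
      ∑ᶠ x ∈ periodicPtsIn T n, ((Real.exp (birkhoff T G n x) : ℝ) : ℂ) := by
    by_cases hfin : (periodicPtsIn T n).Finite
    · rw [finsum_mem_eq_finite_toFinset_sum _ hfin, finsum_mem_eq_finite_toFinset_sum _ hfin]
      push_cast; rfl
    · rw [finsum_mem_eq_zero_of_infinite, finsum_mem_eq_zero_of_infinite]
      · simp
      · refine Set.Infinite.mono (fun x hx => ⟨hx, ?_⟩) hfin
        rw [Function.mem_support]; exact_mod_cast (Real.exp_pos _).ne'
      · refine Set.Infinite.mono (fun x hx => ⟨hx, ?_⟩) hfin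
        rw [Function.mem_support]; exact (Real.exp_pos _).ne'
  rw [h2, h1, Zs]
  congr 1
  · refine wsum_congr fun w hw => ?_
    rw [P_H (φ := fun x => Real.exp (G x)) h hH hφ hu, hfx, hw, exp_birkhoff]
  · rw [hu, exp_birkhoff, prod_xsp (φ := fun x => Real.exp (G x)) h hH n hφ]
    push_cast; rfl

theorem hQ_thm (hq : 2 ≤ q) (hd : d.natAbs = q) (h : IsCircleLift T d) (hc : Continuous T)
    {μ : ℝ} (hμ : 1 < μ) (hx : ∀ x y, μ * |x - y| ≤ |T x - T y|)
    (hH : ∀ x, T (H x) = ((x.hd : ℕ) : ℝ) + H x.sh) {fx : List (Fin q) → Xq q}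
    (hfx : ∀ w, (Xq.sys q κ hκ hκ1).ψw w (fx w) = fx w)
    {G : ℝ → ℝ} (hG : ∀ x, G (x + 1) = G x) {u v : (Xq.sys q κ hκ hκ1).E}
    (hu : ∀ x, fn u x = (Real.exp (G (H x)) : ℂ)) {τ : ℝ → ℝ} (hτ : ∀ x, HasDerivAt T (τ x) x)
    (hv : ∀ x, fn v x = (((τ (H x))⁻¹ : ℝ) : ℂ)) {n : ℕ} (hn : n ≠ 0) :
    ∑ᶠ x ∈ periodicPtsIn T n,
      ((Real.exp (birkhoff T G n x) / (1 - (deriv (T^[n]) x)⁻¹) : ℝ) : ℂ) =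
        Qn fx (Xq.xsp q d) (sg d) u v n := by
  have hφ : ∀ x, (fun x => Real.exp (G x)) (x + 1) = (fun x => Real.exp (G x)) x := fun x => by
    simp only [hG]
  have hτp : ∀ x, τ (x + 1) = τ x := by
    intro x
    have h1 : HasDerivAt (fun y => T (y + 1)) (τ (x + 1)) x := (hτ (x + 1)).comp_add_const x 1
    have h2 : (fun y => T (y + 1)) = fun y => T y + d := funext h
    rw [h2] at h1
    exact h1.unique ((hτ x).add_const _)
  have hτ' : ∀ x, (fun x => (τ x)⁻¹) (x + 1) = (fun x => (τ x)⁻¹) x := fun x => by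
    simp only [hτp]
  have hder : ∀ x, (deriv (T^[n]) x)⁻¹ = ∏ i ∈ Finset.range n, (τ (T^[i] x))⁻¹ := by
    intro x; rw [(deriv_iter hτ n x).deriv, Finset.prod_inv_distrib]
  have h1 := sum_fix_words hq hd h hc hμ hx hH hfx hn
    (f := fun x => ((Real.exp (birkhoff T G n x) / (1 - (deriv (T^[n]) x)⁻¹) : ℝ) : ℂ)) (by
      intro x
      simp only [hder]
      rw [exp_birkhoff, exp_birkhoff, prod_periodic (φ := fun x => Real.exp (G x)) h n hφ, prod_periodic (φ := fun x => (τ x)⁻¹) h n hτ'])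
  rw [h1, Qn]
  congr 1
  · refine wsum_congr fun w hw => ?_
    rw [P_H (φ := fun x => Real.exp (G x)) h hH hφ hu, P_H (φ := fun x => (τ x)⁻¹) h hH hτ' hv, hfx, hw,
      exp_birkhoff, hder]
    push_cast; rfl
  · rw [hu, hv, exp_birkhoff, hder, prod_xsp (φ := fun x => Real.exp (G x)) h hH n hφ,
      prod_xsp (φ := fun x => (τ x)⁻¹) h hH n hτ']
    push_cast; rfl

/-- The special fixed point does not carry the whole pressure. -/
theorem hus_thm (hq : 2 ≤ q) (hd : d.natAbs = q) (h : IsCircleLift T d)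
    {μ : ℝ} (hμ : 1 < μ) (hx : ∀ x y, μ * |x - y| ≤ |T x - T y|)
    (hH : ∀ x, T (H x) = ((x.hd : ℕ) : ℝ) + H x.sh)
    {G : ℝ → ℝ} (hG : ∀ x, G (x + 1) = G x) {u : (Xq.sys q κ hκ hκ1).E}
    (hu : ∀ x, fn u x = (Real.exp (G (H x)) : ℂ)) (l : ℝ) (hh : Xq q → ℝ) (hl : 0 < l)
    (hpos : ∀ x, 0 < hh x)
    (heq : ∀ x, ∑ j : Fin q, (fn u ((Xq.sys q κ hκ hκ1).ψ j x)).re *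
      hh ((Xq.sys q κ hκ hκ1).ψ j x) = l * hh x) : ‖fn u (Xq.xsp q d)‖ < l := by
  have hre : ∀ x, (fn u x).re = Real.exp (G (H x)) := fun x => by rw [hu, Complex.ofReal_re]
  have hψ : ∀ j x, (Xq.sys q κ hκ hκ1).ψ j x = Xq.cons j.castSucc x := fun _ _ => rfl
  have key : ∀ (j : Fin q) x, Real.exp (G (H (Xq.cons j.castSucc x))) * hh (Xq.cons j.castSucc x) <
      l * hh x := by
    intro j x
    rw [← heq x]
    simp only [hre, hψ]
    obtain ⟨i, hi⟩ : ∃ i : Fin q, i ≠ j := by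
      have : Nontrivial (Fin q) := Fin.nontrivial_iff_two_le.2 hq
      exact exists_ne j
    exact Finset.single_lt_sum (f := fun j : Fin q => Real.exp (G (H (Xq.cons j.castSucc x))) *
      hh (Xq.cons j.castSucc x)) hi (Finset.mem_univ j) (Finset.mem_univ i)
      (mul_pos (Real.exp_pos _) (hpos _)) (fun k _ _ => (mul_pos (Real.exp_pos _) (hpos _)).le)
  rw [hu, Complex.norm_real, Real.norm_of_nonneg (Real.exp_pos _).le]
  by_cases hdp : 0 < d
  · have e : Xq.cons (Fin.castSucc (⟨0, by omega⟩ : Fin q)) (Xq.xsp q d) = Xq.xsp q d := by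
      refine Xq.ext_s fun n => ?_
      cases n with
      | zero => simp [Xq.cons, Xq.xsp, cd, hdp]
      | succ n => rfl
    have := key ⟨0, by omega⟩ (Xq.xsp q d)
    rw [e] at this
    exact lt_of_mul_lt_mul_right this (hpos _).le
  · have hdq : d = -(q : ℤ) := by omega
    obtain ⟨x, y, hxy, hyx⟩ : ∃ x y : Xq q, x = Xq.cons (Fin.castSucc (⟨0, by omega⟩ : Fin q)) y ∧
        y = Xq.cons (Fin.castSucc (⟨q - 1, by omega⟩ : Fin q)) x := by
      refine ⟨⟨fun n => if Even n then (⟨0, by omega⟩ : Fin q).castSucc else (⟨q - 1, by omega⟩ : Fin q).castSucc⟩,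
        ⟨fun n => if Even n then (⟨q - 1, by omega⟩ : Fin q).castSucc else (⟨0, by omega⟩ : Fin q).castSucc⟩, ?_, ?_⟩
      · refine Xq.ext_s fun n => ?_
        cases n with
        | zero => simp [Xq.cons]
        | succ n => simp only [Xq.cons, Nat.even_add_one]; split_ifs <;> simp_all
      · refine Xq.ext_s fun n => ?_
        cases n with
        | zero => simp [Xq.cons]
        | succ n => simp only [Xq.cons, Nat.even_add_one]; split_ifs <;> simp_all
    have hTs : T (H (Xq.xsp q d)) = q + H (Xq.xsp q d) := by
      rw [hH]
      have e1 : (Xq.xsp q d).sh = Xq.xsp q d := rfl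
      have e2 : (((Xq.xsp q d).hd : ℕ) : ℝ) = (cd q d : ℝ) := rfl
      rw [e1, e2, cd, if_neg hdp]
    have hTx : T (H x) = H y := by
      rw [hH, hxy, Xq.hd_cons, Xq.sh_cons]; simp
    have hTy : T (H y) = q - 1 + H x := by
      rw [hH, hyx, Xq.hd_cons, Xq.sh_cons]
      simp only [Fin.val_castSucc]
      rw [Nat.cast_sub (by omega)]; simp
    have hTs1 : T (H (Xq.xsp q d) + 1) = H (Xq.xsp q d) := by
      rw [h, hTs, hdq]; push_cast; ring
    have a1 := hx (H y) (H (Xq.xsp q d))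
    have a2 := hx (H x) (H (Xq.xsp q d) + 1)
    rw [hTy, hTs, show (q : ℝ) - 1 + H x - (q + H (Xq.xsp q d)) = H x - (H (Xq.xsp q d) + 1) by ring] at a1
    rw [hTx, hTs1] at a2
    have p1 := abs_nonneg (H y - H (Xq.xsp q d))
    have p2 := abs_nonneg (H x - (H (Xq.xsp q d) + 1))
    have z1 : |H y - H (Xq.xsp q d)| = 0 := by nlinarith
    have z2 : |H x - (H (Xq.xsp q d) + 1)| = 0 := by nlinarith
    have f1 : H y = H (Xq.xsp q d) := by linarith [abs_eq_zero.1 z1]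
    have f2 : H x = H (Xq.xsp q d) + 1 := by linarith [abs_eq_zero.1 z2]
    have k1 := key ⟨0, by omega⟩ y
    have k2 := key ⟨q - 1, by omega⟩ x
    rw [← hxy, f2, hG] at k1
    rw [← hyx, f1] at k2
    have hx0 := hpos x
    have hy0 := hpos y
    by_contra hc
    push Not at hc
    have c1 : l * hh y ≤ Real.exp (G (H (Xq.xsp q d))) * hh y := by gcongr
    have c2 : l * hh x ≤ Real.exp (G (H (Xq.xsp q d))) * hh x := by gcongr
    have e0 := Real.exp_pos (G (H (Xq.xsp q d)))
    have d1 := lt_of_mul_lt_mul_left (k1.trans_le c1) e0.le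
    have d2 := lt_of_mul_lt_mul_left (k2.trans_le c2) e0.le
    linarith

end sym

theorem toBCF_apply {u : ℝ → ℝ} (hc : Continuous u) (hp : Function.Periodic u 1) (x : ℝ) :
    toBCF u x = u x := by
  have hb : ∃ C, ∀ x y, dist (u x) (u y) ≤ C :=
    Metric.isBounded_range_iff.1 (hp.compact_of_continuous one_ne_zero hc).isBounded
  rw [toBCF, dif_pos ⟨hc, hb⟩]
  rfl

theorem iteratedDeriv_periodic {u : ℝ → ℝ} (hp : Function.Periodic u 1) (j : ℕ) :
    Function.Periodic (iteratedDeriv j u) 1 := by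
  intro x
  have h1 : (fun z => u (z + 1)) = u := funext hp
  have h2 := congrFun (iteratedDeriv_comp_add_const j u 1) x
  rw [h1] at h2
  exact h2.symm

theorem deriv_lift_periodic {T : ℝ → ℝ} {d : ℤ} (h : IsCircleLift T d) :
    Function.Periodic (deriv T) 1 := by
  intro x
  rw [← deriv_comp_add_const, show (fun y => T (y + 1)) = fun y => T y + d from funext h,
    deriv_add_const]

theorem hasDerivAt_iteratedDeriv {u : ℝ → ℝ} {r : ℕ} (h : ContDiff ℝ r u) {j : ℕ} (hj : j < r) (x : ℝ) :
    HasDerivAt (iteratedDeriv j u) (iteratedDeriv (j + 1) u x) x := by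
  rw [iteratedDeriv_succ]
  exact ((h.differentiable_iteratedDeriv j (by exact_mod_cast hj)) x).hasDerivAt

theorem continuous_iteratedDeriv_le {u : ℝ → ℝ} {r : ℕ} (h : ContDiff ℝ r u) {j : ℕ} (hj : j ≤ r) :
    Continuous (iteratedDeriv j u) := h.continuous_iteratedDeriv j (by exact_mod_cast hj)

theorem fam_of {P : Type} [NormedAddCommGroup P] [NormedSpace ℝ P] {U : Set P} (hU : IsOpen U)
    {r N : ℕ} (hr : 4 ≤ r) (hN : 1 ≤ N) {lam : ℝ} (hlam : 0 < lam) (hlam1 : lam < 1)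
    {T G : P → ℝ → ℝ} (hT : ExpandingFamily N (r + 1) lam U T) (hG : PotentialFamily N r U G) :
    Fam U (min N (r - 2)) r lam T G (fun j t => toBCF (iteratedDeriv (j + 1) (T t)))
      (fun j t => toBCF (iteratedDeriv j (G t))) := by
  have hle : ((min N (r - 2) : ℕ) : WithTop ℕ∞) ≤ N := by exact_mod_cast min_le_left _ _
  have eT : ∀ t ∈ U, ∀ j ≤ r, ∀ x, toBCF (iteratedDeriv (j + 1) (T t)) x =
      iteratedDeriv (j + 1) (T t) x := by
    intro t ht j hj x
    obtain ⟨hcd, ⟨d, hd⟩, _⟩ := hT.1 t ht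
    refine toBCF_apply (continuous_iteratedDeriv_le hcd (by omega)) ?_ x
    rw [iteratedDeriv_succ']
    exact iteratedDeriv_periodic (deriv_lift_periodic hd) j
  have eG : ∀ t ∈ U, ∀ j ≤ r, ∀ x, toBCF (iteratedDeriv j (G t)) x = iteratedDeriv j (G t) x := by
    intro t ht j hj x
    obtain ⟨hcd, hp⟩ := hG.1 t ht
    exact toBCF_apply (continuous_iteratedDeriv_le hcd hj) (iteratedDeriv_periodic hp j) x
  refine ⟨hU, hT.2.2.1.of_le hle, ?_, ?_, ?_, ?_, ?_, ?_, ?_, by omega, by omega, hlam, hlam1⟩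
  · intro t ht x
    have := hasDerivAt_iteratedDeriv (hT.1 t ht).1 (j := 0) (by omega) x
    rw [iteratedDeriv_zero] at this
    rw [eT t ht 0 (by omega)]
    exact this
  · intro j hj
    exact (hT.2.2.2 (j + 1) (by omega) (by omega)).of_le hle
  · intro j hj t ht x
    have := hasDerivAt_iteratedDeriv (hT.1 t ht).1 (j := j + 1) (by omega) x
    rw [eT t ht (j + 1) (by omega), show (⇑(toBCF (iteratedDeriv (j + 1) (T t)))) =
      iteratedDeriv (j + 1) (T t) from funext (eT t ht j hj.le)]
    exact this
  · intro t ht x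
    rw [eG t ht 0 (by omega), iteratedDeriv_zero]
  · intro j hj
    exact (hG.2.2 j hj).of_le hle
  · intro j hj t ht x
    have := hasDerivAt_iteratedDeriv (hG.1 t ht).1 (j := j) hj x
    rw [eG t ht (j + 1) (by omega), show (⇑(toBCF (iteratedDeriv j (G t)))) =
      iteratedDeriv j (G t) from funext (eG t ht j hj.le)]
    exact this
  · intro t ht x
    rw [eT t ht 0 (by omega), zero_add, iteratedDeriv_one]
    exact (hT.1 t ht).2.2 x

/-- The degree is locally constant. -/
theorem Fam.degree {P : Type} [NormedAddCommGroup P] [NormedSpace ℝ P] {U : Set P} {n r : ℕ} {lam : ℝ}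
    {T G : P → ℝ → ℝ} {τ γ : ℕ → P → (ℝ →ᵇ ℝ)} (hF : Fam U n r lam T G τ γ) (h0 : 0 ∈ U)
    {dd : P → ℤ} (hdd : ∀ t ∈ U, IsCircleLift (T t) (dd t)) :
    ∃ V : Set P, IsOpen V ∧ 0 ∈ V ∧ V ⊆ U ∧ ∀ t ∈ V, dd t = dd 0 := by
  have hc : ContinuousOn (fun t => ‖τ 0 t - τ 0 0‖) U :=
    ((hF.τc 0 (Nat.zero_le _)).continuousOn.sub continuousOn_const).norm
  refine ⟨U ∩ (fun t => ‖τ 0 t - τ 0 0‖) ⁻¹' Iio 1, hc.isOpen_inter_preimage hF.hU isOpen_Iio,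
    ⟨h0, by simp⟩, inter_subset_left, ?_⟩
  rintro t ⟨ht, ht1⟩
  have ht1 : ‖τ 0 t - τ 0 0‖ < 1 := ht1
  have h1 : ‖(T t 1 - T 0 1) - (T t 0 - T 0 0)‖ ≤ ‖τ 0 t - τ 0 0‖ * ‖(1:ℝ) - 0‖ := by
    refine Convex.norm_image_sub_le_of_norm_hasDerivWithin_le (f := fun x => T t x - T 0 x)
      (f' := fun x => τ 0 t x - τ 0 0 x) (s := univ)
      (fun x _ => ((hF.Td t ht x).sub (hF.Td 0 h0 x)).hasDerivWithinAt) ?_ convex_univ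
      (mem_univ _) (mem_univ _)
    intro x _
    exact (τ 0 t - τ 0 0).norm_coe_le_norm x
  have e1 := hdd t ht 0
  have e2 := hdd 0 h0 0
  rw [zero_add] at e1 e2
  rw [e1, e2, sub_zero, norm_one, mul_one, show T t 0 + (dd t : ℝ) - (T 0 0 + (dd 0 : ℝ)) - (T t 0 - T 0 0) =
    ((dd t - dd 0 : ℤ) : ℝ) by push_cast; ring] at h1
  have h2 := h1.trans_lt ht1
  rw [Real.norm_eq_abs] at h2
  have h3 : |dd t - dd 0| < 1 := by exact_mod_cast h2
  have := Int.abs_lt_one_iff.1 h3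
  omega

open Sys in
/-- Positive Lipschitz weights belong to a cone. -/
theorem cone_of {q : ℕ} {κ : ℝ} {hκ : 0 < κ} {hκ1 : κ < 1} {u : (Xq.sys q κ hκ hκ1).E}
    {φ : Xq q → ℝ} (hu : ∀ x, fn u x = (φ x : ℂ)) {m : ℝ} (hm : 0 < m) (hφ : ∀ x, m ≤ φ x) :
    Cone (‖u‖ / m) u := by
  have hre : ∀ x, (fn u x).re = φ x := fun x => by rw [hu, Complex.ofReal_re]
  refine ⟨fun x => by rw [hu, Complex.ofReal_im], fun x => by rw [hre]; exact hm.le.trans (hφ x), ?_⟩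
  intro x y
  rw [hre, hre]
  have h1 := norm_fn_diff_le u x y
  rw [hu, hu, ← Complex.ofReal_sub, Complex.norm_real, Real.norm_eq_abs] at h1
  have h2 := (le_abs_self _).trans h1
  have hδ : 0 ≤ (Xq.sys q κ hκ hκ1).δ x y := Xq.dl_nonneg hκ x y
  have h3 := Real.add_one_le_exp (‖u‖ / m * (Xq.sys q κ hκ hκ1).δ x y)
  have h4 : (‖u‖ / m * (Xq.sys q κ hκ hκ1).δ x y + 1) * φ y ≤
      Real.exp (‖u‖ / m * (Xq.sys q κ hκ hκ1).δ x y) * φ y :=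
    mul_le_mul_of_nonneg_right h3 (hm.le.trans (hφ y))
  have h5 : ‖u‖ * (Xq.sys q κ hκ hκ1).δ x y ≤ ‖u‖ / m * (Xq.sys q κ hκ hκ1).δ x y * φ y := by
    have : ‖u‖ * (Xq.sys q κ hκ hκ1).δ x y = ‖u‖ / m * (Xq.sys q κ hκ hκ1).δ x y * m := by
      field_simp
    rw [this]
    exact mul_le_mul_of_nonneg_left (hφ y) (by positivity)
  linarith

theorem exponent_le (r N : ℕ) (e : WithTop ℕ∞) :
    min (min e ((r : WithTop ℕ∞) - 4)) ((N : WithTop ℕ∞) - 1) ≤ ((min N (r - 2) : ℕ) : WithTop ℕ∞) := by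
  have h1 : (N : WithTop ℕ∞) - 1 ≤ (N : WithTop ℕ∞) := by
    rw [tsub_le_iff_right]
    exact_mod_cast Nat.le_succ N
  have h2 : (r : WithTop ℕ∞) - 4 ≤ ((r - 2 : ℕ) : WithTop ℕ∞) := by
    rw [tsub_le_iff_right]
    exact_mod_cast (by omega : r ≤ r - 2 + 4)
  rcases le_total N (r - 2) with h | h
  · rw [min_eq_left h]; exact (min_le_right _ _).trans h1
  · rw [min_eq_right h]; exact (min_le_left _ _).trans ((min_le_right _ _).trans h2)

open Sys in
set_option maxHeartbeats 1000000 in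
theorem main_thm {Pm : Type} [NormedAddCommGroup Pm] [NormedSpace ℝ Pm] [CompleteSpace Pm]
    {U : Set Pm} (hU : IsOpen U) (h0U : (0 : Pm) ∈ U)
    {r N : ℕ} (hr : 4 ≤ r) (hN : 1 ≤ N)
    {lam : ℝ} (hlam : 0 < lam) (hlam1 : lam < 1)
    {T G : Pm → ℝ → ℝ}
    (hT : ExpandingFamily N (r + 1) lam U T)
    (hG : PotentialFamily N r U G) :
    ∃ R : ℝ, Real.exp (-pressureExp (T 0) (G 0)) < R ∧
    ∃ W : Set Pm, IsOpen W ∧ (0 : Pm) ∈ W ∧ W ⊆ U ∧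
    ∃ d : ℂ → Pm → ℂ,
      (∀ t ∈ W, ∃ ρ : ℝ, 0 < ρ ∧ ∀ z : ℂ, ‖z‖ < ρ →
        Summable fun n : ℕ => detCoeff (T t) (G t) n * z ^ n) ∧
      (∀ t ∈ W,
        DifferentiableOn ℂ (fun z => d z t) (Metric.ball 0 R) ∧
        ∃ ρ : ℝ, 0 < ρ ∧ ∀ z : ℂ, ‖z‖ < ρ →
          d z t = Complex.exp (-∑' n : ℕ, detCoeff (T t) (G t) n * z ^ n)) ∧
      (∀ t ∈ W,
        d ((Real.exp (-pressureExp (T t) (G t)) : ℝ) : ℂ) t = 0 ∧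
        (∀ z ∈ Metric.ball (0 : ℂ) R, d z t = 0 →
          z = ((Real.exp (-pressureExp (T t) (G t)) : ℝ) : ℂ)) ∧
        deriv (fun z => d z t) ((Real.exp (-pressureExp (T t) (G t)) : ℝ) : ℂ) ≠ 0) ∧
      ContDiffOn ℝ ((min N (r - 2) : ℕ) : WithTop ℕ∞)
        (fun p : ℂ × Pm => d p.1 p.2) (Metric.ball 0 R ×ˢ W) := by
  obtain ⟨τ, γ, hF⟩ : ∃ τ γ, Fam U (min N (r - 2)) r lam T G τ γ :=
    ⟨_, _, fam_of hU hr hN hlam hlam1 hT hG⟩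
  have hex : ∀ t, ∃ d : ℤ, t ∈ U → IsCircleLift (T t) d := fun t => by
    by_cases ht : t ∈ U
    · obtain ⟨d, hd⟩ := (hT.1 t ht).2.1
      exact ⟨d, fun _ => hd⟩
    · exact ⟨0, fun h => absurd h ht⟩
  choose dd hdd using hex
  obtain ⟨V, hVo, h0V, hVU, hdV⟩ := hF.degree h0U hdd
  obtain ⟨d, hd⟩ : ∃ d, d = dd 0 := ⟨_, rfl⟩
  have hlift : ∀ t ∈ V, IsCircleLift (T t) d := fun t ht => by
    rw [hd, ← hdV t ht]; exact hdd t (hVU ht)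
  have hμ : 1 < lam⁻¹ := (one_lt_inv₀ hlam).2 hlam1
  have hq : 2 ≤ d.natAbs := by
    have h1 := hF.expand h0U 1 0
    have h2 := hlift 0 h0V 0
    rw [zero_add] at h2
    rw [h2, add_sub_cancel_left, sub_zero, abs_one, mul_one] at h1
    have h3 : (1 : ℝ) < |(d : ℝ)| := hμ.trans_le h1
    have h4 : 1 < |d| := by exact_mod_cast h3
    rw [Int.abs_eq_natAbs] at h4; omega
  have hcont : ∀ t ∈ V, Continuous (T t) := fun t ht => (hT.1 t (hVU ht)).1.continuous
  have hs : Function.Surjective (T 0) := lift_surj (hlift 0 h0V) (by omega) (hcont 0 h0V)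
  have hκ : 0 < (lam + 1) / 2 := by linarith
  have hlk : lam < (lam + 1) / 2 := by linarith
  have hk1 : (lam + 1) / 2 < 1 := by linarith
  obtain ⟨W1, hW1o, h0W1, hW1U, H, uv, hcd, hprop⟩ := hF.exists_uv h0U d.natAbs hκ hlk hk1 hs
  obtain ⟨fx, hfx⟩ := Xq.exists_fx (q := d.natAbs) (hκ := hκ) (hκ1 := hk1)
  have : Nonempty (Fin d.natAbs) := ⟨⟨0, by omega⟩⟩
  have hGp : ∀ t ∈ V, ∀ x, G t (x + 1) = G t x := fun t ht => (hG.1 t (hVU ht)).2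
  have h0W : (0 : Pm) ∈ W1 ∩ V := ⟨h0W1, h0V⟩
  have hlow : ∀ x, Real.exp (-‖γ 0 0‖) ≤ Real.exp (G 0 (H 0 x)) := fun x => by
    rw [Real.exp_le_exp, ← hF.Gg 0 h0U]
    exact neg_le_of_abs_le ((γ 0 0).norm_coe_le_norm _)
  have hcone := cone_of (hprop 0 h0W1).2.1 (Real.exp_pos (-‖γ 0 0‖)) hlow
  obtain ⟨R, hR, W, hWo, hW0, hWW, D, hD⟩ := assembly (S := Xq.sys d.natAbs ((lam + 1) / 2) hκ hk1)
    (Xq.xsp d.natAbs d) fx hfx (Xq.xsp d.natAbs d) (norm_sg d) (hW1o.inter hVo) h0W uv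
    (k := min N (r - 2)) (hcd.mono inter_subset_left) (by positivity) hcone
    (fun t ht x => by
      rw [(hprop t ht.1).2.1 x, Complex.ofReal_im, Complex.ofReal_re]
      exact ⟨rfl, Real.exp_pos _⟩)
    (c := lam) hlk
    (fun x => by
      rw [(hprop 0 h0W1).2.2 x, Complex.norm_real, norm_inv, Real.norm_eq_abs]
      exact inv_le_of_inv_le₀ hlam (hF.ex 0 h0U _))
    (hus_thm hq rfl (hlift 0 h0V) hμ (hF.expand h0U) (hprop 0 h0W1).1 (hGp 0 h0V) (hprop 0 h0W1).2.1)
    T G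
    (fun t ht n hn => hZ_thm hq rfl (hlift t ht.2) (hcont t ht.2) hμ (hF.expand (hVU ht.2))
      (hprop t ht.1).1 hfx (hGp t ht.2) (hprop t ht.1).2.1 hn)
    (fun t ht n hn => hQ_thm hq rfl (hlift t ht.2) (hcont t ht.2) hμ (hF.expand (hVU ht.2))
      (hprop t ht.1).1 hfx (hGp t ht.2) (hprop t ht.1).2.1 (hF.Td t (hVU ht.2)) (hprop t ht.1).2.2 hn)
  exact ⟨R, hR, W, hWo, hW0, fun t ht => hVU (hWW ht).2, D, hD⟩

/-- Theorem `main`, regularity of dynamical determinants.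
Let `U ∋ 0` be open in `ℝ^D`, `r ≥ 4`, `N ≥ 1`, `t ↦ T_t` a `C^N` family of `C^{r+1}`
expanding maps of the circle with expansion constant `λ⁻¹ > 1`, `t ↦ g_t` a `C^N`
family of `C^r` potentials, and `k = min (⌊r/2 − 7/4⌋, r − 4, N − 1)`.  Then there
are `R > e^{−P_0(g_0)}` and a neighbourhood `W` of `0` in `U` such that:
(i) for `t ∈ W` the power series `∑_{n ≥ 1} (1/n)(∑_{T_t^n x = x}
e^{g_{n,t}(x)}/(1 − ((T_t^n)'(x))⁻¹)) z^n` has a nonzero radius of convergence;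
(ii) for `t ∈ W` the function `exp` of minus this series extends holomorphically to
`d(·, t)` on the disc `D(0,R)`; (iii) `e^{−P_t(g_t)}` is the unique zero of `d(·,t)`
in `D(0,R)`, and it is simple; (iv) `(z,t) ↦ d(z,t)` is `C^k` on `D(0,R) × W`. -/
theorem statement0
    (D : ℕ) (U : Set (Fin D → ℝ)) (hU : IsOpen U) (h0U : (0 : Fin D → ℝ) ∈ U)
    (r N : ℕ) (hr : 4 ≤ r) (hN : 1 ≤ N)
    (lam : ℝ) (hlam : 0 < lam) (hlam1 : lam < 1)
    (T G : (Fin D → ℝ) → ℝ → ℝ)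
    (hT : ExpandingFamily N (r + 1) lam U T)
    (hG : PotentialFamily N r U G) :
    ∃ R : ℝ, Real.exp (-pressureExp (T 0) (G 0)) < R ∧
    ∃ W : Set (Fin D → ℝ), IsOpen W ∧ (0 : Fin D → ℝ) ∈ W ∧ W ⊆ U ∧
    ∃ d : ℂ → (Fin D → ℝ) → ℂ,
      -- (i) the power series has a nonzero radius of convergence
      (∀ t ∈ W, ∃ ρ : ℝ, 0 < ρ ∧ ∀ z : ℂ, ‖z‖ < ρ →
        Summable fun n : ℕ => detCoeff (T t) (G t) n * z ^ n) ∧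
      -- (ii) holomorphic extension of the dynamical determinant to `D(0,R)`
      (∀ t ∈ W,
        DifferentiableOn ℂ (fun z => d z t) (Metric.ball 0 R) ∧
        ∃ ρ : ℝ, 0 < ρ ∧ ∀ z : ℂ, ‖z‖ < ρ →
          d z t = Complex.exp (-∑' n : ℕ, detCoeff (T t) (G t) n * z ^ n)) ∧
      -- (iii) `e^{−P_t(g_t)}` is the unique zero of `d(·,t)`, and it is simple
      (∀ t ∈ W,
        d ((Real.exp (-pressureExp (T t) (G t)) : ℝ) : ℂ) t = 0 ∧
        (∀ z ∈ Metric.ball (0 : ℂ) R, d z t = 0 →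
          z = ((Real.exp (-pressureExp (T t) (G t)) : ℝ) : ℂ)) ∧
        deriv (fun z => d z t) ((Real.exp (-pressureExp (T t) (G t)) : ℝ) : ℂ) ≠ 0) ∧
      -- (iv) `(z, t) ↦ d(z, t)` is `C^k`
      ContDiffOn ℝ (min (min (⌊(r : ℝ) / 2 - 7/4⌋.toNat) (r - 4)) (N - 1))
        (fun p : ℂ × (Fin D → ℝ) => d p.1 p.2) (Metric.ball 0 R ×ˢ W) := by
  obtain ⟨R, hR, W, hWo, hW0, hWU, d, h1, h2, h3, h4⟩ := main_thm hU h0U hr hN hlam hlam1 hT hG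
  exact ⟨R, hR, W, hWo, hW0, hWU, d, h1, h2, h3, h4.of_le (exponent_le r N _)⟩
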